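/- arXiv:1210.0740 — 3 statements merged into one kernel-verified Lean document; each statement's English description precedes it below -/
import Mathlib

section
/- For each j ∈ {1,2}, each real A > 0 and each integer B ≥ 0 there exists a constant C depending only on j, A, B such that for every integer k ≥ 2 and every real ξ > 0, the B-th derivative of V_{k,j} satisfies |(ξ/k^j)^B · V_{k,j}^{(B)}(ξ)| ≤ C (1 + ξ/k^j)^{−A}. -/
noncomputable section

/-- e(x) = exp(2πi x) -/
def ee (x : ℝ) : ℂ := Complex.exp (2 * Real.pi * Complex.I * x)

/-- Bessel function of integer order: J_ℓ(x) = ∫_{-1/2}^{1/2} e(ℓt) e^{-ix sin(2πt)} dt -/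
def besselJ (ℓ : ℕ) (x : ℝ) : ℂ :=
  ∫ t in (-(1:ℝ)/2)..(1/2), ee (ℓ * t) * Complex.exp (-Complex.I * x * Real.sin (2 * Real.pi * t))

/-- Kloosterman sum S(n,m;c) -/
def kloos (n m : ℤ) (c : ℕ) : ℂ :=
  ∑ b ∈ Finset.range c, if Nat.Coprime b c then
    ee (((((n : ZMod c) * (b : ZMod c) + (m : ZMod c) * (b : ZMod c)⁻¹).val : ℕ) : ℝ) / c)
  else 0

/-- Λ_{k,j}(s) -/
def Lam (j : ℕ) (k : ℝ) (s : ℂ) : ℂ :=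
  if j = 1 then (2 * Real.pi : ℂ) ^ (-s) * Complex.Gamma (s + (k : ℂ) - 1/2)
  else 8 * (2 * Real.pi : ℂ) ^ (-3*s - 3*(k:ℂ) + 3/2) * Complex.Gamma (s + 2*(k:ℂ) - 3/2) *
    Complex.Gamma (s + (k:ℂ) - 1/2) * Complex.Gamma (s + 1/2)

/-- V_{k,j}(ξ), contour integral on Re s = 1 -/
def V (j : ℕ) (k : ℝ) (ξ : ℝ) : ℂ :=
  (1 / (2 * Real.pi * Complex.I)) * ∫ t : ℝ,
    (Lam j k (1/2 + (1 + (t:ℂ) * Complex.I)) / Lam j k (1/2)) *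
      (ξ : ℂ) ^ (-(1 + (t:ℂ) * Complex.I)) / (1 + (t:ℂ) * Complex.I) * Complex.I

/-- Fourier transform ĥ(t) = ∫ h(v) e(−vt) dv -/
def fhat (h : ℝ → ℂ) (t : ℝ) : ℂ := ∫ v : ℝ, h v * ee (-(v * t))

end

section mine
open Complex MeasureTheory Set Filter Topology

lemma my_norm_Gamma_le {s : ℂ} (hs : 0 < s.re) : ‖Complex.Gamma s‖ ≤ Real.Gamma s.re := by
  rw [Complex.Gamma_eq_integral hs, Real.Gamma_eq_integral hs, Complex.GammaIntegral]
  refine (norm_integral_le_integral_norm _).trans (le_of_eq ?_)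
  refine setIntegral_congr_fun measurableSet_Ioi fun x hx => ?_
  have hx : 0 < x := hx
  simp only [norm_mul, Complex.norm_real, Complex.norm_cpow_eq_rpow_re_of_pos hx, Real.norm_eq_abs,
    Real.abs_exp, Complex.sub_re, Complex.one_re]

lemma my_Gamma_mul_le {s : ℂ} (hs : 0 < s.re) :
    ‖Complex.Gamma s‖ ≤ Real.Gamma (s.re + 1) / ‖s‖ := by
  have h0 : s ≠ 0 := by rintro rfl; simp at hs
  rw [le_div_iff₀ (norm_pos_iff.2 h0), mul_comm, ← norm_mul, ← Complex.Gamma_add_one s h0]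
  simpa using my_norm_Gamma_le (s := s + 1) (by simp; linarith)

lemma my_vert (g : ℝ → ℂ) (hg : Continuous g) (K : ℝ)
    (hb : ∀ t : ℝ, ‖g t‖ ≤ K / ‖(1 + (t:ℂ) * I)‖ ^ 2) : Integrable g := by
  refine Integrable.mono' (integrable_inv_one_add_sq.const_mul K) hg.aestronglyMeasurable ?_
  refine Eventually.of_forall fun t => (hb t).trans (le_of_eq ?_)
  rw [← Complex.normSq_eq_norm_sq]
  simp [Complex.normSq_apply, div_eq_mul_inv, pow_two]

lemma my_Gamma_cont (a : ℝ) (ha : 0 ≤ a) :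
    Continuous (fun t : ℝ => Complex.Gamma (1 + (t:ℂ) * I + a)) := by
  rw [continuous_iff_continuousAt]
  intro t
  have : ContinuousAt Complex.Gamma (1 + (t:ℂ) * I + a) := by
    refine (Complex.differentiableAt_Gamma _ fun m h => ?_).continuousAt
    have := congrArg Complex.re h
    simp at this
    have : (0:ℝ) ≤ m := by positivity
    linarith
  exact ContinuousAt.comp (f := fun t : ℝ => 1 + (t:ℂ) * I + a) this (by fun_prop)

lemma my_inv (f : ℝ → ℂ) (m : ℂ → ℂ) (hf : ∀ t : ℝ, HasMellin f (1 + (t:ℂ) * I) (m (1 + (t:ℂ) * I)))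
    (hm : Integrable fun t : ℝ => m (1 + (t:ℂ) * I)) {x : ℝ} (hx : 0 < x) (hc : ContinuousAt f x) :
    f x = (1 / (2 * Real.pi) : ℂ) * ∫ t : ℝ, (x : ℂ) ^ (-(1 + (t:ℂ) * I)) * m (1 + (t:ℂ) * I) := by
  have h1 : MellinConvergent f ((1:ℝ):ℂ) := by simpa using (hf 0).1
  rw [← mellinInv_mellin_eq 1 f hx h1 ?_ hc]
  · simp only [mellinInv, ofReal_one, smul_eq_mul, (hf _).2]
    simp
  · simp only [VerticalIntegrable, ofReal_one, (hf _).2]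
    exact hm

/-- Poisson weights. -/
noncomputable def qq (n : ℕ) (x : ℝ) : ℂ := ((x ^ n / n.factorial * Real.exp (-x) : ℝ) : ℂ)

noncomputable def ff (k : ℕ) (x : ℝ) : ℂ := ∑ i ∈ Finset.range k, qq i x

lemma qq_contDiff (n : ℕ) {m : WithTop ℕ∞} : ContDiff ℝ m (qq n) := by
  unfold qq
  have h : ContDiff ℝ m (fun x : ℝ => x ^ n / (n.factorial : ℝ) * Real.exp (-x)) := by fun_prop
  exact Complex.ofRealCLM.contDiff.comp h

lemma qq_deriv_zero : deriv (qq 0) = fun x => - qq 0 x := by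
  ext x
  refine HasDerivAt.deriv ?_
  have h : HasDerivAt (fun x : ℝ => x ^ 0 / (Nat.factorial 0) * Real.exp (-x)) (- (x ^ 0 / (Nat.factorial 0) * Real.exp (-x))) x := by
    simpa using (hasDerivAt_neg x).exp
  have := h.ofReal_comp
  rw [ofReal_neg] at this
  exact this

lemma qq_deriv_succ (n : ℕ) : deriv (qq (n+1)) = fun x => qq n x - qq (n+1) x := by
  ext x
  refine HasDerivAt.deriv ?_
  have h : HasDerivAt (fun x : ℝ => x ^ (n+1) / (Nat.factorial (n+1)) * Real.exp (-x))
      (x ^ n / (Nat.factorial n) * Real.exp (-x) - x ^ (n+1) / (Nat.factorial (n+1)) * Real.exp (-x)) x := by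
    convert! ((hasDerivAt_pow (n+1) x).div_const ((Nat.factorial (n+1) : ℕ) : ℝ)).mul (hasDerivAt_neg x).exp using 1
    rw [Nat.factorial_succ]
    have := Nat.factorial_ne_zero n
    push_cast
    field_simp
    ring
  have := h.ofReal_comp
  rw [ofReal_sub] at this
  exact this

lemma ff_deriv (k : ℕ) : deriv (ff (k+1)) = fun x => - qq k x := by
  induction k with
  | zero =>
    have : ff (0+1) = qq 0 := by ext x; simp [ff]
    rw [this, qq_deriv_zero]
  | succ k ih =>
    have : ff (k+1+1) = fun x => ff (k+1) x + qq (k+1) x := by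
      ext x; simp only [ff]; rw [Finset.sum_range_succ]
    rw [this]
    ext x
    rw [deriv_fun_add, ih, qq_deriv_succ]
    · ring
    · unfold ff
      have : ∀ i, Differentiable ℝ (qq i) := fun i => (qq_contDiff i (m := 1)).differentiable (by simp)
      exact DifferentiableAt.fun_sum fun i _ => this i x
    · exact (qq_contDiff _ (m := 1)).differentiable (by simp) x

lemma ff_contDiff (k : ℕ) {m : WithTop ℕ∞} : ContDiff ℝ m (ff k) := by
  unfold ff
  exact ContDiff.sum fun i _ => qq_contDiff i

lemma qq_norm (n : ℕ) {x : ℝ} (hx : 0 < x) : ‖qq n x‖ = x ^ n / n.factorial * Real.exp (-x) := by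
  rw [qq, Complex.norm_real, Real.norm_of_nonneg (by positivity)]

lemma sum_qq_norm_le (s : Finset ℕ) {x : ℝ} (hx : 0 < x) : ∑ i ∈ s, ‖qq i x‖ ≤ 1 := by
  obtain ⟨n, hn⟩ := Finset.exists_nat_subset_range s
  calc _ ≤ ∑ i ∈ Finset.range n, ‖qq i x‖ :=
        Finset.sum_le_sum_of_subset_of_nonneg hn fun _ _ _ => norm_nonneg _
    _ = (∑ i ∈ Finset.range n, x ^ i / i.factorial) * Real.exp (-x) := by
        simp only [qq_norm _ hx, Finset.sum_mul]
    _ ≤ Real.exp x * Real.exp (-x) := by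
        gcongr; exact Real.sum_le_exp_of_nonneg hx.le n
    _ = 1 := by rw [← Real.exp_add]; simp

lemma fact_ratio (n N : ℕ) : ((n + N).factorial : ℝ) ≤ (N + 1 : ℝ) ^ N * (n + 1 : ℝ) ^ N * n.factorial := by
  have h1 := Nat.factorial_mul_ascFactorial n N
  have h2 := Nat.ascFactorial_le_pow_add n N
  have h3 : (n + N) ^ N ≤ ((N + 1) * (n + 1)) ^ N := by gcongr; nlinarith
  rw [mul_pow] at h3
  have : (n + N).factorial ≤ (N + 1) ^ N * (n + 1) ^ N * n.factorial := by
    rw [← h1, mul_comm]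
    exact Nat.mul_le_mul_right _ (h2.trans h3)
  exact_mod_cast this

lemma qq_shift (n N : ℕ) {x : ℝ} (hx : 0 < x) :
    x ^ N * ‖qq n x‖ ≤ (N + 1 : ℝ) ^ N * (n + 1 : ℝ) ^ N * ‖qq (n + N) x‖ := by
  rw [qq_norm _ hx, qq_norm _ hx]
  have h := fact_ratio n N
  have h0 : (0:ℝ) < n.factorial := by positivity
  have h1 : (0:ℝ) < (n+N).factorial := by positivity
  have e1 : x ^ N * (x ^ n / n.factorial * Real.exp (-x)) = x ^ (n + N) * Real.exp (-x) * (1 / n.factorial) := by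
    rw [pow_add]; ring
  have e2 : (N + 1 : ℝ) ^ N * (n + 1 : ℝ) ^ N * (x ^ (n+N) / (n+N).factorial * Real.exp (-x))
    = x ^ (n + N) * Real.exp (-x) * ((N + 1 : ℝ) ^ N * (n + 1 : ℝ) ^ N / (n+N).factorial) := by ring
  rw [e1, e2]
  gcongr ?_ * ?_
  rw [div_le_div_iff₀ h0 h1]
  linarith

lemma qq_bound (N B : ℕ) (n : ℕ) {x : ℝ} (hx : 0 < x) :
    x ^ N * ‖iteratedDeriv B (qq n) x‖ ≤ 2 ^ B * (N + 1 : ℝ) ^ N * (n + 1 : ℝ) ^ N := by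
  induction B generalizing n with
  | zero =>
    refine (by simpa using qq_shift n N hx : _ ≤ _).trans ?_
    have : ‖qq (n+N) x‖ ≤ 1 := by simpa using sum_qq_norm_le {n+N} hx
    simpa using mul_le_mul_of_nonneg_left this (by positivity : (0:ℝ) ≤ (N + 1 : ℝ) ^ N * (n + 1 : ℝ) ^ N)
  | succ B ih =>
    rw [iteratedDeriv_succ']
    cases n with
    | zero =>
      rw [qq_deriv_zero, iteratedDeriv_fun_neg, norm_neg]
      refine (ih 0).trans ?_
      gcongr <;> norm_num
    | succ n =>
      rw [qq_deriv_succ, iteratedDeriv_fun_sub (qq_contDiff _).contDiffAt (qq_contDiff _).contDiffAt]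
      have h1 := ih n
      have h2 := ih (n+1)
      have h3 : (n + 1 : ℝ) ^ N ≤ (((n+1:ℕ):ℝ) + 1) ^ N := by push_cast; gcongr; linarith
      have h4 : (2:ℝ) ^ B * (N + 1 : ℝ) ^ N * (n + 1 : ℝ) ^ N ≤ 2 ^ B * (N + 1 : ℝ) ^ N * (((n+1:ℕ):ℝ) + 1) ^ N := by gcongr
      calc _ ≤ x ^ N * (‖iteratedDeriv B (qq n) x‖ + ‖iteratedDeriv B (qq (n+1)) x‖) := by
            gcongr; exact norm_sub_le _ _
        _ ≤ _ := by rw [pow_succ]; nlinarith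

lemma ff_bound (N B : ℕ) (n : ℕ) {x : ℝ} (hx : 0 < x) :
    x ^ N * ‖iteratedDeriv B (ff (n+1)) x‖ ≤ 2 ^ B * (N + 1 : ℝ) ^ N * (n + 1 : ℝ) ^ N := by
  cases B with
  | succ B =>
    rw [iteratedDeriv_succ', ff_deriv, iteratedDeriv_fun_neg, norm_neg]
    refine (qq_bound N B n hx).trans ?_
    gcongr <;> norm_num
  | zero =>
    simp only [iteratedDeriv_zero, pow_zero, one_mul]
    calc x ^ N * ‖ff (n+1) x‖ ≤ x ^ N * ∑ i ∈ Finset.range (n+1), ‖qq i x‖ := by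
          gcongr; exact norm_sum_le _ _
      _ = ∑ i ∈ Finset.range (n+1), x ^ N * ‖qq i x‖ := by rw [Finset.mul_sum]
      _ ≤ ∑ i ∈ Finset.range (n+1), (N + 1 : ℝ) ^ N * (n + 1 : ℝ) ^ N * ‖qq (i + N) x‖ := by
          refine Finset.sum_le_sum fun i hi => (qq_shift i N hx).trans ?_
          have : (i:ℝ) ≤ n := by exact_mod_cast Nat.lt_succ_iff.1 (Finset.mem_range.1 hi)
          gcongr
      _ = (N + 1 : ℝ) ^ N * (n + 1 : ℝ) ^ N * ∑ i ∈ (Finset.range (n+1)).map (addRightEmbedding N), ‖qq i x‖ := by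
          rw [Finset.sum_map, Finset.mul_sum]; rfl
      _ ≤ _ := by
          refine (mul_le_mul_of_nonneg_left (sum_qq_norm_le _ hx) (by positivity : (0:ℝ) ≤ (N + 1 : ℝ) ^ N * (n + 1 : ℝ) ^ N)).trans ?_
          rw [mul_one]

lemma qq_mellin (n : ℕ) {s : ℂ} (hs : 0 < s.re) : HasMellin (qq n) s (Complex.Gamma (s + n) / n.factorial) := by
  have hs' : 0 < (s + n).re := by simp; positivity
  have key : ∀ x ∈ Ioi (0:ℝ), (((-x).exp : ℝ) : ℂ) * (x:ℂ) ^ (s + n - 1) / n.factorial = (x:ℂ) ^ (s - 1) • qq n x := by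
    intro x hx
    have hx : 0 < x := hx
    have e : s + n - 1 = (s - 1) + n := by ring
    rw [e, Complex.cpow_add _ _ (by exact_mod_cast hx.ne'), Complex.cpow_natCast, qq, smul_eq_mul]
    push_cast
    ring
  constructor
  · exact IntegrableOn.congr_fun (Integrable.div_const (Complex.GammaIntegral_convergent hs') _) key measurableSet_Ioi
  · rw [mellin, ← setIntegral_congr_fun measurableSet_Ioi key, Complex.Gamma_eq_integral hs', Complex.GammaIntegral]
    rw [integral_div]

lemma ff_mellin (k : ℕ) {s : ℂ} (hs : 0 < s.re) :
    HasMellin (ff (k+1)) s (Complex.Gamma (s + (k + 1)) / (s * k.factorial)) := by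
  have h0 : s ≠ 0 := by rintro rfl; simp at hs
  induction k with
  | zero =>
    have : ff (0+1) = qq 0 := by ext x; simp [ff]
    rw [this]
    convert qq_mellin 0 hs using 1
    simp [Complex.Gamma_add_one s h0, h0]
  | succ k ih =>
    have : ff (k+1+1) = fun x => ff (k+1) x + qq (k+1) x := by
      ext x; simp only [ff]; rw [Finset.sum_range_succ]
    rw [this]
    have h := hasMellin_add ih.1 (qq_mellin (k+1) hs).1
    rw [ih.2, (qq_mellin (k+1) hs).2] at h
    convert h using 1
    have hk : s + (k + 1) ≠ 0 := by
      intro h; have := congrArg Complex.re h; simp at this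
      have : (0:ℝ) ≤ k := by positivity
      linarith
    have := Complex.Gamma_add_one _ hk
    push_cast
    rw [show s + (k + 1 + 1 : ℂ) = s + (k+1) + 1 by ring, this, Nat.factorial_succ]
    have h1 : (k.factorial : ℂ) ≠ 0 := by exact_mod_cast k.factorial_ne_zero
    have h2 : (k + 1 : ℂ) ≠ 0 := by exact_mod_cast k.succ_ne_zero
    push_cast
    field_simp
    ring

lemma V_one (k : ℕ) {ξ : ℝ} (hξ : 0 < ξ) : V 1 ((k+1 : ℕ) : ℝ) ξ = ff (k+1) (2 * Real.pi * ξ) := by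
  have hpi := Real.pi_pos
  have hk0 : (0:ℝ) ≤ k := by positivity
  rw [my_inv (ff (k+1)) (fun s => Complex.Gamma (s + (k + 1)) / (s * k.factorial))
    (fun t => ff_mellin k (by simp)) ?_ (by positivity) (ff_contDiff (m := 0) _).continuous.continuousAt]
  · rw [V, show (1 / (2 * Real.pi * I) : ℂ) = (1 / (2 * Real.pi)) * (1 / I) by field_simp, mul_assoc,
      ← integral_const_mul]
    congr 2
    ext t
    set s : ℂ := 1 + (t:ℂ) * I with hs
    have hs0 : s ≠ 0 := by intro h; have := congrArg Complex.re h; simp [hs] at this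
    have h1 : (k.factorial : ℂ) ≠ 0 := by exact_mod_cast k.factorial_ne_zero
    have h2 : (2 * Real.pi : ℂ) ≠ 0 := by simp [Real.pi_ne_zero]
    simp only [Lam, if_true]
    have e1 : (2 * Real.pi : ℂ) ^ (-(1/2 + s)) = (2 * Real.pi : ℂ) ^ (-(1/2) : ℂ) * (2 * Real.pi : ℂ) ^ (-s) := by
      rw [← Complex.cpow_add _ _ h2]; ring_nf
    have e2 : ((2 * Real.pi * ξ : ℝ) : ℂ) ^ (-s) = (2 * Real.pi : ℂ) ^ (-s) * (ξ : ℂ) ^ (-s) := by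
      rw [ofReal_mul, Complex.mul_cpow_ofReal_nonneg (by positivity) hξ.le]; push_cast; rfl
    have h3 : (2 * Real.pi : ℂ) ^ (-(1/2) : ℂ) ≠ 0 := by simp [Complex.cpow_eq_zero_iff, h2]
    have e3 : Complex.Gamma (1/2 + (((k+1:ℕ):ℝ):ℂ) - 1/2) = k.factorial := by
      rw [← Complex.Gamma_nat_eq_factorial]; congr 1; push_cast; ring
    have e4 : (1/2 + s + (((k+1:ℕ):ℝ):ℂ) - 1/2) = s + (k + 1) := by push_cast; ring
    rw [e1, e2, e3, e4]
    field_simp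
  · have hc := my_Gamma_cont (k+1) (by positivity)
    refine my_vert _ ?_ (Real.Gamma (1 + (k+1) + 1) / k.factorial) ?_
    · refine Continuous.div (by simpa using hc) (by fun_prop) fun t h => ?_
      have h1 : (k.factorial : ℂ) ≠ 0 := by exact_mod_cast k.factorial_ne_zero
      have := congrArg Complex.re ((mul_eq_zero.1 h).resolve_right h1)
      simp at this
    · intro t
      set s : ℂ := 1 + (t:ℂ) * I with hs
      have hsre : s.re = 1 := by simp [hs]
      have hspos : 0 < ‖s‖ := norm_pos_iff.2 (by intro h; rw [h] at hsre; simp at hsre)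
      have h := my_Gamma_mul_le (s := s + (k+1)) (by simp [hsre]; linarith)
      have hle : ‖s‖ ≤ ‖s + (k+1)‖ := by
        rw [← sq_le_sq₀ (by positivity) (by positivity), ← Complex.normSq_eq_norm_sq, ← Complex.normSq_eq_norm_sq]
        simp [Complex.normSq_apply, hs]
        nlinarith
      have hG : 0 ≤ Real.Gamma (1 + (k+1) + 1) := (Real.Gamma_pos_of_pos (by linarith)).le
      rw [norm_div, norm_mul, Complex.norm_natCast]
      have h5 : ‖Complex.Gamma (s + (k+1))‖ ≤ Real.Gamma (1 + (k+1) + 1) / ‖s‖ := by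
        refine h.trans ?_
        simp only [add_re, hsre, natCast_re, one_re]
        gcongr
      calc _ ≤ (Real.Gamma (1 + (k+1) + 1) / ‖s‖) / (‖s‖ * k.factorial) := by gcongr
        _ = _ := by field_simp

section gen
variable {Ω : Type*} [MeasurableSpace Ω] (μ : Measure Ω) [IsFiniteMeasure μ] (w : Ω → ℝ)

noncomputable def FF (B : ℕ) (x : ℝ) : ℂ := ∫ p, (((w p ^ B)⁻¹ * Real.exp (-(x / w p)) : ℝ) : ℂ) ∂μ

lemma exp_aux (N : ℕ) {y : ℝ} (hy : 0 ≤ y) : y ^ N * Real.exp (-y) ≤ N.factorial := by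
  have := Real.pow_div_factorial_le_exp y hy N
  rw [div_le_iff₀ (by positivity)] at this
  rw [Real.exp_neg, ← div_eq_mul_inv, div_le_iff₀ (Real.exp_pos _)]
  linarith

lemma FF_aux (M B : ℕ) {x v : ℝ} (hx : 0 < x) (hv : 0 < v) :
    x ^ (M + B) * ((v ^ B)⁻¹ * Real.exp (-(x / v))) ≤ (M + B).factorial * v ^ M := by
  have h := exp_aux (M + B) (y := x / v) (by positivity)
  calc _ = v ^ M * ((x / v) ^ (M + B) * Real.exp (-(x / v))) := by
        rw [div_pow, pow_add v]; field_simp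
    _ ≤ v ^ M * (M + B).factorial := by gcongr
    _ = _ := by ring

lemma FF_meas (hw : Measurable w) (B : ℕ) (x : ℝ) :
    AEStronglyMeasurable (fun p => (((w p ^ B)⁻¹ * Real.exp (-(x / w p)) : ℝ) : ℂ)) μ := by
  have : Measurable (fun p => (((w p ^ B)⁻¹ * Real.exp (-(x / w p)) : ℝ) : ℂ)) := by fun_prop
  exact this.aestronglyMeasurable

lemma FF_integrable (hw : Measurable w) (hpos : ∀ᵐ p ∂μ, 0 < w p) (B : ℕ) {x : ℝ} (hx : 0 < x) :
    Integrable (fun p => (((w p ^ B)⁻¹ * Real.exp (-(x / w p)) : ℝ) : ℂ)) μ := by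
  refine Integrable.mono' (integrable_const ((B.factorial : ℝ) / x ^ B)) (FF_meas μ w hw B x) ?_
  filter_upwards [hpos] with p hp
  rw [Complex.norm_real, Real.norm_of_nonneg (by positivity), le_div_iff₀ (by positivity)]
  have := FF_aux 0 B hx hp
  simp only [zero_add, pow_zero, mul_one] at this
  linarith

lemma FF_deriv (hw : Measurable w) (hpos : ∀ᵐ p ∂μ, 0 < w p) (B : ℕ) {x : ℝ} (hx : 0 < x) :
    HasDerivAt (FF μ w B) (- FF μ w (B+1) x) x := by
  have h := hasDerivAt_integral_of_dominated_loc_of_deriv_le (μ := μ) (s := Ioi (x/2)) (x₀ := x)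
    (F := fun x p => (((w p ^ B)⁻¹ * Real.exp (-(x / w p)) : ℝ) : ℂ))
    (F' := fun x p => -(((w p ^ (B+1))⁻¹ * Real.exp (-(x / w p)) : ℝ) : ℂ))
    (bound := fun _ => ((B+1).factorial : ℝ) / (x/2) ^ (B+1))
    (Ioi_mem_nhds (by linarith)) (Eventually.of_forall fun y => FF_meas μ w hw B y)
    (FF_integrable μ w hw hpos B hx) (FF_meas μ w hw (B+1) x).neg ?_ (integrable_const _) ?_
  · have h2 := h.2
    rw [integral_neg] at h2
    exact h2
  · filter_upwards [hpos] with p hp y hy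
    have hy : x/2 < y := hy
    have hy0 : 0 < y := by linarith
    rw [norm_neg, Complex.norm_real, Real.norm_of_nonneg (by positivity), le_div_iff₀ (by positivity)]
    have := FF_aux 0 (B+1) hy0 hp
    simp only [zero_add, pow_zero, mul_one] at this
    refine le_trans ?_ this
    rw [mul_comm]
    gcongr
  · filter_upwards [hpos] with p hp y hy
    have : HasDerivAt (fun y : ℝ => (w p ^ B)⁻¹ * Real.exp (-(y / w p)))
        (-((w p ^ (B+1))⁻¹ * Real.exp (-(y / w p)))) y := by
      convert! (((hasDerivAt_id y).div_const (w p)).neg.exp).const_mul ((w p ^ B)⁻¹) using 1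
      rw [pow_succ]
      field_simp
      simp
    have := this.ofReal_comp
    rw [ofReal_neg] at this
    exact this

lemma FF_iter (hw : Measurable w) (hpos : ∀ᵐ p ∂μ, 0 < w p) (B : ℕ) {x : ℝ} (hx : 0 < x) :
    iteratedDeriv B (FF μ w 0) x = (-1) ^ B * FF μ w B x := by
  induction B generalizing x with
  | zero => simp
  | succ B ih =>
    rw [iteratedDeriv_succ]
    have : iteratedDeriv B (FF μ w 0) =ᶠ[𝓝 x] fun x => (-1) ^ B * FF μ w B x := by
      filter_upwards [Ioi_mem_nhds hx] with y hy using ih hy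
    rw [this.deriv_eq, ((FF_deriv μ w hw hpos B hx).const_mul _).deriv]
    ring

lemma FF_bound (hpos : ∀ᵐ p ∂μ, 0 < w p) (M B : ℕ) {x : ℝ} (hx : 0 < x)
    (hi : Integrable (fun p => (w p : ℂ) ^ (M : ℂ)) μ) :
    x ^ (M + B) * ‖FF μ w B x‖ ≤ (M + B).factorial * ‖∫ p, (w p : ℂ) ^ (M : ℂ) ∂μ‖ := by
  have e : (fun p => (w p : ℂ) ^ (M : ℂ)) = fun p => ((w p ^ M : ℝ) : ℂ) := by
    ext p; rw [Complex.cpow_natCast]; push_cast; rfl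
  have hi' : Integrable (fun p => w p ^ M) μ := by
    rw [e] at hi
    exact hi.re
  have h1 : ‖∫ p, (w p : ℂ) ^ (M : ℂ) ∂μ‖ = ∫ p, w p ^ M ∂μ := by
    rw [e, integral_complex_ofReal, Complex.norm_real, Real.norm_of_nonneg]
    exact integral_nonneg_of_ae (by filter_upwards [hpos] with p hp; simp; positivity)
  rw [h1]
  have h2 : ‖FF μ w B x‖ ≤ ∫ p, ((M + B).factorial / x ^ (M + B)) * w p ^ M ∂μ := by
    refine norm_integral_le_of_norm_le (hi'.const_mul _) ?_
    filter_upwards [hpos] with p hp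
    rw [Complex.norm_real, Real.norm_of_nonneg (by positivity), div_mul_eq_mul_div, le_div_iff₀ (by positivity), mul_comm]
    exact FF_aux M B hx hp
  rw [integral_const_mul] at h2
  calc _ ≤ x ^ (M + B) * ((M + B).factorial / x ^ (M + B) * ∫ p, w p ^ M ∂μ) := by gcongr
    _ = _ := by field_simp

lemma FF_mellin (hw : Measurable w) (hpos : ∀ᵐ p ∂μ, 0 < w p) {s : ℂ} (hs : 0 < s.re)
    (hi : Integrable (fun p => (w p : ℂ) ^ s) μ) :
    HasMellin (FF μ w 0) s (Complex.Gamma s * ∫ p, (w p : ℂ) ^ s ∂μ) := by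
  let H : ℝ → Ω → ℂ := fun x p => (x : ℂ) ^ (s - 1) * ((Real.exp (-(x / w p)) : ℝ) : ℂ)
  have hHm : Measurable (Function.uncurry H) := by
    simp only [H, Function.uncurry_def]
    fun_prop
  have base : ∀ v : ℝ, 0 < v → IntegrableOn (fun x : ℝ => (x : ℂ) ^ (s - 1) * ((Real.exp (-(x / v)) : ℝ) : ℂ)) (Ioi 0) := by
    intro v hv
    have h := (qq_mellin 0 hs).1
    have h' := (MellinConvergent.comp_mul_left (f := qq 0) (s := s) (inv_pos.2 hv)).2 h
    refine IntegrableOn.congr_fun h' (fun x hx => ?_) measurableSet_Ioi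
    simp [qq, div_eq_inv_mul]
  have val : ∀ v : ℝ, 0 < v → ∫ x in Ioi (0:ℝ), (x : ℂ) ^ (s - 1) * ((Real.exp (-(x / v)) : ℝ) : ℂ) = Complex.Gamma s * (v : ℂ) ^ s := by
    intro v hv
    have h := Complex.integral_cpow_mul_exp_neg_mul_Ioi hs (inv_pos.2 hv)
    rw [mul_comm]
    convert h using 1
    · simp [div_eq_inv_mul]
    · simp
  have valn : ∀ v : ℝ, 0 < v → ∫ x in Ioi (0:ℝ), ‖(x : ℂ) ^ (s - 1) * ((Real.exp (-(x / v)) : ℝ) : ℂ)‖ = Real.Gamma s.re * ‖(v : ℂ) ^ s‖ := by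
    intro v hv
    have h := Real.integral_rpow_mul_exp_neg_mul_Ioi hs (inv_pos.2 hv)
    rw [mul_comm, Complex.norm_cpow_eq_rpow_re_of_pos hv]
    rw [one_div, inv_inv] at h
    rw [← h]
    refine setIntegral_congr_fun measurableSet_Ioi fun x hx => ?_
    have hx : 0 < x := hx
    simp only [norm_mul, Complex.norm_cpow_eq_rpow_re_of_pos hx, Complex.norm_real, Real.norm_eq_abs,
      Real.abs_exp, sub_re, one_re, div_eq_inv_mul]
  have hint : Integrable (Function.uncurry H) ((volume.restrict (Ioi (0:ℝ))).prod μ) := by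
    rw [integrable_prod_iff' hHm.aestronglyMeasurable]
    constructor
    · filter_upwards [hpos] with p hp using base _ hp
    · refine (hi.norm.const_mul (Real.Gamma s.re)).congr ?_
      filter_upwards [hpos] with p hp
      exact (valn _ hp).symm
  have eqF : ∀ x : ℝ, (x : ℂ) ^ (s - 1) • FF μ w 0 x = ∫ p, H x p ∂μ := by
    intro x
    simp only [H, FF, pow_zero, inv_one, one_mul, smul_eq_mul]
    rw [integral_const_mul]
  constructor
  · simp only [MellinConvergent, eqF]
    exact hint.integral_prod_left
  · simp only [mellin, eqF]
    rw [integral_integral_swap hint, ← integral_const_mul]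
    refine integral_congr_ae ?_
    filter_upwards [hpos] with p hp using val _ hp

end gen

noncomputable def nu (n : ℕ) : Measure ℝ :=
  (volume.restrict (Ioi 0)).withDensity
    (fun x => ((Real.toNNReal (x ^ n / n.factorial * Real.exp (-x)) : NNReal) : ENNReal))

lemma nu_pos (n : ℕ) : ∀ᵐ x ∂(nu n), 0 < x := by
  have h : ∀ᵐ x ∂(volume.restrict (Ioi (0:ℝ))), 0 < x := ae_restrict_mem measurableSet_Ioi
  exact (withDensity_absolutelyContinuous _ _).ae_le h

instance (n : ℕ) : SFinite (nu n) := by unfold nu; infer_instance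

lemma nu_moment (n : ℕ) {s : ℂ} (hs : 0 ≤ s.re) :
    Integrable (fun x : ℝ => (x:ℂ) ^ s) (nu n) ∧
      ∫ x : ℝ, (x:ℂ) ^ s ∂(nu n) = Complex.Gamma (s + 1 + n) / n.factorial := by
  have hm : Measurable (fun x : ℝ => Real.toNNReal (x ^ n / n.factorial * Real.exp (-x))) := by fun_prop
  have h := qq_mellin n (s := s + 1) (by simp; linarith)
  have key : ∀ x ∈ Ioi (0:ℝ), (x:ℂ) ^ (s + 1 - 1) • qq n x =
      Real.toNNReal (x ^ n / n.factorial * Real.exp (-x)) • (x:ℂ) ^ s := by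
    intro x hx
    have hx : 0 < x := hx
    rw [NNReal.smul_def, Real.coe_toNNReal _ (by positivity), add_sub_cancel_right, smul_eq_mul,
      Complex.real_smul, mul_comm]
    rfl
  constructor
  · rw [nu, integrable_withDensity_iff_integrable_smul hm]
    exact IntegrableOn.congr_fun h.1 key measurableSet_Ioi
  · rw [nu, integral_withDensity_eq_integral_smul hm, ← h.2, mellin]
    exact (setIntegral_congr_fun measurableSet_Ioi key).symm

instance (n : ℕ) : IsFiniteMeasure (nu n) := by
  have h := (nu_moment n (s := 0) (by simp)).1
  simp only [Complex.cpow_zero] at h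
  exact (integrable_const_iff_isFiniteMeasure one_ne_zero).1 h

noncomputable def cc : ℝ := (2 * Real.pi) ^ 3

lemma cc_pos : 0 < cc := by unfold cc; have := Real.pi_pos; positivity

noncomputable def ww (p : ℝ × ℝ) : ℝ := cc⁻¹ * (p.1 * p.2)

lemma ww_meas : Measurable ww := by unfold ww; fun_prop

lemma mu_pos2 (n m : ℕ) : ∀ᵐ p ∂((nu n).prod (nu m)), 0 < p.1 ∧ 0 < p.2 := by
  have h1 : ∀ᵐ p ∂((nu n).prod (nu m)), 0 < p.1 := Measure.quasiMeasurePreserving_fst.ae (nu_pos n)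
  have h2 : ∀ᵐ p ∂((nu n).prod (nu m)), 0 < p.2 := Measure.quasiMeasurePreserving_snd.ae (nu_pos m)
  filter_upwards [h1, h2] with p a b using ⟨a, b⟩

lemma mu_pos (n m : ℕ) : ∀ᵐ p ∂((nu n).prod (nu m)), 0 < ww p := by
  filter_upwards [mu_pos2 n m] with p hp
  exact mul_pos (inv_pos.2 cc_pos) (mul_pos hp.1 hp.2)

lemma mu_moment (n m : ℕ) {s : ℂ} (hs : 0 ≤ s.re) :
    Integrable (fun p => (ww p:ℂ) ^ s) ((nu n).prod (nu m)) ∧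
      ∫ p, (ww p:ℂ) ^ s ∂((nu n).prod (nu m)) = (cc : ℂ) ^ (-s) *
        (Complex.Gamma (s + 1 + n) / n.factorial * (Complex.Gamma (s + 1 + m) / m.factorial)) := by
  have key : (fun p : ℝ × ℝ => (cc : ℂ) ^ (-s) * ((p.1 : ℂ) ^ s * (p.2 : ℂ) ^ s)) =ᵐ[(nu n).prod (nu m)]
      (fun p => (ww p:ℂ) ^ s) := by
    filter_upwards [mu_pos2 n m] with p hp
    have hc := cc_pos
    rw [ww, ofReal_mul, Complex.mul_cpow_ofReal_nonneg (by positivity) (mul_pos hp.1 hp.2).le,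
      ofReal_mul, Complex.mul_cpow_ofReal_nonneg hp.1.le hp.2.le, ofReal_inv, Complex.inv_cpow, Complex.cpow_neg]
    rw [Complex.arg_ofReal_of_nonneg hc.le]
    exact Real.pi_pos.ne
  have h1 := nu_moment n hs
  have h2 := nu_moment m hs
  constructor
  · exact ((h1.1.mul_prod h2.1).const_mul _).congr key
  · rw [← integral_congr_ae key, integral_const_mul, integral_prod_mul (fun x : ℝ => (x:ℂ) ^ s) (fun x : ℝ => (x:ℂ) ^ s), h1.2, h2.2]

lemma V_two (k : ℕ) {ξ : ℝ} (hξ : 0 < ξ) :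
    V 2 ((k+1 : ℕ) : ℝ) ξ = FF ((nu (2*k)).prod (nu k)) ww 0 ξ := by
  have hpi := Real.pi_pos
  have hk0 : (0:ℝ) ≤ k := by positivity
  have hcc := cc_pos
  have hcc' : (cc : ℂ) ≠ 0 := by exact_mod_cast hcc.ne'
  rw [my_inv (FF ((nu (2*k)).prod (nu k)) ww 0) (fun s => Complex.Gamma s * ((cc : ℂ) ^ (-s) *
        (Complex.Gamma (s + 1 + (2*k : ℕ)) / (2*k).factorial * (Complex.Gamma (s + 1 + k) / k.factorial))))
    (fun t => ?_) ?_ hξ (FF_deriv _ _ ww_meas (mu_pos _ _) 0 hξ).continuousAt]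
  · rw [V, show (1 / (2 * Real.pi * I) : ℂ) = (1 / (2 * Real.pi)) * (1 / I) by field_simp, mul_assoc,
      ← integral_const_mul]
    congr 2
    ext t
    set s : ℂ := 1 + (t:ℂ) * I with hs
    have hs0 : s ≠ 0 := by intro h; have := congrArg Complex.re h; simp [hs] at this
    have h1 : (k.factorial : ℂ) ≠ 0 := by exact_mod_cast k.factorial_ne_zero
    have h1' : ((2*k).factorial : ℂ) ≠ 0 := by exact_mod_cast (2*k).factorial_ne_zero
    have h2 : (2 * Real.pi : ℂ) ≠ 0 := by simp [Real.pi_ne_zero]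
    simp only [Lam, if_neg (show ¬ (2 = 1) by norm_num)]
    set z : ℂ := (((k+1:ℕ):ℝ):ℂ) with hz
    have ecc : (cc : ℂ) ^ (-s) = (2 * Real.pi : ℂ) ^ (3 * (-s)) := by
      have : (cc : ℂ) = (2 * Real.pi : ℂ) ^ 3 := by simp [cc]
      rw [this]
      have ha : (2 * Real.pi : ℂ).arg = 0 := by
        rw [show (2 * Real.pi : ℂ) = ((2 * Real.pi : ℝ) : ℂ) by push_cast; rfl]
        exact Complex.arg_ofReal_of_nonneg (by positivity)
      exact (Complex.cpow_nat_mul' (n := 3) (by rw [ha]; simpa using hpi) (by rw [ha]; simpa using hpi.le) (-s)).symm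
    have e1 : (2 * Real.pi : ℂ) ^ (-3 * (1/2 + s) - 3 * z + 3/2) =
        (2 * Real.pi : ℂ) ^ (-3 * (1/2) - 3 * z + 3/2) * (cc : ℂ) ^ (-s) := by
      rw [ecc, ← Complex.cpow_add _ _ h2]; ring_nf
    have h3 : (2 * Real.pi : ℂ) ^ (-3 * (1/2) - 3 * z + 3/2) ≠ 0 := by simp [Complex.cpow_eq_zero_iff, h2]
    have e3 : Complex.Gamma (1/2 + z - 1/2) = k.factorial := by
      rw [← Complex.Gamma_nat_eq_factorial]; congr 1; rw [hz]; push_cast; ring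
    have e3' : Complex.Gamma (1/2 + 2 * z - 3/2) = (2*k).factorial := by
      rw [← Complex.Gamma_nat_eq_factorial]; congr 1; rw [hz]; push_cast; ring
    have e5 : Complex.Gamma (1/2 + 1/2) = 1 := by norm_num
    have e6 : Complex.Gamma (1/2 + s + 1/2) = s * Complex.Gamma s := by
      rw [← Complex.Gamma_add_one _ hs0]; congr 1; ring
    have e4 : (1/2 + s + z - 1/2) = s + 1 + k := by rw [hz]; push_cast; ring
    have e4' : (1/2 + s + 2 * z - 3/2) = s + 1 + (2*k : ℕ) := by rw [hz]; push_cast; ring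
    rw [e1, e3, e3', e4, e4', e5, e6]
    field_simp
  · have hc := my_Gamma_cont 0 le_rfl
    have hc1 := my_Gamma_cont (1 + (2*k : ℕ)) (by positivity)
    have hc2 := my_Gamma_cont (1 + k) (by positivity)
    refine my_vert _ ?_ (2 * (cc ^ (-1:ℝ) *
        (Real.Gamma (1 + 1 + (2*k : ℕ)) / (2*k).factorial * (Real.Gamma (1 + 1 + k) / k.factorial)))) ?_
    · refine Continuous.mul (by simpa using hc) (Continuous.mul ?_ (Continuous.mul ?_ ?_))
      · exact Continuous.const_cpow (by fun_prop) (Or.inl hcc')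
      · refine Continuous.div_const ?_ _
        simpa [add_assoc] using hc1
      · refine Continuous.div_const ?_ _
        simpa [add_assoc] using hc2
    · intro t
      set s : ℂ := 1 + (t:ℂ) * I with hs
      have hsre : s.re = 1 := by simp [hs]
      have hs0 : s ≠ 0 := by intro h; rw [h] at hsre; simp at hsre
      have hspos : 0 < ‖s‖ := norm_pos_iff.2 hs0
      have h := my_Gamma_mul_le (s := s + 1) (by simp [hsre])
      have g1 := my_norm_Gamma_le (s := s + 1 + (2*k : ℕ)) (by simp [hsre]; positivity)
      have g2 := my_norm_Gamma_le (s := s + 1 + k) (by simp [hsre]; positivity)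
      simp only [add_re, hsre, natCast_re, one_re] at h g1 g2
      have hle : ‖s‖ ≤ ‖s + 1‖ := by
        rw [← sq_le_sq₀ (by positivity) (by positivity), ← Complex.normSq_eq_norm_sq, ← Complex.normSq_eq_norm_sq]
        simp [Complex.normSq_apply, hs]
        nlinarith
      have g0 : ‖Complex.Gamma s‖ ≤ 2 / ‖s‖ ^ 2 := by
        have e0 := Complex.Gamma_add_one s hs0
        have e1 : Real.Gamma (1 + 1 + 1) = 2 := by
          have := Real.Gamma_nat_eq_factorial 2
          norm_num at this ⊢
        rw [e0, norm_mul, e1] at h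
        have h' : ‖s‖ * ‖Complex.Gamma s‖ ≤ 2 / ‖s‖ := h.trans (by gcongr)
        rw [le_div_iff₀ hspos] at h'
        rw [le_div_iff₀ (by positivity)]
        linarith
      have g3 : ‖(cc : ℂ) ^ (-s)‖ = cc ^ (-1 : ℝ) := by
        rw [Complex.norm_cpow_eq_rpow_re_of_pos hcc]; simp [hsre]
      simp only [norm_mul, norm_div, Complex.norm_natCast, g3]
      calc _ ≤ 2 / ‖s‖ ^ 2 * (cc ^ (-1:ℝ) *
        (Real.Gamma (1 + 1 + (2*k : ℕ)) / (2*k).factorial * (Real.Gamma (1 + 1 + k) / k.factorial))) := by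
            gcongr
        _ = _ := by ring
  · have hre : (1 + (t:ℂ) * I).re = 1 := by simp
    have hm := mu_moment (2*k) k (s := 1 + (t:ℂ) * I) (by rw [hre]; norm_num)
    rw [← hm.2]
    exact FF_mellin _ _ ww_meas (mu_pos _ _) (by rw [hre]; norm_num) hm.1

lemma final_red (j : ℕ)
    (H : ∀ N B : ℕ, B ≤ N → ∃ C : ℝ, ∀ k : ℕ, 2 ≤ k → ∀ ξ : ℝ, 0 < ξ →
      (ξ / (k : ℝ) ^ j) ^ N * ‖iteratedDeriv B (fun t : ℝ => V j (k : ℝ) t) ξ‖ ≤ C)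
    (A : ℝ) (B : ℕ) :
    ∃ C : ℝ, ∀ k : ℕ, 2 ≤ k → ∀ ξ : ℝ, 0 < ξ →
      ‖(((ξ / (k : ℝ) ^ j) ^ B : ℝ) : ℂ) * iteratedDeriv B (fun t : ℝ => V j (k : ℝ) t) ξ‖
        ≤ C * (1 + ξ / (k : ℝ) ^ j) ^ (-A) := by
  obtain ⟨n, hn⟩ := exists_nat_ge A
  obtain ⟨C0, h0⟩ := H B B le_rfl
  obtain ⟨C1, h1⟩ := H (B + n) B (by omega)
  refine ⟨2 ^ (n-1) * (C0 + C1), fun k hk ξ hξ => ?_⟩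
  have a0 := h0 k hk ξ hξ
  have a1 := h1 k hk ξ hξ
  have hk0 : (0:ℝ) < k := by exact_mod_cast (by omega : 0 < k)
  set y := ξ / (k : ℝ) ^ j with hy
  have hy0 : 0 < y := by positivity
  set D := ‖iteratedDeriv B (fun t : ℝ => V j (k : ℝ) t) ξ‖ with hD
  have hD0 : 0 ≤ D := norm_nonneg _
  rw [norm_mul, Complex.norm_real, Real.norm_of_nonneg (by positivity), Real.rpow_neg (by positivity),
    ← div_eq_mul_inv, le_div_iff₀ (by positivity), ← hD]
  have b1 : (1 + y) ^ A ≤ 2 ^ (n-1) * (1 ^ n + y ^ n) := by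
    calc (1 + y) ^ A ≤ (1 + y) ^ (n:ℝ) := Real.rpow_le_rpow_of_exponent_le (by linarith) hn
      _ = (1 + y) ^ n := Real.rpow_natCast _ _
      _ ≤ _ := add_pow_le zero_le_one hy0.le n
  calc y ^ B * D * (1 + y) ^ A ≤ y ^ B * D * (2 ^ (n-1) * (1 ^ n + y ^ n)) := by gcongr
    _ = 2 ^ (n-1) * (y ^ B * D + y ^ (B + n) * D) := by rw [pow_add, one_pow]; ring
    _ ≤ _ := by gcongr

lemma case_one (N B : ℕ) : ∃ C : ℝ, ∀ k : ℕ, 2 ≤ k → ∀ ξ : ℝ, 0 < ξ →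
      (ξ / (k : ℝ) ^ 1) ^ N * ‖iteratedDeriv B (fun t : ℝ => V 1 (k : ℝ) t) ξ‖ ≤ C := by
  have hpi := Real.pi_pos
  refine ⟨(2 * Real.pi) ^ B * ((2 * Real.pi) ^ N)⁻¹ * (2 ^ B * (N + 1 : ℝ) ^ N), fun k hk ξ hξ => ?_⟩
  obtain ⟨k, rfl⟩ : ∃ m, k = m + 1 := ⟨k - 1, by omega⟩
  have hx : 0 < 2 * Real.pi * ξ := by positivity
  have e : (fun t : ℝ => V 1 ((k+1 : ℕ) : ℝ) t) =ᶠ[𝓝 ξ] fun t => ff (k+1) ((2 * Real.pi) * t) := by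
    filter_upwards [Ioi_mem_nhds hξ] with t ht using V_one k ht
  rw [e.iteratedDeriv_eq, iteratedDeriv_comp_const_smul (ff_contDiff _)]
  simp only [smul_eq_mul]
  rw [norm_smul, Real.norm_of_nonneg (by positivity), pow_one]
  have h := ff_bound N B k hx
  set D := ‖iteratedDeriv B (ff (k+1)) (2 * Real.pi * ξ)‖
  have hk : (0:ℝ) < k + 1 := by positivity
  push_cast
  calc (ξ / (k + 1 : ℝ)) ^ N * ((2 * Real.pi) ^ B * D)
      = (2 * Real.pi) ^ B * ((2 * Real.pi) ^ N)⁻¹ * (((k+1:ℝ) ^ N)⁻¹ * ((2 * Real.pi * ξ) ^ N * D)) := by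
        rw [div_pow, mul_pow (2 * Real.pi)]; field_simp
    _ ≤ (2 * Real.pi) ^ B * ((2 * Real.pi) ^ N)⁻¹ * (((k+1:ℝ) ^ N)⁻¹ * (2 ^ B * (N + 1 : ℝ) ^ N * (k + 1 : ℝ) ^ N)) := by gcongr
    _ = _ := by field_simp

lemma case_two (N B : ℕ) (hNB : B ≤ N) : ∃ C : ℝ, ∀ k : ℕ, 2 ≤ k → ∀ ξ : ℝ, 0 < ξ →
      (ξ / (k : ℝ) ^ 2) ^ N * ‖iteratedDeriv B (fun t : ℝ => V 2 (k : ℝ) t) ξ‖ ≤ C := by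
  obtain ⟨M, rfl⟩ : ∃ M, N = M + B := ⟨N - B, by omega⟩
  have hcc := cc_pos
  refine ⟨(M + B).factorial * ((cc ^ M)⁻¹ * ((M + 1 : ℝ) ^ M * 2 ^ M * (M + 1 : ℝ) ^ M)), fun k hk ξ hξ => ?_⟩
  obtain ⟨k, rfl⟩ : ∃ m, k = m + 1 := ⟨k - 1, by omega⟩
  have e : (fun t : ℝ => V 2 ((k+1 : ℕ) : ℝ) t) =ᶠ[𝓝 ξ] FF ((nu (2*k)).prod (nu k)) ww 0 := by
    filter_upwards [Ioi_mem_nhds hξ] with t ht using V_two k ht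
  rw [e.iteratedDeriv_eq, FF_iter _ _ ww_meas (mu_pos _ _) B hξ]
  have hm := mu_moment (2*k) k (s := (M:ℂ)) (by simp)
  have h := FF_bound _ _ (mu_pos (2*k) k) M B hξ hm.1
  have g : ∀ n : ℕ, Complex.Gamma ((M:ℂ) + 1 + n) = ((n + M).factorial : ℂ) := by
    intro n
    rw [← Complex.Gamma_nat_eq_factorial]; congr 1; push_cast; ring
  rw [hm.2, g, g, Complex.cpow_neg, Complex.cpow_natCast] at h
  simp only [norm_mul, norm_div, norm_inv, norm_pow, Complex.norm_natCast, Complex.norm_real,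
    Real.norm_of_nonneg hcc.le] at h
  have f1 := fact_ratio (2*k) M
  have f2 := fact_ratio k M
  rw [← div_le_iff₀ (by positivity)] at f1 f2
  have hk : (1:ℝ) ≤ k + 1 := by simp
  have f3 : (((2*k : ℕ) : ℝ) + 1) ^ M ≤ 2 ^ M * (k + 1 : ℝ) ^ M := by
    rw [← mul_pow]; gcongr; push_cast; linarith
  have f4 : ((2*k + M).factorial : ℝ) / (2*k).factorial ≤ (M + 1 : ℝ) ^ M * (2 ^ M * (k + 1 : ℝ) ^ M) :=
    f1.trans (by gcongr)
  have h5 : ξ ^ (M + B) * ‖FF ((nu (2*k)).prod (nu k)) ww B ξ‖ ≤ (M + B).factorial * ((cc ^ M)⁻¹ *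
      (((M + 1 : ℝ) ^ M * (2 ^ M * (k + 1 : ℝ) ^ M)) * ((M + 1 : ℝ) ^ M * (k + 1 : ℝ) ^ M))) :=
    h.trans (by gcongr)
  have h6 : ((k + 1 : ℝ) ^ M * (k + 1 : ℝ) ^ M) ≤ ((k + 1 : ℝ) ^ 2) ^ (M + B) := by
    rw [← pow_add, ← pow_mul]
    exact pow_le_pow_right₀ hk (by omega)
  rw [norm_mul, norm_pow, norm_neg, norm_one, one_pow, one_mul, div_pow, div_mul_eq_mul_div]
  push_cast
  rw [div_le_iff₀ (by positivity)]
  refine h5.trans ?_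
  calc _ = (M + B).factorial * ((cc ^ M)⁻¹ * ((M + 1 : ℝ) ^ M * 2 ^ M * (M + 1 : ℝ) ^ M)) * ((k + 1 : ℝ) ^ M * (k + 1 : ℝ) ^ M) := by ring
    _ ≤ _ := by gcongr

end mine

theorem stmt9 (j : ℕ) (hj : j = 1 ∨ j = 2) (A : ℝ) (hA : 0 < A) (B : ℕ) :
    ∃ C : ℝ, ∀ k : ℕ, 2 ≤ k → ∀ ξ : ℝ, 0 < ξ →
      ‖(((ξ / (k : ℝ) ^ j) ^ B : ℝ) : ℂ) * iteratedDeriv B (fun t : ℝ => V j (k : ℝ) t) ξ‖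
        ≤ C * (1 + ξ / (k : ℝ) ^ j) ^ (-A) := by
  rcases hj with rfl | rfl
  · exact final_red 1 (fun N B _ => case_one N B) A B
  · exact final_red 2 case_two A B
end

section
/- For every ε > 0 there exists a constant C = C(ε) such that for every integer m, every positive integer c, and every real x ≥ 1, one has ∑_{1 ≤ n ≤ x} |S(n, m; c)| ≤ C c^{1/2 + ε} x. -/
section part1
open Polynomial

section Stepanov
variable {k : Type*} [Field k]

lemma st_sq {f R S : k[X]} (hf : Squarefree f) (hd : 0 < f.natDegree) {c : k} (hc : c ≠ 0)
    (h : R ^ 2 = C c * S ^ 2 * f) : R = 0 ∧ S = 0 := by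
  by_cases hS : S = 0
  · subst hS
    simp at h
    exact ⟨h, rfl⟩
  · exfalso
    have h1 : S ^ 2 ∣ R ^ 2 := ⟨C c * f, by rw [h]; ring⟩
    have h2 : S ∣ R := by
      classical
      exact (UniqueFactorizationMonoid.pow_dvd_pow_iff_dvd (by norm_num)).1 h1
    obtain ⟨t, rfl⟩ := h2
    have h3 : t ^ 2 = C c * f := by
      have : S ^ 2 * t ^ 2 = S ^ 2 * (C c * f) := by linear_combination h
      exact mul_left_cancel₀ (pow_ne_zero 2 hS) this
    have h4 : t * t ∣ f := ⟨C c⁻¹, by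
      rw [← pow_two, h3, mul_comm (C c) f, mul_assoc, ← C_mul, mul_inv_cancel₀ hc]; simp⟩
    have h5 := hf t h4
    have h6 : IsUnit f := by
      have : IsUnit (C c * f) := by rw [← h3]; exact h5.pow 2
      exact isUnit_of_mul_isUnit_right this
    have := natDegree_eq_zero_of_isUnit h6
    omega

lemma st_key (p s N d : ℕ) [Fact p.Prime] [CharP k p] (hM : p ^ s = 2 * N + 1)
    {f R S : k[X]} (hf : Squarefree f) (hd : 0 < d) (hfd : f.natDegree = 2 * d)
    (hdN : d ≤ N) (hf0 : f.coeff 0 ≠ 0)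
    (hR : R.natDegree < N + 1) (hS : S.natDegree < N + 1 - d)
    (h : X ^ (2 * N + 1) ∣ R + S * f ^ (N + 1)) : R = 0 ∧ S = 0 := by
  have h1 : X ^ (2 * N + 1) ∣ R ^ 2 - S ^ 2 * f ^ (2 * N + 2) := by
    have : R ^ 2 - S ^ 2 * f ^ (2 * N + 2) = (R + S * f ^ (N + 1)) * (R - S * f ^ (N+1)) := by
      ring
    rw [this]
    exact h.mul_right _
  obtain ⟨g, hg⟩ : X ∣ f - C (f.coeff 0) := by
    rw [X_dvd_iff]; simp
  have h2 : f ^ (2 * N + 1) = C (f.coeff 0 ^ (2 * N + 1)) + X ^ (2 * N + 1) * g ^ (2 * N + 1) := by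
    have : f = C (f.coeff 0) + X * g := by rw [← hg]; ring
    conv_lhs => rw [this]
    rw [← hM, add_pow_char_pow, mul_pow, ← C_pow]
  have h3 : X ^ (2 * N + 1) ∣ R ^ 2 - C (f.coeff 0 ^ (2 * N + 1)) * S ^ 2 * f := by
    have : R ^ 2 - C (f.coeff 0 ^ (2 * N + 1)) * S ^ 2 * f =
      R ^ 2 - S ^ 2 * f ^ (2 * N + 2) + X ^ (2 * N + 1) * (g ^ (2 * N + 1) * S ^ 2 * f) := by
      have h4 : f ^ (2 * N + 2) = f ^ (2 * N + 1) * f := by ring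
      rw [h4, h2]; ring
    rw [this]
    exact dvd_add h1 (dvd_mul_right _ _)
  have h4 : R ^ 2 - C (f.coeff 0 ^ (2 * N + 1)) * S ^ 2 * f = 0 := by
    apply eq_zero_of_dvd_of_natDegree_lt h3
    rw [natDegree_X_pow]
    have a1 : (R ^ 2).natDegree ≤ 2 * R.natDegree := natDegree_pow_le
    have a2 : (S ^ 2).natDegree ≤ 2 * S.natDegree := natDegree_pow_le
    have a3 : (C (f.coeff 0 ^ (2 * N + 1)) * S ^ 2).natDegree ≤ (S^2).natDegree :=
      natDegree_C_mul_le _ _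
    have a4 : (C (f.coeff 0 ^ (2 * N + 1)) * S ^ 2 * f).natDegree ≤
      (C (f.coeff 0 ^ (2 * N + 1)) * S ^ 2).natDegree + f.natDegree := natDegree_mul_le
    have a5 := natDegree_sub_le (R^2) (C (f.coeff 0 ^ (2 * N + 1)) * S ^ 2 * f)
    omega
  exact st_sq hf (by omega) (pow_ne_zero _ hf0) (sub_eq_zero.1 h4)

lemma st_indep (p s N d : ℕ) [Fact p.Prime] [CharP k p] (hM : p ^ s = 2 * N + 1)
    {f : k[X]} (hf : Squarefree f) (hd : 0 < d) (hfd : f.natDegree = 2 * d)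
    (hdN : d ≤ N) (hf0 : f.coeff 0 ≠ 0) (J : ℕ) (R S : Fin J → k[X])
    (hR : ∀ j, (R j).natDegree < N + 1) (hS : ∀ j, (S j).natDegree < N + 1 - d)
    (h : ∑ j, (R j + S j * f ^ (N + 1)) * X ^ ((2 * N + 1) * (j : ℕ)) = 0) :
    ∀ j, R j = 0 ∧ S j = 0 := by
  induction J with
  | zero => exact fun j => j.elim0
  | succ J ih =>
    rw [Fin.sum_univ_succ] at h
    have e : ∑ i : Fin J, (R i.succ + S i.succ * f ^ (N + 1)) * X ^ ((2 * N + 1) * (i.succ : ℕ))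
      = X ^ (2 * N + 1) * ∑ i : Fin J, (R i.succ + S i.succ * f ^ (N + 1)) *
        X ^ ((2 * N + 1) * (i : ℕ)) := by
      rw [Finset.mul_sum]
      refine Finset.sum_congr rfl fun i _ => ?_
      rw [Fin.val_succ]; ring
    rw [e] at h
    simp only [Fin.val_zero, mul_zero, pow_zero, mul_one] at h
    have h0 : X ^ (2 * N + 1) ∣ R 0 + S 0 * f ^ (N + 1) := by
      rw [eq_neg_of_add_eq_zero_left h]
      exact (dvd_mul_right _ _).neg_right
    have h1 := st_key p s N d hM hf hd hfd hdN hf0 (hR 0) (hS 0) h0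
    rw [h1.1, h1.2] at h
    simp only [zero_mul, add_zero, zero_add] at h
    have h2 := (mul_eq_zero.1 h).resolve_left (pow_ne_zero _ X_ne_zero)
    have h3 := ih (fun i => R i.succ) (fun i => S i.succ) (fun i => hR _) (fun i => hS _) h2
    intro j
    refine Fin.cases h1 h3 j

lemma st_natDegree_lt {n : ℕ} (hn : 0 < n) {q : k[X]} (hq : q ∈ degreeLT k n) :
    q.natDegree < n := by
  rw [mem_degreeLT] at hq
  by_cases h : q = 0
  · simp [h, hn]
  · exact (natDegree_lt_iff_degree_lt h).2 hq

theorem stepanov [Fintype k] [DecidableEq k] (p s N d : ℕ) [Fact p.Prime] [CharP k p]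
    (hM : p ^ s = 2 * N + 1) (hcard : Fintype.card k = (2 * N + 1) ^ 2)
    {f : k[X]} (hf : Squarefree f) (hd : 0 < d) (hfd : f.natDegree = 2 * d)
    (hdN : d + 1 ≤ N) (hf0 : f.coeff 0 ≠ 0) (e : k) :
    2 * (Finset.univ.filter fun y : k => f.eval y ^ (2 * N ^ 2 + 2 * N) = e ∨ f.eval y = 0).card
      ≤ (2 * N + 1) ^ 2 + 4 * d * (2 * N + 1) := by
  set J := N + d + 1 with hJ
  set D := (2 * N + 1) * N + d + J with hD
  let U := Fin J → (degreeLT k (N + 1) × degreeLT k (N + 1 - d))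
  let T : U → k[X] := fun u => ∑ j, (((u j).1 : k[X]) ^ (2 * N + 1) +
    C e * ((u j).2 : k[X]) ^ (2 * N + 1) * f ^ (N + 1)) * X ^ (j : ℕ)
  have hTmem : ∀ u, T u ∈ degreeLT k D := by
    intro u
    refine Submodule.sum_mem _ fun j _ => ?_
    have a1 := st_natDegree_lt (by omega) (u j).1.2
    have a2 := st_natDegree_lt (by omega) (u j).2.2
    rw [mem_degreeLT]
    have hlt : ((((u j).1 : k[X]) ^ (2 * N + 1) +
      C e * ((u j).2 : k[X]) ^ (2 * N + 1) * f ^ (N + 1)) * X ^ (j : ℕ)).natDegree < D := by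
      have b1 : (((u j).1 : k[X]) ^ (2 * N + 1)).natDegree ≤ (2 * N + 1) * N :=
        natDegree_pow_le.trans (Nat.mul_le_mul_left _ (by omega))
      have b2 : (((u j).2 : k[X]) ^ (2 * N + 1)).natDegree ≤ (2 * N + 1) * (N - d) :=
        natDegree_pow_le.trans (Nat.mul_le_mul_left _ (by omega))
      have b3 : (f ^ (N + 1)).natDegree ≤ (N + 1) * (2 * d) := by
        refine natDegree_pow_le.trans (by rw [hfd])
      have b4 : (C e * ((u j).2 : k[X]) ^ (2 * N + 1) * f ^ (N + 1)).natDegree ≤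
          (2 * N + 1) * (N - d) + (N + 1) * (2 * d) :=
        natDegree_mul_le.trans (add_le_add ((natDegree_C_mul_le _ _).trans b2) b3)
      have b5 : (2 * N + 1) * (N - d) + (N + 1) * (2 * d) = (2 * N + 1) * N + d := by
        obtain ⟨w, rfl⟩ := Nat.exists_eq_add_of_le (show d ≤ N by omega)
        rw [Nat.add_sub_cancel_left]; ring
      have b6 := natDegree_add_le_of_degree_le (n := (2 * N + 1) * N + d) (b1.trans (by omega))
        (b4.trans b5.le)
      have b7 : ((X : k[X]) ^ (j : ℕ)).natDegree = j := natDegree_X_pow _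
      have b8 := (natDegree_mul_le (p := (((u j).1 : k[X]) ^ (2 * N + 1) +
        C e * ((u j).2 : k[X]) ^ (2 * N + 1) * f ^ (N + 1))) (q := X ^ (j : ℕ)))
      have := j.2
      omega
    exact degree_le_natDegree.trans_lt (by exact_mod_cast hlt)
  have hTsub : ∀ u v, T (u - v) = T u - T v := by
    intro u v
    simp only [T]
    rw [← Finset.sum_sub_distrib]
    refine Finset.sum_congr rfl fun j _ => ?_
    have : ∀ a b : k[X], (a - b) ^ (2 * N + 1) = a ^ (2 * N + 1) - b ^ (2 * N + 1) := by
      intro a b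
      rw [← hM, sub_pow_char_pow]
    have e1 : (((u - v) j).1 : k[X]) = (u j).1 - (v j).1 := rfl
    have e2 : (((u - v) j).2 : k[X]) = (u j).2 - (v j).2 := rfl
    rw [e1, e2, this, this]
    ring
  have hex : ∃ u : U, u ≠ 0 ∧ T u = 0 := by
    by_contra hcon
    push Not at hcon
    have hinj : Function.Injective (fun u : U => (⟨T u, hTmem u⟩ : degreeLT k D)) := by
      intro u v huv
      have : T u = T v := congrArg Subtype.val huv
      by_contra hne
      exact hcon (u - v) (sub_ne_zero.2 hne) (by rw [hTsub, this, sub_self])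
    have hfin : ∀ n, Module.Finite k (degreeLT k n) := fun n =>
      Module.Finite.equiv (degreeLTEquiv k n).symm
    have hfr : ∀ n, Module.finrank k (degreeLT k n) = n := fun n => by
      rw [(degreeLTEquiv k n).finrank_eq]; simp
    have := hfin D
    have := hfin (N + 1)
    have := hfin (N + 1 - d)
    have : Finite (degreeLT k D) := Module.finite_of_finite k
    have h1 := Nat.card_le_card_of_injective _ hinj
    rw [Module.natCard_eq_pow_finrank (K := k), Module.natCard_eq_pow_finrank (K := k) (V := degreeLT k D),
      hfr] at h1
    have h2 : Module.finrank k U = J * ((N + 1) + (N + 1 - d)) := by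
      simp [U, Module.finrank_pi_fintype, hfr]
    rw [h2] at h1
    have hk : 1 < Nat.card k := Finite.one_lt_card
    have h3 := (Nat.pow_le_pow_iff_right hk).1 h1
    obtain ⟨w, rfl⟩ := Nat.exists_eq_add_of_le hdN
    have : d + 1 + w + 1 - d = w + 2 := by omega
    rw [this] at h3
    simp only [hD, hJ] at h3
    nlinarith
  obtain ⟨u, hu0, hu⟩ := hex
  let G : k[X] := ∑ j, (((u j).1 : k[X]) + ((u j).2 : k[X]) * f ^ (N + 1)) *
    X ^ ((2 * N + 1) * (j : ℕ))
  have hG0 : G ≠ 0 := by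
    intro h
    apply hu0
    have := st_indep p s N d hM hf hd hfd (by omega) hf0 J (fun j => (u j).1) (fun j => (u j).2)
      (fun j => st_natDegree_lt (by omega) (u j).1.2)
      (fun j => st_natDegree_lt (by omega) (u j).2.2) h
    funext j
    exact Prod.ext (Subtype.ext (this j).1) (Subtype.ext (this j).2)
  have hGd : G.natDegree ≤ N + 2 * N * d + d + (2 * N + 1) * (N + d) := by
    refine natDegree_sum_le_of_forall_le _ _ fun j _ => ?_
    have a1 := st_natDegree_lt (by omega) (u j).1.2
    have a2 := st_natDegree_lt (by omega) (u j).2.2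
    have b3 : (f ^ (N + 1)).natDegree ≤ (N + 1) * (2 * d) := by
      refine natDegree_pow_le.trans (by rw [hfd])
    have b4 : (((u j).2 : k[X]) * f ^ (N + 1)).natDegree ≤ (N - d) + (N + 1) * (2 * d) :=
      natDegree_mul_le.trans (add_le_add (by omega) b3)
    have b5 : (N - d) + (N + 1) * (2 * d) = N + 2 * N * d + d := by
      obtain ⟨w, rfl⟩ := Nat.exists_eq_add_of_le (show d ≤ N by omega)
      rw [Nat.add_sub_cancel_left]; ring
    have b6 := natDegree_add_le_of_degree_le (p := ((u j).1 : k[X])) (n := N + 2 * N * d + d)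
      (by nlinarith) (b4.trans b5.le)
    refine natDegree_mul_le.trans (add_le_add b6 ?_)
    rw [natDegree_X_pow]
    exact Nat.mul_le_mul_left _ (by have := j.2; omega)
  have hroot : ∀ y : k, f.eval y ^ (2 * N ^ 2 + 2 * N) = e ∨ f.eval y = 0 → G.eval y = 0 := by
    intro y hy
    have hfe : (f.eval y) ^ ((N + 1) * (2 * N + 1)) = e * f.eval y ^ (N + 1) := by
      rcases hy with hy | hy
      · rw [← hy, ← pow_add]; congr 1; ring
      · rw [hy, zero_pow (by positivity), zero_pow (by positivity), mul_zero]
    have h1 : (T u).eval y = 0 := by rw [hu, eval_zero]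
    have h2 : (G.eval y) ^ (2 * N + 1) = (T u).eval y := by
      simp only [G, T, eval_finsetSum, eval_mul, eval_add, eval_pow, eval_C, eval_X]
      rw [← hM, sum_pow_char_pow]
      refine Finset.sum_congr rfl fun j _ => ?_
      rw [mul_pow, add_pow_char_pow, hM, mul_pow, ← pow_mul (f.eval y), hfe]
      have : (y ^ ((2 * N + 1) * (j : ℕ))) ^ (2 * N + 1) = y ^ (j : ℕ) := by
        rw [← pow_mul, show (2 * N + 1) * (j : ℕ) * (2 * N + 1) = (2 * N + 1) ^ 2 * j by ring,
          pow_mul, ← hcard, FiniteField.pow_card]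
      rw [this]; ring
    rw [h1] at h2
    exact pow_eq_zero_iff (by omega) |>.1 h2
  have hfin : (Finset.univ.filter fun y : k => f.eval y ^ (2 * N ^ 2 + 2 * N) = e ∨ f.eval y = 0).card
      ≤ G.natDegree := by
    apply card_le_degree_of_subset_roots
    intro y hy
    rw [Finset.mem_val, Finset.mem_filter] at hy
    exact (mem_roots hG0).2 (hroot y hy.2)
  have := hfin.trans hGd
  nlinarith

end Stepanov

end part1

section part2
open Polynomial

section CurveCount
variable {p : ℕ} [Fact p.Prime] {k : Type*} [Field k] [Fintype k] [DecidableEq k]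

lemma as_card_fiber [Algebra (ZMod p) k] (z : k) :
    (Finset.univ.filter fun y : k => y ^ p - y = z).card =
      if Algebra.trace (ZMod p) k z = 0 then p else 0 := by
  have : CharP k p := charP_of_injective_algebraMap (algebraMap (ZMod p) k).injective p
  have hp : p.Prime := Fact.out
  set r : k → ℕ := fun z => (Finset.univ.filter fun y : k => y ^ p - y = z).card with hr
  have h0 : ∀ z, Algebra.trace (ZMod p) k z ≠ 0 → r z = 0 := by
    intro z hz
    rw [hr]
    simp only
    rw [Finset.card_eq_zero, Finset.filter_eq_empty_iff]
    intro y _ hy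
    apply hz
    rw [← hy, map_sub, sub_eq_zero]
    have := Algebra.trace_eq_of_algEquiv (FiniteField.frobeniusAlgEquivOfAlgebraic (ZMod p) k) y
    rw [← this]
    simp
  have h1 : ∀ z, r z ≤ p := by
    intro z
    have hne : (X ^ p - X - C z : k[X]) ≠ 0 := by
      intro h
      have := congrArg (fun q => coeff q p) h
      simp [coeff_X, coeff_C, hp.ne_zero, hp.one_lt.ne] at this
    have hdeg : (X ^ p - X - C z : k[X]).natDegree ≤ p := by
      rw [natDegree_sub_C]
      refine (natDegree_sub_le _ _).trans ?_
      simp [hp.one_lt.le]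
    refine le_trans ?_ hdeg
    apply card_le_degree_of_subset_roots
    intro y hy
    rw [Finset.mem_val, Finset.mem_filter] at hy
    rw [mem_roots hne]
    simp [hy.2]
  have h2 : ∑ z, r z = Fintype.card k := by
    have := Finset.card_eq_sum_card_fiberwise (f := fun y : k => y ^ p - y) (s := Finset.univ)
      (t := Finset.univ) (by intro x _; simp)
    rw [← Finset.card_univ, this]
  have h3 : (Finset.univ.filter fun z : k => Algebra.trace (ZMod p) k z = 0).card * p
      = Fintype.card k := by
    have e1 := LinearMap.finrank_range_add_finrank_ker (Algebra.trace (ZMod p) k)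
    rw [LinearMap.range_eq_top.2 (Algebra.trace_surjective (ZMod p) k), finrank_top,
      Module.finrank_self] at e1
    have e2 : (Finset.univ.filter fun z : k => Algebra.trace (ZMod p) k z = 0).card =
      Nat.card (LinearMap.ker (Algebra.trace (ZMod p) k)) := by
      rw [← Fintype.card_subtype, ← Nat.card_eq_fintype_card]; rfl
    rw [e2, Module.natCard_eq_pow_finrank (K := ZMod p), ← Nat.card_eq_fintype_card,
      Module.natCard_eq_pow_finrank (K := ZMod p) (V := k), ← e1]
    simp [pow_add, mul_comm]
  have h4 : ∑ z ∈ Finset.univ.filter (fun z : k => Algebra.trace (ZMod p) k z = 0), r z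
      = ∑ z ∈ Finset.univ.filter (fun z : k => Algebra.trace (ZMod p) k z = 0), p := by
    rw [Finset.sum_const, smul_eq_mul, h3, ← h2, Finset.sum_filter]
    refine Finset.sum_congr rfl fun z _ => ?_
    split_ifs with h
    · rfl
    · exact (h0 z h).symm
  have h5 := (Finset.sum_eq_sum_iff_of_le fun z _ => h1 z).1 h4
  split_ifs with h
  · exact h5 z (by simp [h])
  · exact h0 z h

lemma quad_fiber (hk : ringChar k ≠ 2) {a : k} (ha : a ≠ 0) (t : k) :
    (((Finset.univ.filter fun x : kˣ => (x : k) + a * (x⁻¹ : kˣ) = t).card : ℕ) : ℤ) =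
      quadraticChar k (t ^ 2 - 4 * a) + 1 := by
  have h2 : (2 : k) ≠ 0 := Ring.two_ne_zero hk
  rw [← quadraticChar_card_sqrts hk]
  norm_cast
  refine Finset.card_bij (fun x _ => 2 * (x : k) - t) ?_ ?_ ?_
  · intro x hx
    simp only [Finset.mem_filter, Finset.mem_univ, true_and] at hx
    simp only [Set.mem_toFinset]
    change (2 * (x : k) - t) ^ 2 = t ^ 2 - 4 * a
    have : (x : k) * (x⁻¹ : kˣ) = 1 := by simp
    linear_combination (4 * (x:k)) * hx - 4 * a * this
  · intro x _ y _ h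
    ext
    have : 2 * (x : k) = 2 * y := by linear_combination h
    exact mul_left_cancel₀ h2 this
  · intro y hy
    simp only [Set.mem_toFinset] at hy
    change y ^ 2 = t ^ 2 - 4 * a at hy
    have hx : ((y + t) / 2) ^ 2 - t * ((y + t) / 2) + a = 0 := by
      field_simp
      linear_combination hy
    have hx0 : (y + t) / 2 ≠ 0 := by
      intro h
      rw [h] at hx
      apply ha
      linear_combination hx
    refine ⟨Units.mk0 _ hx0, ?_, ?_⟩
    · simp only [Finset.mem_filter, Finset.mem_univ, true_and, Units.val_inv_eq_inv_val, Units.val_mk0]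
      generalize (y + t) / 2 = w at *
      field_simp
      linear_combination hx
    · simp only [Units.val_mk0]
      field_simp
      ring

lemma char_sum_bound (hp2 : p ≠ 2) [CharP k p] (s N : ℕ) (hM : p ^ s = 2 * N + 1)
    (hcard : Fintype.card k = (2 * N + 1) ^ 2) (hpN : p + 1 ≤ N) {a : k} (ha : a ≠ 0) :
    |∑ y : k, quadraticChar k ((y ^ p - y) ^ 2 - 4 * a)| ≤ 4 * p * (2 * N + 1) := by
  have hp : p.Prime := Fact.out
  have hk : ringChar k ≠ 2 := by rw [ringChar.eq k p]; exact hp2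
  have h2 : (2 : k) ≠ 0 := Ring.two_ne_zero hk
  have h4 : (4 : k) ≠ 0 := by
    have : (4 : k) = 2 * 2 := by norm_num
    rw [this]; exact mul_ne_zero h2 h2
  let g : k[X] := X ^ p - X
  let f : k[X] := g ^ 2 - C (4 * a)
  have hgdeg : g.natDegree = p := by
    rw [natDegree_sub_eq_left_of_natDegree_lt]
    · simp
    · simp [hp.one_lt]
  have hfd : f.natDegree = 2 * p := by
    simp only [f]
    rw [natDegree_sub_C, natDegree_pow, hgdeg]
  have hf0 : f.coeff 0 ≠ 0 := by
    rw [coeff_zero_eq_eval_zero]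
    simp [f, g, hp.ne_zero, h4, ha]
  have hsep : f.Separable := by
    refine ⟨C (-(4 * a)⁻¹), C (-(4 * a)⁻¹ * 2⁻¹) * g, ?_⟩
    have hder : derivative f = - (C 2 * g) := by
      simp only [f, g, derivative_sub, derivative_pow, derivative_C, derivative_X]
      simp
    rw [hder]
    have c1 : (C (2⁻¹ : k) * C 2 : k[X]) = 1 := by rw [← C_mul, inv_mul_cancel₀ h2, C_1]
    have c2 : (C ((4 * a)⁻¹ : k) * C (4 * a) : k[X]) = 1 := by
      rw [← C_mul, inv_mul_cancel₀ (mul_ne_zero h4 ha), C_1]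
    rw [C_mul, C_neg]
    simp only [f]
    linear_combination c2 + (C (4*a)⁻¹ * g * g) * c1
  have key := fun e : k => stepanov p s N p hM hcard hsep.squarefree hp.pos hfd hpN hf0 e
  have hev : ∀ y, f.eval y = (y ^ p - y) ^ 2 - 4 * a := by
    intro y; simp [f, g]
  have hhalf : Fintype.card k / 2 = 2 * N ^ 2 + 2 * N := by
    rw [hcard]
    have : (2 * N + 1) ^ 2 = 2 * (2 * N ^ 2 + 2 * N) + 1 := by ring
    omega
  have hc : ((Fintype.card k : ℕ) : ℤ) = (2 * N + 1) ^ 2 := by rw [hcard]; push_cast; ring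
  have bound : ∀ e : ℤ, (e = 1 ∨ e = -1) →
      e * ∑ y : k, quadraticChar k ((y ^ p - y) ^ 2 - 4 * a) ≤ 4 * p * (2 * N + 1) := by
    intro e he
    have h1 := key (e : k)
    have h2 : e * ∑ y : k, quadraticChar k ((y ^ p - y) ^ 2 - 4 * a) ≤
      ∑ y : k, (2 * (if f.eval y ^ (2 * N ^ 2 + 2 * N) = (e : k) ∨ f.eval y = 0 then 1 else 0) - 1) := by
      rw [Finset.mul_sum]
      refine Finset.sum_le_sum fun y _ => ?_
      rw [← hev]
      by_cases h0 : f.eval y = 0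
      · simp [h0]
      · have h3 := quadraticChar_eq_pow_of_char_ne_two' hk (f.eval y)
        rw [hhalf] at h3
        rcases quadraticChar_dichotomy h0 with h5 | h5 <;> rcases he with rfl | rfl <;>
          rw [h5] at h3 ⊢ <;> rw [← h3] <;> simp [h0] <;> split_ifs <;> norm_num
    refine h2.trans ?_
    rw [Finset.sum_sub_distrib, ← Finset.mul_sum, Finset.sum_boole]
    simp only [Finset.sum_const, Finset.card_univ, nsmul_eq_mul, mul_one, hc]
    have h1' : (2 * ((Finset.univ.filter fun y : k => f.eval y ^ (2 * N ^ 2 + 2 * N) = (e : k) ∨ f.eval y = 0).card : ℕ) : ℤ)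
      ≤ (2 * N + 1) ^ 2 + 4 * p * (2 * N + 1) := by exact_mod_cast h1
    linarith
  rw [abs_le]
  have b1 := bound 1 (Or.inl rfl)
  have b2 := bound (-1) (Or.inr rfl)
  constructor <;> linarith

/-- Kloosterman sum over an extension. -/
noncomputable def KE (p : ℕ) [Fact p.Prime] (k : Type*) [Field k] [Fintype k] [DecidableEq k]
    [Algebra (ZMod p) k] (a b : ZMod p) : ℂ :=
  ∑ x : kˣ, ZMod.stdAddChar (b * Algebra.trace (ZMod p) k
    ((x : k) + algebraMap (ZMod p) k a * (x⁻¹ : kˣ)))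

lemma KE_sum [Algebra (ZMod p) k] (hp2 : p ≠ 2) {a : ZMod p} (ha : a ≠ 0) :
    ∑ b, KE p k a b = Fintype.card k +
      ((∑ y : k, quadraticChar k ((y ^ p - y) ^ 2 - 4 * algebraMap (ZMod p) k a) : ℤ) : ℂ) := by
  have : CharP k p := charP_of_injective_algebraMap (algebraMap (ZMod p) k).injective p
  have hk : ringChar k ≠ 2 := by rw [ringChar.eq k p]; exact hp2
  have ha' : algebraMap (ZMod p) k a ≠ 0 := by simpa using ha
  unfold KE
  rw [Finset.sum_comm]
  have h1 : ∀ x : kˣ, ∑ b : ZMod p, ZMod.stdAddChar (b * Algebra.trace (ZMod p) k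
      ((x : k) + algebraMap (ZMod p) k a * (x⁻¹ : kˣ))) =
      (((Finset.univ.filter fun y : k => y ^ p - y =
        (x : k) + algebraMap (ZMod p) k a * (x⁻¹ : kˣ)).card : ℕ) : ℂ) := by
    intro x
    rw [AddChar.sum_mulShift _ (ZMod.isPrimitive_stdAddChar p), as_card_fiber, ZMod.card]
  rw [Finset.sum_congr rfl fun x _ => h1 x]
  have h2 : ∑ x : kˣ, (((Finset.univ.filter fun y : k => y ^ p - y =
        (x : k) + algebraMap (ZMod p) k a * (x⁻¹ : kˣ)).card : ℕ) : ℤ) =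
      ∑ y : k, (quadraticChar k ((y ^ p - y) ^ 2 - 4 * algebraMap (ZMod p) k a) + 1) := by
    rw [Finset.sum_congr rfl fun y _ => (quad_fiber hk ha' (y ^ p - y)).symm]
    norm_cast
    simp only [Finset.card_filter]
    rw [Finset.sum_comm]
    simp only [eq_comm]
  rw [Finset.sum_add_distrib] at h2
  simp only [Finset.sum_const, Finset.card_univ, nsmul_eq_mul, mul_one] at h2
  have h3 := congrArg (fun z : ℤ => (z : ℂ)) h2
  push_cast at h3 ⊢
  rw [h3]; ring

lemma KE_bound [Algebra (ZMod p) k] (hp2 : p ≠ 2) {a : ZMod p} (ha : a ≠ 0) (s : ℕ)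
    (hcard : Fintype.card k = (p ^ s) ^ 2) (hs : 2 * p + 3 ≤ p ^ s) :
    ‖∑ b ∈ Finset.univ.erase 0, KE p k a b‖ ≤ 1 + 4 * p * p ^ s := by
  have : CharP k p := charP_of_injective_algebraMap (algebraMap (ZMod p) k).injective p
  have hp : p.Prime := Fact.out
  obtain ⟨N, hN⟩ : Odd (p ^ s) := (hp.odd_of_ne_two hp2).pow
  have h0 : KE p k a 0 = Fintype.card k - 1 := by
    unfold KE
    simp [Fintype.card_units, Fintype.card_pos]
  have h1 := KE_sum (k := k) hp2 ha
  rw [← Finset.add_sum_erase _ _ (Finset.mem_univ (0 : ZMod p)), h0] at h1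
  have h2 : ∑ b ∈ Finset.univ.erase 0, KE p k a b =
    1 + ((∑ y : k, quadraticChar k ((y ^ p - y) ^ 2 - 4 * algebraMap (ZMod p) k a) : ℤ) : ℂ) := by
    linear_combination h1
  have h3 := char_sum_bound (k := k) hp2 s N hN (by rw [hcard, hN]) (by omega)
    (show algebraMap (ZMod p) k a ≠ 0 by simpa using ha)
  rw [h2]
  refine (norm_add_le _ _).trans ?_
  rw [norm_one, Complex.norm_intCast]
  have h4 : ((p : ℝ) ^ s) = 2 * N + 1 := by exact_mod_cast hN
  rw [h4]
  have h5 : ((|∑ y : k, quadraticChar k ((y ^ p - y) ^ 2 - 4 * algebraMap (ZMod p) k a)| : ℤ) : ℝ)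
    ≤ 4 * p * (2 * N + 1) := by exact_mod_cast h3
  rw [Int.cast_abs] at h5
  linarith

end CurveCount

end part2

section part3
open Polynomial

section LFun
variable {p : ℕ} [Fact p.Prime]

lemma monSet_finite (p n : ℕ) [Fact p.Prime] : {h : (ZMod p)[X] | h.Monic ∧ h.natDegree = n}.Finite := by
  have : Module.Finite (ZMod p) (degreeLT (ZMod p) (n+1)) :=
    Module.Finite.equiv (degreeLTEquiv (ZMod p) (n+1)).symm
  have : Finite (degreeLT (ZMod p) (n+1)) := Module.finite_of_finite (ZMod p)
  refine (Set.toFinite ((degreeLT (ZMod p) (n+1) : Submodule _ _) : Set (ZMod p)[X])).subset ?_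
  rintro h ⟨h1, h2⟩
  rw [SetLike.mem_coe, mem_degreeLT]
  refine degree_le_natDegree.trans_lt ?_
  rw [h2]; exact_mod_cast Nat.lt_succ_self n

noncomputable def Mon (p n : ℕ) [Fact p.Prime] : Finset (ZMod p)[X] := (monSet_finite p n).toFinset

lemma mem_Mon {n : ℕ} {h : (ZMod p)[X]} : h ∈ Mon p n ↔ h.Monic ∧ h.natDegree = n := by
  simp [Mon]

open Classical in
noncomputable def Irr (p n : ℕ) [Fact p.Prime] : Finset (ZMod p)[X] :=
  ((Finset.range (n + 1)).biUnion fun m => Mon p m).filter Irreducible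

lemma mem_Irr {n : ℕ} {h : (ZMod p)[X]} :
    h ∈ Irr p n ↔ h.Monic ∧ Irreducible h ∧ h.natDegree ≤ n := by
  simp only [Irr, Finset.mem_filter, Finset.mem_biUnion, Finset.mem_range, mem_Mon]
  constructor
  · rintro ⟨⟨m, hm, h1, h2⟩, h3⟩
    exact ⟨h1, h3, by omega⟩
  · rintro ⟨h1, h2, h3⟩
    exact ⟨⟨h.natDegree, by omega, h1, rfl⟩, h2⟩

open Classical in
lemma deg_count {n : ℕ} {h : (ZMod p)[X]} (hh : h ∈ Mon p n) :
    n = ∑ P ∈ Irr p n, ∑ j ∈ Finset.Icc 1 n, if P ^ j ∣ h then P.natDegree else 0 := by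
  obtain ⟨hm, hd⟩ := mem_Mon.1 hh
  have h0 : h ≠ 0 := hm.ne_zero
  set N := UniqueFactorizationMonoid.normalizedFactors h with hN
  have hprod : N.prod = h := by
    rw [hN, UniqueFactorizationMonoid.prod_normalizedFactors_eq h0, hm.normalize_eq_self]
  have hmem : ∀ P ∈ N, P.Monic ∧ Irreducible P ∧ P ∣ h := by
    intro P hP
    have hi := UniqueFactorizationMonoid.irreducible_of_normalized_factor P hP
    refine ⟨?_, hi, UniqueFactorizationMonoid.dvd_of_mem_normalizedFactors hP⟩
    rw [← UniqueFactorizationMonoid.normalize_normalized_factor P hP]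
    exact monic_normalize hi.ne_zero
  have hdeg : n = (N.map natDegree).sum := by
    rw [← natDegree_multiset_prod, hprod, hd]
    intro h'
    exact (hmem 0 h').1.ne_zero rfl
  rw [Finset.sum_multiset_map_count] at hdeg
  have hsub : N.toFinset ⊆ Irr p n := by
    intro P hP
    rw [Multiset.mem_toFinset] at hP
    obtain ⟨a1, a2, a3⟩ := hmem P hP
    exact mem_Irr.2 ⟨a1, a2, hd ▸ natDegree_le_of_dvd a3 h0⟩
  rw [Finset.sum_subset hsub (by
    intro P _ hP
    rw [Multiset.mem_toFinset] at hP
    simp [Multiset.count_eq_zero_of_notMem hP])] at hdeg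
  refine hdeg.trans (Finset.sum_congr rfl fun P hP => ?_)
  obtain ⟨a1, a2, a3⟩ := mem_Irr.1 hP
  have hiff : ∀ j, P ^ j ∣ h ↔ j ≤ N.count P := by
    intro j
    rw [pow_dvd_iff_le_emultiplicity,
      UniqueFactorizationMonoid.emultiplicity_eq_count_normalizedFactors a2 h0, a1.normalize_eq_self]
    exact_mod_cast Iff.rfl
  have hle : N.count P ≤ n := by
    have h1 := natDegree_le_of_dvd ((hiff _).2 le_rfl) h0
    rw [natDegree_pow, hd] at h1
    exact (Nat.le_mul_of_pos_right _ a2.natDegree_pos).trans h1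
  simp only [hiff]
  rw [← Finset.sum_filter, Finset.sum_const]
  congr 1
  have : (Finset.Icc 1 n).filter (fun j => j ≤ N.count P) = Finset.Icc 1 (N.count P) := by
    ext j; simp only [Finset.mem_filter, Finset.mem_Icc]; omega
  rw [this]; simp

/-- abstract log-derivative identity -/
lemma log_deriv (η : (ZMod p)[X] → ℂ) (hη : ∀ f g : (ZMod p)[X], f.Monic → g.Monic → η (f * g) = η f * η g)
    (hη1 : η 1 = 1) (n : ℕ) :
    (n : ℂ) * ∑ h ∈ Mon p n, η h =
      ∑ k ∈ Finset.Icc 1 n, (∑ P ∈ Irr p k, ∑ j ∈ Finset.Icc 1 k,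
        if j * P.natDegree = k then (P.natDegree : ℂ) * η P ^ j else 0) * ∑ h ∈ Mon p (n - k), η h := by
  classical
  have hpow : ∀ P : (ZMod p)[X], P.Monic → ∀ j, η (P ^ j) = η P ^ j := by
    intro P hP j
    induction j with
    | zero => simp [hη1]
    | succ j ih => rw [pow_succ, hη _ _ (hP.pow j) hP, ih, pow_succ]
  have hinner : ∀ P ∈ Irr p n, ∀ j ∈ Finset.Icc 1 n,
      ∑ h ∈ (Mon p n).filter (fun h => P ^ j ∣ h), η h =
      if j * P.natDegree ≤ n then η P ^ j * ∑ h ∈ Mon p (n - j * P.natDegree), η h else 0 := by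
    intro P hP j hj
    obtain ⟨a1, a2, a3⟩ := mem_Irr.1 hP
    split_ifs with hle
    · rw [Finset.mul_sum]
      symm
      refine Finset.sum_bij (fun h _ => P ^ j * h) ?_ ?_ ?_ ?_
      · intro h hh
        obtain ⟨b1, b2⟩ := mem_Mon.1 hh
        refine Finset.mem_filter.2 ⟨mem_Mon.2 ⟨(a1.pow j).mul b1, ?_⟩, dvd_mul_right _ _⟩
        rw [(a1.pow j).natDegree_mul b1, natDegree_pow, b2]; omega
      · intro h _ h' _ he
        exact mul_left_cancel₀ (a1.pow j).ne_zero he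
      · intro h hh
        obtain ⟨b0, ⟨g, rfl⟩⟩ := Finset.mem_filter.1 hh
        obtain ⟨b1, b2⟩ := mem_Mon.1 b0
        have hg : g.Monic := (a1.pow j).of_mul_monic_left b1
        refine ⟨g, mem_Mon.2 ⟨hg, ?_⟩, rfl⟩
        rw [(a1.pow j).natDegree_mul hg, natDegree_pow] at b2
        omega
      · intro h hh
        rw [hη _ _ (a1.pow j) (mem_Mon.1 hh).1, hpow P a1]
    · rw [Finset.filter_false_of_mem, Finset.sum_empty]
      intro h hh hdvd
      obtain ⟨b1, b2⟩ := mem_Mon.1 hh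
      have := natDegree_le_of_dvd hdvd b1.ne_zero
      rw [natDegree_pow, b2] at this
      exact hle this
  have h1 : (n : ℂ) * ∑ h ∈ Mon p n, η h = ∑ P ∈ Irr p n, ∑ j ∈ Finset.Icc 1 n,
      (P.natDegree : ℂ) * ∑ h ∈ (Mon p n).filter (fun h => P ^ j ∣ h), η h := by
    rw [Finset.mul_sum]
    have : ∀ h ∈ Mon p n, (n : ℂ) * η h = ∑ P ∈ Irr p n, ∑ j ∈ Finset.Icc 1 n,
        (if P ^ j ∣ h then (P.natDegree : ℂ) * η h else 0) := by
      intro h hh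
      have := congrArg (fun z : ℕ => (z : ℂ)) (deg_count hh)
      rw [this]
      push_cast
      simp only [Finset.sum_mul, ite_mul, zero_mul]
    rw [Finset.sum_congr rfl this, Finset.sum_comm]
    refine Finset.sum_congr rfl fun P _ => ?_
    rw [Finset.sum_comm]
    refine Finset.sum_congr rfl fun j _ => ?_
    rw [Finset.mul_sum, Finset.sum_filter]
  rw [h1]
  have h2 : ∀ k ∈ Finset.Icc 1 n, (∑ P ∈ Irr p k, ∑ j ∈ Finset.Icc 1 k,
        if j * P.natDegree = k then (P.natDegree : ℂ) * η P ^ j else 0) * ∑ h ∈ Mon p (n - k), η h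
      = ∑ P ∈ Irr p n, ∑ j ∈ Finset.Icc 1 n,
        (if j * P.natDegree = k then (P.natDegree : ℂ) * η P ^ j * ∑ h ∈ Mon p (n - k), η h else 0) := by
    intro k hk
    rw [Finset.mem_Icc] at hk
    have hs1 : Irr p k ⊆ Irr p n := by
      intro P hP
      obtain ⟨a1, a2, a3⟩ := mem_Irr.1 hP
      exact mem_Irr.2 ⟨a1, a2, by omega⟩
    have hs2 : Finset.Icc 1 k ⊆ Finset.Icc 1 n := Finset.Icc_subset_Icc_right hk.2
    rw [Finset.sum_mul, ← Finset.sum_subset hs1]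
    · refine Finset.sum_congr rfl fun P hP => ?_
      rw [Finset.sum_mul, ← Finset.sum_subset hs2]
      · refine Finset.sum_congr rfl fun j hj => ?_
        rw [ite_mul, zero_mul]
      · intro j hj hj'
        rw [if_neg]
        intro he
        apply hj'
        have := (mem_Irr.1 hP).2.1.natDegree_pos
        rw [Finset.mem_Icc] at hj ⊢
        refine ⟨hj.1, ?_⟩
        rw [← he]
        exact Nat.le_mul_of_pos_right _ this
    · intro P hP hP'
      refine Finset.sum_eq_zero fun j hj => ?_
      rw [if_neg]
      intro he
      apply hP'
      obtain ⟨a1, a2, a3⟩ := mem_Irr.1 hP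
      refine mem_Irr.2 ⟨a1, a2, ?_⟩
      rw [Finset.mem_Icc] at hj
      rw [← he]
      exact Nat.le_mul_of_pos_left _ (by omega)
  rw [Finset.sum_congr rfl h2]
  conv_rhs => rw [Finset.sum_comm]
  refine Finset.sum_congr rfl fun P hP => ?_
  conv_rhs => rw [Finset.sum_comm]
  refine Finset.sum_congr rfl fun j hj => ?_
  rw [hinner P hP j hj, Finset.sum_ite_eq]
  have hpos := (mem_Irr.1 hP).2.1.natDegree_pos
  rw [Finset.mem_Icc] at hj
  have : j * P.natDegree ∈ Finset.Icc 1 n ↔ j * P.natDegree ≤ n := by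
    rw [Finset.mem_Icc]
    have : 0 < j * P.natDegree := Nat.mul_pos (by omega) hpos
    omega
  simp only [this]
  split_ifs <;> ring

end LFun

end part3

section part4
open Polynomial

section Eta
variable {p : ℕ} [Fact p.Prime]

noncomputable def etaK (a b : ZMod p) (h : (ZMod p)[X]) : ℂ :=
  if h.coeff 0 = 0 then 0 else
    ZMod.stdAddChar (b * (-h.nextCoeff + a * (-(h.coeff 1 / h.coeff 0))))

lemma eta_mul (a b : ZMod p) (f g : (ZMod p)[X]) (hf : f.Monic) (hg : g.Monic) :
    etaK a b (f * g) = etaK a b f * etaK a b g := by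
  unfold etaK
  rw [mul_coeff_zero]
  by_cases h1 : f.coeff 0 = 0
  · simp [h1]
  by_cases h2 : g.coeff 0 = 0
  · simp [h2]
  rw [if_neg (mul_ne_zero h1 h2), if_neg h1, if_neg h2, ← AddChar.map_add_eq_mul, hf.nextCoeff_mul hg,
    mul_coeff_one]
  congr 1
  field_simp
  ring

lemma eta_one (a b : ZMod p) : etaK a b 1 = 1 := by
  simp [etaK, coeff_one, nextCoeff]

lemma c_zero (a b : ZMod p) : ∑ h ∈ Mon p 0, etaK a b h = 1 := by
  have : Mon p 0 = {1} := by
    ext h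
    rw [mem_Mon, Finset.mem_singleton]
    constructor
    · rintro ⟨h1, h2⟩; exact h1.natDegree_eq_zero.1 h2
    · rintro rfl; simp
  rw [this, Finset.sum_singleton, eta_one]

lemma c_one (a b : ZMod p) : ∑ h ∈ Mon p 1, etaK a b h =
    ∑ x : (ZMod p)ˣ, ZMod.stdAddChar (b * ((x : ZMod p) + a * ((x⁻¹ : (ZMod p)ˣ) : ZMod p))) := by
  classical
  have h1 : ∑ h ∈ Mon p 1, etaK a b h = ∑ r : ZMod p, etaK a b (X - C r) := by
    symm
    refine Finset.sum_bij (fun r _ => X - C r) ?_ ?_ ?_ ?_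
    · intro r _
      exact mem_Mon.2 ⟨monic_X_sub_C r, natDegree_X_sub_C r⟩
    · intro r _ r' _ h
      simpa using h
    · intro h hh
      obtain ⟨h1, h2⟩ := mem_Mon.1 hh
      refine ⟨-h.coeff 0, Finset.mem_univ _, ?_⟩
      rw [C_neg, sub_neg_eq_add]
      exact (h1.eq_X_add_C h2).symm
    · intro r _; rfl
  rw [h1, ← Finset.add_sum_erase _ _ (Finset.mem_univ (0 : ZMod p))]
  have h2 : etaK a b (X - C 0) = 0 := by simp [etaK]
  rw [h2, zero_add]
  symm
  refine Finset.sum_bij (fun x _ => (x : ZMod p)) ?_ ?_ ?_ ?_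
  · intro x _; simp
  · intro x _ y _ h; exact Units.ext h
  · intro r hr
    exact ⟨Units.mk0 r (Finset.ne_of_mem_erase hr), Finset.mem_univ _, rfl⟩
  · intro x _
    unfold etaK
    have hx : (x : ZMod p) ≠ 0 := x.ne_zero
    rw [if_neg (by simp)]
    congr 1
    have e1 : (X - C (x : ZMod p)).coeff 1 = 1 := by
      rw [coeff_sub, coeff_X_one, coeff_C, if_neg one_ne_zero, sub_zero]
    have e0 : (X - C (x : ZMod p)).coeff 0 = -(x : ZMod p) := by
      rw [coeff_sub, coeff_X_zero, coeff_C_zero, zero_sub]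
    rw [nextCoeff_X_sub_C, e1, e0, Units.val_inv_eq_inv_val, neg_neg, div_neg, neg_neg, one_div]

lemma c_two {a b : ZMod p} (ha : a ≠ 0) (hb : b ≠ 0) : ∑ h ∈ Mon p 2, etaK a b h = p := by
  classical
  have h1 : ∑ h ∈ Mon p 2, etaK a b h = ∑ v : ZMod p, ∑ u : ZMod p,
      etaK a b (X ^ 2 + C u * X + C v) := by
    rw [← Finset.sum_product']
    symm
    have hcoef : ∀ v u : ZMod p, (X ^ 2 + C u * X + C v : (ZMod p)[X]).coeff 0 = v ∧
      (X ^ 2 + C u * X + C v : (ZMod p)[X]).coeff 1 = u := by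
      intro v u
      simp [coeff_X, coeff_C]
    refine Finset.sum_bij (fun r _ => X ^ 2 + C r.2 * X + C r.1) ?_ ?_ ?_ ?_
    · intro r _
      refine mem_Mon.2 ⟨?_, ?_⟩
      · monicity!
      · compute_degree!
    · intro r _ r' _ h
      have e1 := congrArg (fun q => coeff q 0) h
      have e2 := congrArg (fun q => coeff q 1) h
      simp only [hcoef] at e1 e2
      exact Prod.ext e1 e2
    · intro h hh
      obtain ⟨h1, h2⟩ := mem_Mon.1 hh
      refine ⟨(h.coeff 0, h.coeff 1), by simp, ?_⟩
      have h3 : h.coeff 2 = 1 := by rw [← h2]; exact h1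
      conv_rhs => rw [h.as_sum_range_C_mul_X_pow, h2]
      simp [Finset.sum_range_succ, h3]
      ring
    · intro r _; rfl
  rw [h1]
  have h2 : ∀ v u : ZMod p, etaK a b (X ^ 2 + C u * X + C v) = if v = 0 then 0 else
      ZMod.stdAddChar (u * (-b * (1 + a / v))) := by
    intro v u
    have hd : (X ^ 2 + C u * X + C v : (ZMod p)[X]).natDegree = 2 := by compute_degree!
    have hn : (X ^ 2 + C u * X + C v : (ZMod p)[X]).nextCoeff = u := by
      rw [nextCoeff_of_natDegree_pos (by omega), hd]
      simp [coeff_X, coeff_C]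
    unfold etaK
    rw [hn]
    simp only [coeff_add, coeff_X_pow, coeff_C_mul, coeff_X, coeff_C]
    simp only [show (0:ℕ) ≠ 2 by norm_num, show (1:ℕ) ≠ 0 by norm_num, show (1:ℕ) ≠ 2 by norm_num,
      if_false, if_true, mul_zero, zero_add, mul_one, add_zero]
    split_ifs with hv
    · rfl
    · congr 1; field_simp; ring
  simp only [h2]
  have h3 : ∀ v : ZMod p, (∑ u : ZMod p, (if v = 0 then (0:ℂ) else
      ZMod.stdAddChar (u * (-b * (1 + a / v))))) = if v = -a then (p : ℂ) else 0 := by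
    intro v
    by_cases hv : v = 0
    · have : ¬ (0 = -a) := by intro h; apply ha; linear_combination h
      simp [hv, this]
    · simp only [if_neg hv]
      rw [AddChar.sum_mulShift _ (ZMod.isPrimitive_stdAddChar p), ZMod.card]
      have : -b * (1 + a / v) = 0 ↔ v = -a := by
        rw [mul_eq_zero, neg_eq_zero]
        constructor
        · rintro (h | h)
          · exact absurd h hb
          · field_simp at h; linear_combination h
        · rintro rfl
          right; field_simp; ring
      simp only [this]
      split_ifs <;> simp
  simp only [h3, Finset.sum_ite_eq', Finset.mem_univ, if_true]

lemma c_ge_three {a b : ZMod p} (hb : b ≠ 0) (n : ℕ) (hn : 3 ≤ n) :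
    ∑ h ∈ Mon p n, etaK a b h = 0 := by
  have key : ∑ h ∈ Mon p n, etaK a b h =
      ZMod.stdAddChar (1 : ZMod p) * ∑ h ∈ Mon p n, etaK a b h := by
    rw [Finset.mul_sum]
    set t : ZMod p := b⁻¹ with ht
    have hdl : ∀ t : ZMod p, (C t * X ^ (n - 1) : (ZMod p)[X]).degree < (n : WithBot ℕ) := by
      intro t
      refine (degree_C_mul_X_pow_le _ _).trans_lt ?_
      exact_mod_cast (by omega : n - 1 < n)
    have hmon : ∀ (t : ZMod p) (h : (ZMod p)[X]), h ∈ Mon p n → h + C t * X ^ (n - 1) ∈ Mon p n := by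
      intro t h hh
      obtain ⟨h1, h2⟩ := mem_Mon.1 hh
      have h3 : (C t * X ^ (n - 1) : (ZMod p)[X]).degree < h.degree := by
        rw [degree_eq_natDegree h1.ne_zero, h2]; exact hdl t
      refine mem_Mon.2 ⟨h1.add_of_left h3, ?_⟩
      rw [natDegree_add_eq_left_of_degree_lt h3, h2]
    refine Finset.sum_bij' (fun h _ => h + C t * X ^ (n - 1)) (fun h _ => h + C (-t) * X ^ (n - 1))
      (fun h hh => hmon t h hh) (fun h hh => hmon (-t) h hh) ?_ ?_ ?_
    · intro h _; simp
    · intro h _; simp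
    · intro h hh
      obtain ⟨h1, h2⟩ := mem_Mon.1 hh
      obtain ⟨h3, h4⟩ := mem_Mon.1 (hmon t h hh)
      have e0 : (h + C t * X ^ (n - 1)).coeff 0 = h.coeff 0 := by
        rw [coeff_add, coeff_C_mul_X_pow, if_neg (by omega), add_zero]
      have e1 : (h + C t * X ^ (n - 1)).coeff 1 = h.coeff 1 := by
        rw [coeff_add, coeff_C_mul_X_pow, if_neg (by omega), add_zero]
      have e2 : (h + C t * X ^ (n - 1)).nextCoeff = h.nextCoeff + t := by
        rw [nextCoeff_of_natDegree_pos (by omega), nextCoeff_of_natDegree_pos (by omega), h4, h2,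
          coeff_add, coeff_C_mul_X_pow, if_pos rfl]
      unfold etaK
      rw [e0, e1, e2]
      split_ifs with h0
      · simp
      · rw [← AddChar.map_add_eq_mul]
        congr 1
        have : b * t = 1 := mul_inv_cancel₀ hb
        linear_combination this
  have hne : (ZMod.stdAddChar (1 : ZMod p) : ℂ) ≠ 1 := by
    intro h
    rw [← (ZMod.stdAddChar (N := p)).map_zero_eq_one, ZMod.injective_stdAddChar.eq_iff] at h
    exact one_ne_zero h
  have : (ZMod.stdAddChar (1 : ZMod p) - 1) * ∑ h ∈ Mon p n, etaK a b h = 0 := by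
    linear_combination -key
  exact (mul_eq_zero.1 this).resolve_left (sub_ne_zero.2 hne)

end Eta

section KEfield
variable {p : ℕ} [Fact p.Prime] {k : Type*} [Field k] [Fintype k] [Algebra (ZMod p) k]

lemma nextCoeff_minpoly_inv (x : k) (hx : x ≠ 0) :
    (minpoly (ZMod p) x⁻¹).nextCoeff = (minpoly (ZMod p) x).coeff 1 / (minpoly (ZMod p) x).coeff 0 := by
  have hint : ∀ y : k, IsIntegral (ZMod p) y := fun y => .of_finite _ _
  set P := minpoly (ZMod p) x with hP
  have hPm : P.Monic := minpoly.monic (hint x)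
  have hP0 : P.coeff 0 ≠ 0 := minpoly.coeff_zero_ne_zero (hint x) hx
  have hPd : 0 < P.natDegree := minpoly.natDegree_pos (hint x)
  set Q := C (P.coeff 0)⁻¹ * P.reverse with hQ
  have htr : P.natTrailingDegree = 0 := natTrailingDegree_eq_zero.2 (Or.inr hP0)
  have hrd : P.reverse.natDegree = P.natDegree := by rw [reverse_natDegree, htr, Nat.sub_zero]
  have hQd : Q.natDegree = P.natDegree := by
    rw [hQ, natDegree_C_mul (inv_ne_zero hP0), hrd]
  have hQm : Q.Monic := by
    rw [Monic, hQ, leadingCoeff_mul, leadingCoeff_C, reverse_leadingCoeff, trailingCoeff, htr,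
      inv_mul_cancel₀ hP0]
  have hroot : aeval x⁻¹ Q = 0 := by
    rw [hQ, map_mul]
    have : Invertible x := invertibleOfNonzero hx
    have h1 := (eval₂_reverse_eq_zero_iff (algebraMap (ZMod p) k) x P).2 (by
      rw [← aeval_def]; exact minpoly.aeval _ _)
    rw [invOf_eq_inv, ← aeval_def] at h1
    rw [h1, mul_zero]
  have hadj : IntermediateField.adjoin (ZMod p) {x⁻¹} = IntermediateField.adjoin (ZMod p) {x} := by
    apply le_antisymm
    · rw [IntermediateField.adjoin_simple_le_iff]
      exact inv_mem (IntermediateField.mem_adjoin_simple_self _ _)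
    · rw [IntermediateField.adjoin_simple_le_iff]
      have := inv_mem (IntermediateField.mem_adjoin_simple_self (ZMod p) x⁻¹)
      rwa [inv_inv] at this
  have hdeg : (minpoly (ZMod p) x⁻¹).natDegree = P.natDegree := by
    rw [← IntermediateField.adjoin.finrank (hint _), hadj, IntermediateField.adjoin.finrank (hint _)]
  have heq : Q = minpoly (ZMod p) x⁻¹ :=
    (eq_of_monic_of_dvd_of_natDegree_le (minpoly.monic (hint _)) hQm (minpoly.dvd _ _ hroot)
      (by rw [hQd, hdeg]))
  rw [← heq, nextCoeff_of_natDegree_pos (by omega), hQd, hQ, coeff_C_mul, coeff_reverse,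
    revAt_le (by omega), show P.natDegree - (P.natDegree - 1) = 1 by omega]
  field_simp

open Classical in
lemma card_minpoly_fiber {P : (ZMod p)[X]} (hm : P.Monic) (hi : Irreducible P)
    (hd : P.natDegree ∣ Module.finrank (ZMod p) k) :
    (Finset.univ.filter fun x : k => minpoly (ZMod p) x = P).card = P.natDegree := by
  have : Fact (Irreducible P) := ⟨hi⟩
  have h1 : Module.finrank (ZMod p) (AdjoinRoot P) = P.natDegree := by
    rw [(AdjoinRoot.powerBasis hi.ne_zero).finrank, AdjoinRoot.powerBasis_dim]
  have h2 := FiniteField.natCard_algHom_of_finrank_dvd (F := ZMod p) (K := AdjoinRoot P) (L := k)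
    (by rw [h1]; exact hd)
  rw [h1, Nat.card_congr (AdjoinRoot.equiv (L := k) (F := ZMod p) P hi.ne_zero)] at h2
  rw [← h2, ← Fintype.card_subtype, ← Nat.card_eq_fintype_card]
  refine Nat.card_congr (Equiv.subtypeEquivRight fun x => ?_)
  rw [mem_aroots]
  constructor
  · rintro rfl
    exact ⟨hi.ne_zero, minpoly.aeval _ _⟩
  · rintro ⟨_, h⟩
    exact (minpoly.eq_of_irreducible_of_monic hi h hm).symm

lemma KE_eq [DecidableEq k] (a b : ZMod p) (n : ℕ) (hn : Module.finrank (ZMod p) k = n) :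
    KE p k a b = ∑ P ∈ Irr p n, ∑ j ∈ Finset.Icc 1 n,
        if j * P.natDegree = n then (P.natDegree : ℂ) * etaK a b P ^ j else 0 := by
  classical
  have hint : ∀ y : k, IsIntegral (ZMod p) y := fun y => .of_finite _ _
  have hn0 : 0 < n := hn ▸ Module.finrank_pos
  let G : (ZMod p)[X] → ℂ := fun P => ∑ j ∈ Finset.Icc 1 n,
    if j * P.natDegree = n then etaK a b P ^ j else 0
  have hjx : ∀ x : k, ∃ j, 1 ≤ j ∧ j * (minpoly (ZMod p) x).natDegree = n ∧
      Module.finrank (IntermediateField.adjoin (ZMod p) {x}) k = j := by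
    intro x
    have h1 := Module.finrank_mul_finrank (ZMod p) (IntermediateField.adjoin (ZMod p) {x}) k
    rw [IntermediateField.adjoin.finrank (hint x), hn] at h1
    refine ⟨_, Module.finrank_pos, ?_, rfl⟩
    rw [mul_comm]; exact h1
  have hGx : ∀ (x : k) (j : ℕ), 1 ≤ j → j * (minpoly (ZMod p) x).natDegree = n →
      G (minpoly (ZMod p) x) = etaK a b (minpoly (ZMod p) x) ^ j := by
    intro x j h1 h2
    have hpos : 0 < (minpoly (ZMod p) x).natDegree := minpoly.natDegree_pos (hint x)
    simp only [G]
    rw [Finset.sum_eq_single_of_mem j]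
    · rw [if_pos h2]
    · rw [Finset.mem_Icc]
      exact ⟨h1, h2 ▸ Nat.le_mul_of_pos_right _ hpos⟩
    · intro j' _ hne
      rw [if_neg]
      intro h
      exact hne (Nat.eq_of_mul_eq_mul_right hpos (h.trans h2.symm))
  have h1 : KE p k a b = ∑ x : k, G (minpoly (ZMod p) x) := by
    rw [← Finset.add_sum_erase _ _ (Finset.mem_univ (0 : k))]
    have h0 : G (minpoly (ZMod p) (0 : k)) = 0 := by
      obtain ⟨j, j1, j2, _⟩ := hjx 0
      rw [hGx 0 j j1 j2, minpoly.zero, etaK, if_pos (by simp), zero_pow (by omega)]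
    rw [h0, zero_add]
    unfold KE
    refine Finset.sum_bij (fun x _ => (x : k)) ?_ ?_ ?_ ?_
    · intro x _; simp
    · intro x _ y _ h; exact Units.ext h
    · intro r hr
      exact ⟨Units.mk0 r (Finset.ne_of_mem_erase hr), Finset.mem_univ _, rfl⟩
    · intro x _
      have hx : (x : k) ≠ 0 := x.ne_zero
      obtain ⟨j, j1, j2, j3⟩ := hjx x
      rw [hGx x j j1 j2, etaK, if_neg (minpoly.coeff_zero_ne_zero (hint _) hx),
        ← AddChar.map_nsmul_eq_pow]
      congr 1
      have t1 := trace_eq_finrank_mul_minpoly_nextCoeff (ZMod p) (x : k)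
      have t2 := trace_eq_finrank_mul_minpoly_nextCoeff (ZMod p) (x : k)⁻¹
      have hadj : IntermediateField.adjoin (ZMod p) {(x : k)⁻¹} =
          IntermediateField.adjoin (ZMod p) {(x : k)} := by
        apply le_antisymm
        · rw [IntermediateField.adjoin_simple_le_iff]
          exact inv_mem (IntermediateField.mem_adjoin_simple_self _ _)
        · rw [IntermediateField.adjoin_simple_le_iff]
          have := inv_mem (IntermediateField.mem_adjoin_simple_self (ZMod p) (x : k)⁻¹)
          rwa [inv_inv] at this
      rw [hadj, nextCoeff_minpoly_inv _ hx, j3] at t2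
      rw [j3] at t1
      rw [map_add, Units.val_inv_eq_inv_val, ← Algebra.smul_def, map_smul, t1, t2, smul_eq_mul,
        nsmul_eq_mul]
      ring
  have h2 : ∑ x : k, G (minpoly (ZMod p) x) = ∑ P ∈ Irr p n,
      ∑ x ∈ Finset.univ.filter (fun x : k => minpoly (ZMod p) x = P), G (minpoly (ZMod p) x) := by
    symm
    apply Finset.sum_fiberwise_of_maps_to
    intro x _
    refine mem_Irr.2 ⟨minpoly.monic (hint x), minpoly.irreducible (hint x), ?_⟩
    rw [← hn]
    exact minpoly.natDegree_le x
  rw [h1, h2]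
  refine Finset.sum_congr rfl fun P hP => ?_
  obtain ⟨a1, a2, a3⟩ := mem_Irr.1 hP
  have h3 : ∑ x ∈ Finset.univ.filter (fun x : k => minpoly (ZMod p) x = P), G (minpoly (ZMod p) x)
    = ∑ x ∈ Finset.univ.filter (fun x : k => minpoly (ZMod p) x = P), G P :=
    Finset.sum_congr rfl fun x hx => by rw [(Finset.mem_filter.1 hx).2]
  rw [h3, Finset.sum_const, nsmul_eq_mul, Finset.mul_sum]
  refine Finset.sum_congr rfl fun j _ => ?_
  split_ifs with hj
  · rw [card_minpoly_fiber a1 a2 (by rw [hn, ← hj]; exact dvd_mul_left _ _)]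
  · rw [mul_zero]

end KEfield

end part4

section part5
open Polynomial

section Weil

lemma rec_real (κ P : ℝ) (hP : 0 < P) (w : ℕ → ℝ) (h0 : w 0 = 2) (h1 : w 1 = -κ)
    (hr : ∀ n, w (n + 2) = -κ * w (n + 1) - P * w n) :
    (∀ s, -2 * P ^ s ≤ w (2 * s)) ∧ (4 * P < κ ^ 2 → ∃ r, P < r ∧ ∀ s, r ^ s ≤ w (2 * s)) := by
  by_cases hk : κ ^ 2 ≤ 4 * P
  · refine ⟨?_, fun h => absurd h (not_lt.2 hk)⟩
    let D := Real.sqrt (4 * P - κ ^ 2)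
    have hD : D ^ 2 = 4 * P - κ ^ 2 := Real.sq_sqrt (by linarith)
    let α : ℂ := ⟨-κ / 2, D / 2⟩
    have hα : α ^ 2 = -(κ : ℂ) * α - P := by
      apply Complex.ext
      · simp [α, pow_two]; nlinarith
      · simp [α, pow_two]; ring
    have hw : ∀ n, w n = 2 * (α ^ n).re ∧ w (n + 1) = 2 * (α ^ (n + 1)).re := by
      intro n
      induction n with
      | zero => 
        refine ⟨by simp [h0], ?_⟩
        simp only [zero_add, pow_one, h1, α]; ring
      | succ n ih =>
        refine ⟨ih.2, ?_⟩
        rw [hr, ih.1, ih.2]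
        have : α ^ (n + 1 + 1) = -(κ : ℂ) * α ^ (n + 1) - P * α ^ n := by
          linear_combination α ^ n * hα
        rw [this]
        simp
        ring
    have hn : Complex.normSq α = P := by
      simp [Complex.normSq_apply, α]; nlinarith
    intro s
    rw [(hw (2 * s)).1]
    have h3 : |(α ^ (2 * s)).re| ≤ P ^ s := by
      refine (Complex.abs_re_le_norm _).trans ?_
      rw [norm_pow, pow_mul, Complex.sq_norm, hn]
    have := (abs_le.1 h3).1
    linarith
  · push Not at hk
    let D := Real.sqrt (κ ^ 2 - 4 * P)
    have hD : D ^ 2 = κ ^ 2 - 4 * P := Real.sq_sqrt (by linarith)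
    have hD0 : 0 < D := Real.sqrt_pos.2 (by linarith)
    let α : ℝ := (-κ + D) / 2
    let β : ℝ := (-κ - D) / 2
    have hα : α ^ 2 = -κ * α - P := by simp only [α]; nlinarith
    have hβ : β ^ 2 = -κ * β - P := by simp only [β]; nlinarith
    have hw : ∀ n, w n = α ^ n + β ^ n ∧ w (n + 1) = α ^ (n + 1) + β ^ (n + 1) := by
      intro n
      induction n with
      | zero => 
        refine ⟨by simp [h0]; norm_num, ?_⟩
        simp only [zero_add, pow_one, h1, α, β]; ring
      | succ n ih =>
        refine ⟨ih.2, ?_⟩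
        rw [hr, ih.1, ih.2]
        linear_combination -α ^ n * hα - β ^ n * hβ
    have hw2 : ∀ s, w (2 * s) = (α ^ 2) ^ s + (β ^ 2) ^ s := fun s => by
      rw [(hw (2 * s)).1, pow_mul, pow_mul]
    refine ⟨fun s => ?_, fun _ => ?_⟩
    · rw [hw2]
      have : 0 ≤ (α ^ 2) ^ s + (β ^ 2) ^ s := by positivity
      have : 0 < P ^ s := by positivity
      linarith
    · rcases le_or_gt κ 0 with h | h
      · refine ⟨α ^ 2, ?_, fun s => ?_⟩
        · simp only [α]; nlinarith [mul_nonneg (neg_nonneg.2 h) hD0.le]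
        · rw [hw2]
          have : 0 ≤ (β ^ 2) ^ s := by positivity
          linarith
      · refine ⟨β ^ 2, ?_, fun s => ?_⟩
        · simp only [β]; nlinarith [mul_nonneg h.le hD0.le]
        · rw [hw2]
          have : 0 ≤ (α ^ 2) ^ s := by positivity
          linarith

variable {p : ℕ} [Fact p.Prime]

/-- Kloosterman sum mod p -/
noncomputable def KP (p : ℕ) [Fact p.Prime] (a b : ZMod p) : ℂ :=
  ∑ x : (ZMod p)ˣ, ZMod.stdAddChar (b * ((x : ZMod p) + a * ((x⁻¹ : (ZMod p)ˣ) : ZMod p)))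

lemma KP_real (a b : ZMod p) : ∃ κ : ℝ, KP p a b = κ := by
  have h : (starRingEnd ℂ) (KP p a b) = KP p a b := by
    unfold KP
    rw [map_sum]
    refine Fintype.sum_equiv (Equiv.neg _) _ _ fun x => ?_
    rw [← AddChar.map_neg_eq_conj]
    congr 1
    have h1 : (((-x)⁻¹ : (ZMod p)ˣ) : ZMod p) = -((x⁻¹ : (ZMod p)ˣ) : ZMod p) := by
      rw [inv_neg]; rfl
    change -(b * ((x : ZMod p) + a * ((x⁻¹ : (ZMod p)ˣ) : ZMod p))) =
      b * (((-x : (ZMod p)ˣ) : ZMod p) + a * (((-x)⁻¹ : (ZMod p)ˣ) : ZMod p))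
    rw [h1, Units.val_neg]
    ring
  obtain ⟨κ, hκ⟩ := Complex.conj_eq_iff_real.1 h
  exact ⟨κ, hκ⟩

noncomputable def LamK (p : ℕ) [Fact p.Prime] (a b : ZMod p) (k : ℕ) : ℂ :=
  ∑ P ∈ Irr p k, ∑ j ∈ Finset.Icc 1 k,
        if j * P.natDegree = k then (P.natDegree : ℂ) * etaK a b P ^ j else 0

lemma LamK_rec {a b : ZMod p} (ha : a ≠ 0) (hb : b ≠ 0) :
    LamK p a b 1 = KP p a b ∧ LamK p a b 2 = 2 * p - (KP p a b) ^ 2 ∧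
    ∀ n, LamK p a b (n + 3) = - KP p a b * LamK p a b (n + 2) - p * LamK p a b (n + 1) := by
  have key := log_deriv (etaK a b) (eta_mul a b) (eta_one a b)
  have c0 := c_zero a b
  have c1 : ∑ h ∈ Mon p 1, etaK a b h = KP p a b := c_one a b
  have c2 := c_two ha hb
  have h1 : LamK p a b 1 = KP p a b := by
    have := key 1
    simp only [Finset.Icc_self, Finset.sum_singleton, Nat.sub_self, c0, c1] at this
    unfold LamK
    simp only [Finset.Icc_self, Finset.sum_singleton]
    rw [← mul_one (∑ P ∈ Irr p 1, _), ← this]; simp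
  refine ⟨h1, ?_, ?_⟩
  · have := key 2
    change _ = ∑ k ∈ Finset.Icc 1 2, LamK p a b k * _ at this
    rw [show Finset.Icc 1 2 = {1, 2} from rfl, Finset.sum_pair (by norm_num), c2, h1] at this
    simp only [Nat.sub_self, show 2 - 1 = 1 from rfl, c0, c1] at this
    push_cast at this
    linear_combination -this
  · intro n
    have := key (n + 3)
    change _ = ∑ k ∈ Finset.Icc 1 (n+3), LamK p a b k * _ at this
    rw [c_ge_three hb _ (by omega), Finset.sum_Icc_succ_top (by omega), Finset.sum_Icc_succ_top (by omega),
      Finset.sum_Icc_succ_top (by omega)] at this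
    rw [Finset.sum_eq_zero (fun k hk => by
      rw [Finset.mem_Icc] at hk
      rw [c_ge_three hb _ (by omega), mul_zero])] at this
    rw [show n + 3 - (n + 0 + 1) = 2 by omega, show n + 3 - (n + 1 + 1) = 1 by omega,
      show n + 3 - (n + 2 + 1) = 0 by omega, c0, c1, c2] at this
    linear_combination -this

theorem weil_prime (hp2 : p ≠ 2) {a : ZMod p} (ha : a ≠ 0) : ‖KP p a 1‖ ≤ 2 * Real.sqrt p := by
  classical
  have hp : p.Prime := Fact.out
  have hp0 : (0 : ℝ) < p := by exact_mod_cast hp.pos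
  choose κ hκ using fun b => KP_real a b
  let w : ZMod p → ℕ → ℝ := fun b n => Nat.rec (motive := fun _ => ℝ × ℝ) (2, -κ b)
    (fun _ q => (q.2, -κ b * q.2 - p * q.1)) n |>.1
  have w0 : ∀ b, w b 0 = 2 := fun b => rfl
  have w1 : ∀ b, w b 1 = -κ b := fun b => rfl
  have wr : ∀ b n, w b (n + 2) = -κ b * w b (n + 1) - p * w b n := fun b n => rfl
  have hL : ∀ b, b ≠ 0 → ∀ n, LamK p a b (n + 1) = -(w b (n + 1) : ℂ) ∧
      LamK p a b (n + 2) = -(w b (n + 2) : ℂ) := by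
    intro b hb n
    obtain ⟨r1, r2, r3⟩ := LamK_rec ha hb
    induction n with
    | zero =>
      refine ⟨?_, ?_⟩
      · rw [zero_add, w1, r1, hκ]; simp
      · rw [zero_add, show w b 2 = -κ b * w b 1 - p * w b 0 from rfl, w1, w0, r2, hκ]
        push_cast; ring
    | succ n ih =>
      refine ⟨ih.2, ?_⟩
      rw [show n + 1 + 2 = n + 3 by ring, r3,
        show w b (n + 3) = -κ b * w b (n + 2) - p * w b (n + 1) from rfl, ih.2, ih.1, hκ]
      push_cast; ring
  have hlow := fun b => rec_real (κ b) p hp0 (w b) (w0 b) (w1 b) (wr b)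
  have hsum : ∀ s, 3 ≤ s → ∑ b ∈ Finset.univ.erase 0, w b (2 * s) ≤ 1 + 4 * p * p ^ s := by
    intro s hs
    have : Fintype (GaloisField p (2 * s)) := Fintype.ofFinite _
    have hcard : Fintype.card (GaloisField p (2 * s)) = (p ^ s) ^ 2 := by
      rw [← Nat.card_eq_fintype_card, GaloisField.card p _ (by omega), mul_comm, pow_mul]
    have hps : 2 * p + 3 ≤ p ^ s := by
      have h2 := hp.two_le
      have h3 : p ^ 3 ≤ p ^ s := Nat.pow_le_pow_right hp.pos hs
      have : 3 ≤ p := by omega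
      have : 9 * p ≤ p ^ 3 := by
        rw [show p ^ 3 = p * p * p by ring]
        exact Nat.mul_le_mul_right p (show 3 * 3 ≤ p * p from Nat.mul_le_mul this this)
      omega
    have h1 := KE_bound (k := GaloisField p (2 * s)) hp2 ha s hcard hps
    have h2 : ∑ b ∈ Finset.univ.erase 0, KE p (GaloisField p (2 * s)) a b =
        -((∑ b ∈ Finset.univ.erase 0, w b (2 * s) : ℝ) : ℂ) := by
      push_cast
      rw [← Finset.sum_neg_distrib]
      refine Finset.sum_congr rfl fun b hb => ?_
      rw [KE_eq a b (2 * s) (GaloisField.finrank p (by omega))]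
      have := (hL b (Finset.ne_of_mem_erase hb) (2 * s - 1)).1
      rw [show 2 * s - 1 + 1 = 2 * s by omega] at this
      exact this
    rw [h2, norm_neg, Complex.norm_real, Real.norm_eq_abs] at h1
    exact (le_abs_self _).trans h1
  have hone : ∀ s, 3 ≤ s → w 1 (2 * s) ≤ (1 + 6 * p) * p ^ s := by
    intro s hs
    have h1 := hsum s hs
    rw [← Finset.add_sum_erase _ _ (show (1 : ZMod p) ∈ Finset.univ.erase 0 by simp)] at h1
    have h2 : ∑ b ∈ (Finset.univ.erase (0 : ZMod p)).erase 1, (-2 * (p : ℝ) ^ s) ≤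
      ∑ b ∈ (Finset.univ.erase 0).erase 1, w b (2 * s) :=
      Finset.sum_le_sum fun b _ => (hlow b).1 s
    rw [Finset.sum_const, nsmul_eq_mul] at h2
    have h3 : (((Finset.univ.erase (0 : ZMod p)).erase 1).card : ℝ) ≤ p := by
      have : ((Finset.univ.erase (0 : ZMod p)).erase 1).card ≤ p := by
        refine (Finset.card_le_univ _).trans ?_
        rw [ZMod.card]
      exact_mod_cast this
    have h4 : (1 : ℝ) ≤ p ^ s := one_le_pow₀ (by exact_mod_cast hp.one_lt.le)
    nlinarith
  have hfinal : (κ 1) ^ 2 ≤ 4 * p := by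
    by_contra hcon
    push Not at hcon
    obtain ⟨r, hr, hrs⟩ := (hlow 1).2 hcon
    have h1 : 1 < r / p := (one_lt_div hp0).2 hr
    obtain ⟨s, hs⟩ := pow_unbounded_of_one_lt (1 + 6 * p : ℝ) h1
    have h2 : (r / p) ^ s ≤ (r / p) ^ (s + 3) := pow_le_pow_right₀ h1.le (by omega)
    have h3 := (hrs (s + 3)).trans (hone (s + 3) (by omega))
    have h4 : (r / p) ^ (s + 3) ≤ 1 + 6 * p := by
      rw [div_pow, div_le_iff₀ (by positivity)]
      exact h3
    linarith
  rw [hκ, Complex.norm_real, Real.norm_eq_abs]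
  apply abs_le_of_sq_le_sq _ (by positivity)
  rw [mul_pow, Real.sq_sqrt hp0.le]
  linarith

end Weil

end part5

section part6

/-- Kloosterman sum over units -/
noncomputable def KS (N : ℕ) [NeZero N] (a b : ZMod N) : ℂ :=
  ∑ u : (ZMod N)ˣ, ZMod.stdAddChar (a * (u : ZMod N) + b * ((u⁻¹ : (ZMod N)ˣ) : ZMod N))

section primecase
variable {p : ℕ} [Fact p.Prime]

lemma KS_inv {N : ℕ} [NeZero N] (a b : ZMod N) : KS N a b = KS N b a := by
  unfold KS
  refine Fintype.sum_equiv (Equiv.inv _) _ _ fun x => ?_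
  congr 1
  change _ = b * ((x⁻¹ : (ZMod N)ˣ) : ZMod N) + a * ((x⁻¹⁻¹ : (ZMod N)ˣ) : ZMod N)
  rw [inv_inv]; ring

lemma KS_zero {a : ZMod p} (ha : a ≠ 0) : ‖KS p a 0‖ = 1 := by
  classical
  have h : ∑ x : ZMod p, ZMod.stdAddChar (N := p) (x * a) = 0 := by
    rw [AddChar.sum_mulShift a (ZMod.isPrimitive_stdAddChar p), if_neg ha]; simp
  have h2 : KS p a 0 = ∑ x ∈ Finset.univ.erase (0 : ZMod p), ZMod.stdAddChar (N := p) (x * a) := by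
    unfold KS
    refine Finset.sum_bij (fun u _ => (u : ZMod p)) ?_ ?_ ?_ ?_
    · intro u _; simp
    · intro u _ v _ h; exact Units.ext h
    · intro x hx; exact ⟨Units.mk0 x (Finset.ne_of_mem_erase hx), Finset.mem_univ _, rfl⟩
    · intro u _; rw [zero_mul, add_zero, mul_comm]
  rw [← Finset.add_sum_erase _ _ (Finset.mem_univ 0), ← h2] at h
  simp only [zero_mul, AddChar.map_zero_eq_one] at h
  rw [show KS p a 0 = -1 by linear_combination h]; simp

lemma KS_prime (hp2 : p ≠ 2) {a b : ZMod p} (hab : a ≠ 0 ∨ b ≠ 0) :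
    ‖KS p a b‖ ≤ 2 * Real.sqrt p := by
  have h1 : (1 : ℝ) ≤ 2 * Real.sqrt p := by
    have : (1 : ℝ) ≤ p := by exact_mod_cast (Fact.out : p.Prime).one_le
    have := Real.one_le_sqrt.2 this
    linarith
  by_cases ha : a = 0
  · subst ha
    rw [KS_inv, KS_zero (by simpa using hab)]; exact h1
  by_cases hb : b = 0
  · subst hb
    rw [KS_zero ha]; exact h1
  have : KS p a b = KP p (a * b) 1 := by
    unfold KS KP
    refine Fintype.sum_equiv (Equiv.mulLeft (Units.mk0 a ha)) _ _ fun x => ?_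
    congr 1
    have e1 := (Units.mk0 a ha).mul_inv
    change _ = 1 * (((Units.mk0 a ha * x : (ZMod p)ˣ) : ZMod p) +
      a * b * (((Units.mk0 a ha * x)⁻¹ : (ZMod p)ˣ) : ZMod p))
    rw [mul_inv, Units.val_mul, Units.val_mul]
    rw [Units.val_mk0] at e1 ⊢
    linear_combination (-b * ((x⁻¹ : (ZMod p)ˣ) : ZMod p)) * e1
  rw [this]
  exact weil_prime hp2 (mul_ne_zero ha hb)

end primecase

section pp
variable {p : ℕ} [hpF : Fact p.Prime] {k : ℕ}

lemma pk_zero {j : ℕ} (h : k ≤ j) : ((p : ZMod (p ^ k))) ^ j = 0 := by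
  have : ((p : ZMod (p ^ k))) ^ k = 0 := by rw [← Nat.cast_pow, ZMod.natCast_self]
  rw [← Nat.sub_add_cancel h, pow_add, this, mul_zero]

lemma pk_ne {j : ℕ} (h : j < k) : ((p : ZMod (p ^ k))) ^ j ≠ 0 := by
  rw [← Nat.cast_pow, Ne, ZMod.natCast_eq_zero_iff]
  intro h'
  exact absurd ((Nat.pow_dvd_pow_iff_le_right hpF.out.one_lt).1 h') (by omega)

lemma unit_or_dvd (x : ZMod (p ^ k)) : IsUnit x ∨ ∃ y, x = p * y := by
  by_cases h : p ∣ x.val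
  · obtain ⟨y, hy⟩ := h
    right
    exact ⟨y, by rw [← ZMod.natCast_zmod_val x, hy]; push_cast; rfl⟩
  · left
    rw [← ZMod.natCast_zmod_val x, ZMod.isUnit_iff_coprime]
    exact (((Nat.Prime.coprime_iff_not_dvd hpF.out).2 h).symm).pow_right k

lemma not_unit (hk : 1 ≤ k) (y : ZMod (p ^ k)) : ¬ IsUnit ((p : ZMod (p ^ k)) * y) := by
  intro h
  have h1 := h.pow k
  rw [mul_pow, pk_zero le_rfl, zero_mul] at h1
  have : Nontrivial (ZMod (p ^ k)) := by
    have : Fact (1 < p ^ k) := ⟨Nat.one_lt_pow (by omega) hpF.out.one_lt⟩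
    exact ZMod.nontrivial _
  exact not_isUnit_zero h1

lemma unit_of_add (hk : 1 ≤ k) {x y : ZMod (p ^ k)} (h : IsUnit (x + y)) : IsUnit x ∨ IsUnit y := by
  rcases unit_or_dvd x with hx | ⟨x', rfl⟩
  · exact Or.inl hx
  rcases unit_or_dvd y with hy | ⟨y', rfl⟩
  · exact Or.inr hy
  rw [← mul_add] at h
  exact absurd h (not_unit hk _)

lemma count_lin {N : ℕ} [NeZero N] (d : ℕ) (hd : 0 < d) (w : ZMod N) :
    (Finset.univ.filter fun u : (ZMod N)ˣ => (d : ZMod N) * ((u : ZMod N) + w) = 0).card ≤ d := by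
  classical
  refine le_trans ?_ (IsAddCyclic.card_nsmul_eq_zero_le (α := ZMod N) hd)
  refine Finset.card_le_card_of_injOn (fun u => (u : ZMod N) + w) ?_ ?_
  · intro u hu
    simp only [Finset.coe_filter, Finset.mem_univ, true_and, Set.mem_ofPred_eq] at hu ⊢
    rw [nsmul_eq_mul]; exact hu
  · intro u _ v _ h
    exact Units.ext (add_right_cancel h)

lemma two_factor (hk : 1 ≤ k) (u v : (ZMod (p ^ k))ˣ) (q : ZMod (p ^ k))
    (h : q * (((u : ZMod (p ^ k)) - v) * (u + v)) = 0) :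
    q * 2 * ((u : ZMod (p ^ k)) - v) = 0 ∨ q * 2 * ((u : ZMod (p ^ k)) + v) = 0 := by
  by_cases hp2 : p = 2
  · have hodd : ∀ w : (ZMod (p ^ k))ˣ, ∃ y, (w : ZMod (p ^ k)) = 1 + 2 * y := by
      intro w
      rcases unit_or_dvd ((w : ZMod (p ^ k)) - 1) with hw | ⟨y, hy⟩
      · exfalso
        rcases Nat.even_or_odd (w : ZMod (p ^ k)).val with he | ho
        · obtain ⟨r, hr⟩ := he
          refine not_unit hk (r : ZMod (p ^ k)) ?_
          have : (p : ZMod (p ^ k)) * r = w := by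
            rw [← ZMod.natCast_zmod_val (w : ZMod (p ^ k)), hr, hp2]; push_cast; ring
          rw [this]; exact w.isUnit
        · obtain ⟨r, hr⟩ := ho
          refine not_unit hk (r : ZMod (p ^ k)) ?_
          have : (p : ZMod (p ^ k)) * r = w - 1 := by
            rw [← ZMod.natCast_zmod_val (w : ZMod (p ^ k)), hr]
            push_cast
            rw [add_sub_cancel_right]
            congr 1
            have := congrArg (Nat.cast : ℕ → ZMod (p ^ k)) hp2
            simpa using this
          rw [this]; exact hw
      · refine ⟨y, ?_⟩
        have := congrArg (Nat.cast : ℕ → ZMod (p ^ k)) hp2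
        push_cast at this
        rw [this] at hy
        linear_combination hy
    obtain ⟨y, hy⟩ := hodd u
    obtain ⟨z, hz⟩ := hodd v
    have hu : IsUnit ((y - z + v) + -(y - z)) := by
      rw [show (y - z + v) + -(y - z) = (v : ZMod (p ^ k)) by ring]; exact v.isUnit
    rcases unit_of_add hk hu with h' | h'
    · left
      rw [← h'.mul_left_eq_zero]
      rw [hy, hz] at h ⊢
      linear_combination h
    · right
      rw [← h'.mul_left_eq_zero]
      rw [hy, hz] at h ⊢
      linear_combination -h
  · have h2 : IsUnit (2 : ZMod (p ^ k)) := by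
      have := (ZMod.isUnit_iff_coprime 2 (p ^ k)).2
        ((Nat.Coprime.pow_right k ((Nat.coprime_primes Nat.prime_two hpF.out).2 (Ne.symm hp2))))
      simpa using this
    have hu : IsUnit (((u : ZMod (p ^ k)) + v) + -(u - v)) := by
      rw [show ((u : ZMod (p ^ k)) + v) + -(u - v) = 2 * v by ring]; exact h2.mul v.isUnit
    rcases unit_of_add hk hu with h' | h'
    · left
      rw [← h'.mul_left_eq_zero]
      linear_combination 2 * h
    · right
      rw [← h'.mul_left_eq_zero]
      linear_combination -2 * h

lemma both_unit {s : ℕ} (hs : s < k) {a b : ZMod (p ^ k)} (hab : IsUnit a ∨ IsUnit b)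
    (u : (ZMod (p ^ k))ˣ) (h : (p : ZMod (p ^ k)) ^ s * (a * u - b * ((u⁻¹ : (ZMod (p ^ k))ˣ) : ZMod (p ^ k))) = 0) :
    IsUnit a ∧ IsUnit b := by
  have key : ∀ (c d : ZMod (p ^ k)), IsUnit c → (p : ZMod (p ^ k)) ^ s * (c - d) = 0 → IsUnit d := by
    intro c d hc h
    have : IsUnit (d + (c - d)) := by simpa using hc
    rcases unit_of_add (by omega) this with h' | h'
    · exact h'
    · rw [h'.mul_left_eq_zero] at h
      exact absurd h (pk_ne hs)
  rcases hab with ha | hb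
  · exact ⟨ha, isUnit_of_mul_isUnit_left (key _ _ (ha.mul u.isUnit) h)⟩
  · refine ⟨isUnit_of_mul_isUnit_left (key _ (a * u) (hb.mul (u⁻¹).isUnit) ?_), hb⟩
    linear_combination -h

lemma count_quad {s : ℕ} (hs : s < k) {a b : ZMod (p ^ k)} (hab : IsUnit a ∨ IsUnit b) :
    (Finset.univ.filter fun u : (ZMod (p ^ k))ˣ =>
      (p : ZMod (p ^ k)) ^ s * (a * u - b * ((u⁻¹ : (ZMod (p ^ k))ˣ) : ZMod (p ^ k))) = 0).card ≤ 4 * p ^ s := by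
  classical
  rcases Finset.eq_empty_or_nonempty (Finset.univ.filter fun u : (ZMod (p ^ k))ˣ =>
      (p : ZMod (p ^ k)) ^ s * (a * u - b * ((u⁻¹ : (ZMod (p ^ k))ˣ) : ZMod (p ^ k))) = 0) with h | ⟨v, hv⟩
  · rw [h]; simp
  rw [Finset.mem_filter] at hv
  have hv := hv.2
  obtain ⟨ha, hb⟩ := both_unit hs hab v hv
  have hpos : 0 < p ^ s * 2 := by have := pow_pos hpF.out.pos s; omega
  calc _ ≤ ((Finset.univ.filter fun u : (ZMod (p ^ k))ˣ =>
        ((p ^ s * 2 : ℕ) : ZMod (p ^ k)) * ((u : ZMod (p ^ k)) + (-v)) = 0) ∪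
        (Finset.univ.filter fun u : (ZMod (p ^ k))ˣ =>
        ((p ^ s * 2 : ℕ) : ZMod (p ^ k)) * ((u : ZMod (p ^ k)) + v) = 0)).card := by
        refine Finset.card_le_card fun u hu => ?_
        rw [Finset.mem_filter] at hu
        have hu := hu.2
        rw [Finset.mem_union, Finset.mem_filter, Finset.mem_filter]
        push_cast
        have h3 : (p : ZMod (p ^ k)) ^ s * (((u : ZMod (p ^ k)) - v) * (u + v)) = 0 := by
          rw [← ha.mul_right_eq_zero]
          have e1 := u.mul_inv
          have e2 := v.mul_inv
          linear_combination u * hu - v * hv + p ^ s * b * e1 - p ^ s * b * e2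
        rcases two_factor (by omega) u v _ h3 with h4 | h4
        · left; exact ⟨Finset.mem_univ _, by rw [← sub_eq_add_neg]; exact h4⟩
        · right; exact ⟨Finset.mem_univ _, h4⟩
    _ ≤ p ^ s * 2 + p ^ s * 2 := (Finset.card_union_le _ _).trans
        (Nat.add_le_add (count_lin _ hpos _) (count_lin _ hpos _))
    _ = _ := by ring

end pp

end part6

section part7

section shift
variable {N : ℕ} [NeZero N]

/-- averaging over a family of unit multipliers -/
lemma KS_avg (a b : ZMod N) (v : ZMod N → (ZMod N)ˣ) :
    (N : ℂ) * KS N a b = ∑ u : (ZMod N)ˣ, ∑ t : ZMod N,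
      ZMod.stdAddChar (a * (u * v t : ZMod N) + b * (((u⁻¹ : (ZMod N)ˣ) : ZMod N) * (((v t)⁻¹ : (ZMod N)ˣ) : ZMod N))) := by
  rw [Finset.sum_comm]
  rw [Finset.sum_congr rfl (g := fun _ => KS N a b)]
  · rw [Finset.sum_const, Finset.card_univ, ZMod.card, nsmul_eq_mul]
  · intro t _
    unfold KS
    symm
    refine Fintype.sum_equiv (Equiv.mulRight (v t)⁻¹) _ _ fun x => ?_
    congr 1
    change _ = a * (((x * (v t)⁻¹ : (ZMod N)ˣ) : ZMod N) * (v t : ZMod N)) +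
      b * ((((x * (v t)⁻¹)⁻¹ : (ZMod N)ˣ) : ZMod N) * (((v t)⁻¹ : (ZMod N)ˣ) : ZMod N))
    rw [← Units.val_mul, ← Units.val_mul, inv_mul_cancel_right]
    rw [mul_inv, inv_inv, mul_inv_cancel_right]

lemma KS_lemA (a b q : ZMod N) (hq : q * q = 0) :
    ‖KS N a b‖ ≤ (Finset.univ.filter fun u : (ZMod N)ˣ =>
      q * (a * u - b * ((u⁻¹ : (ZMod N)ˣ) : ZMod N)) = 0).card := by
  classical
  let v : ZMod N → (ZMod N)ˣ := fun t => ⟨1 + q * t, 1 - q * t, by linear_combination -t * t * hq,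
    by linear_combination -t * t * hq⟩
  have h := KS_avg a b v
  have hN : (0 : ℝ) < N := by exact_mod_cast Nat.pos_of_ne_zero (NeZero.ne N)
  have h2 : ∀ u : (ZMod N)ˣ, ∑ t : ZMod N,
      ZMod.stdAddChar (a * (u * v t : ZMod N) + b * (((u⁻¹ : (ZMod N)ˣ) : ZMod N) * (((v t)⁻¹ : (ZMod N)ˣ) : ZMod N)))
      = ZMod.stdAddChar (a * (u : ZMod N) + b * ((u⁻¹ : (ZMod N)ˣ) : ZMod N)) *
        ((if q * (a * u - b * ((u⁻¹ : (ZMod N)ˣ) : ZMod N)) = 0 then N else 0 : ℕ) : ℂ) := by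
    intro u
    have := AddChar.sum_mulShift (q * (a * u - b * ((u⁻¹ : (ZMod N)ˣ) : ZMod N)))
      (ZMod.isPrimitive_stdAddChar N)
    rw [ZMod.card] at this
    rw [← this, Finset.mul_sum]
    refine Finset.sum_congr rfl fun t _ => ?_
    rw [← AddChar.map_add_eq_mul]
    congr 1
    change a * (u * (1 + q * t)) + b * (((u⁻¹ : (ZMod N)ˣ) : ZMod N) * (1 - q * t)) = _
    ring
  rw [Finset.sum_congr rfl fun u _ => h2 u] at h
  have h3 : (N : ℝ) * ‖KS N a b‖ ≤ N * (Finset.univ.filter fun u : (ZMod N)ˣ =>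
      q * (a * u - b * ((u⁻¹ : (ZMod N)ˣ) : ZMod N)) = 0).card := by
    calc (N : ℝ) * ‖KS N a b‖ = ‖(N : ℂ) * KS N a b‖ := by simp
      _ ≤ ∑ u : (ZMod N)ˣ, ((if q * (a * u - b * ((u⁻¹ : (ZMod N)ˣ) : ZMod N)) = 0 then N else 0 : ℕ) : ℝ) := by
        rw [h]
        refine (norm_sum_le _ _).trans (Finset.sum_le_sum fun u _ => ?_)
        rw [norm_mul, AddChar.norm_apply, one_mul, Complex.norm_natCast]
      _ = _ := by
        rw [← Nat.cast_sum, ← Finset.sum_filter, Finset.sum_const]; simp [mul_comm]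
  exact le_of_mul_le_mul_left h3 hN

/-- quadratic exponential sum -/
noncomputable def WQ (N : ℕ) [NeZero N] (A B : ZMod N) : ℂ :=
  ∑ t : ZMod N, ZMod.stdAddChar (A * t + B * t ^ 2)

lemma WQ_sq (A B : ZMod N) :
    ‖WQ N A B‖ ^ 2 ≤ N * (Finset.univ.filter fun h : ZMod N => 2 * B * h = 0).card := by
  classical
  have h1 : ((‖WQ N A B‖ ^ 2 : ℝ) : ℂ) = ∑ h : ZMod N, ZMod.stdAddChar (A * h + B * h ^ 2) *
      ((if 2 * B * h = 0 then N else 0 : ℕ) : ℂ) := by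
    rw [Complex.ofReal_pow, ← Complex.mul_conj']
    unfold WQ
    rw [map_sum, Finset.mul_sum]
    have : ∀ h : ZMod N, ZMod.stdAddChar (A * h + B * h ^ 2) *
      ((if 2 * B * h = 0 then N else 0 : ℕ) : ℂ) = ∑ t : ZMod N,
        ZMod.stdAddChar (A * (h + t) + B * (h + t) ^ 2) *
          (starRingEnd ℂ) (ZMod.stdAddChar (A * t + B * t ^ 2)) := by
      intro h
      have := AddChar.sum_mulShift (2 * B * h) (ZMod.isPrimitive_stdAddChar N)
      rw [ZMod.card] at this
      rw [← this, Finset.mul_sum]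
      refine Finset.sum_congr rfl fun t _ => ?_
      rw [← AddChar.map_neg_eq_conj, ← AddChar.map_add_eq_mul, ← AddChar.map_add_eq_mul]
      congr 1
      ring
    rw [Finset.sum_congr rfl fun h _ => this h, Finset.sum_comm]
    refine Finset.sum_congr rfl fun t _ => ?_
    rw [Finset.sum_mul]
    symm
    exact Fintype.sum_equiv (Equiv.addRight t) _ _ fun x => rfl
  have h2 : ‖WQ N A B‖ ^ 2 = ‖((‖WQ N A B‖ ^ 2 : ℝ) : ℂ)‖ := by
    rw [Complex.norm_real, Real.norm_of_nonneg (by positivity)]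
  rw [h2, h1]
  calc _ ≤ ∑ h : ZMod N, ((if 2 * B * h = 0 then N else 0 : ℕ) : ℝ) := by
        refine (norm_sum_le _ _).trans (Finset.sum_le_sum fun u _ => ?_)
        rw [norm_mul, AddChar.norm_apply, one_mul, Complex.norm_natCast]
    _ = _ := by
        rw [← Nat.cast_sum, ← Finset.sum_filter, Finset.sum_const]; simp [mul_comm]

lemma WQ_zero (A B P : ZMod N) (hP : P * B = 0) (hA : P * A ≠ 0) : WQ N A B = 0 := by
  classical
  have h1 : ∀ z, WQ N A B = ZMod.stdAddChar (z * (P * A)) * WQ N A B := by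
    intro z
    unfold WQ
    rw [Finset.mul_sum]
    refine Fintype.sum_equiv (Equiv.addRight (-(P * z))) _ _ fun x => ?_
    change _ = _ * ZMod.stdAddChar (A * (x + -(P * z)) + B * (x + -(P * z)) ^ 2)
    rw [← AddChar.map_add_eq_mul]
    congr 1
    linear_combination (2 * x * z - P * z ^ 2) * hP
  have h2 : ∑ z : ZMod N, WQ N A B = ∑ z : ZMod N, ZMod.stdAddChar (z * (P * A)) * WQ N A B :=
    Finset.sum_congr rfl fun z _ => h1 z
  rw [← Finset.sum_mul, AddChar.sum_mulShift _ (ZMod.isPrimitive_stdAddChar N), if_neg hA] at h2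
  simp at h2
  exact h2.resolve_left (NeZero.ne N)

lemma KS_lemB (a b q P : ZMod N) (hq : q * q * q = 0) (hP : P * (q * q) = 0) (M : ℝ)
    (hM : ∀ u : (ZMod N)ˣ, P * q * (a * u - b * ((u⁻¹ : (ZMod N)ˣ) : ZMod N)) = 0 →
      ∀ A, ‖WQ N A (q * q * (b * ((u⁻¹ : (ZMod N)ˣ) : ZMod N)))‖ ≤ N * M) :
    ‖KS N a b‖ ≤ (Finset.univ.filter fun u : (ZMod N)ˣ =>
      P * q * (a * u - b * ((u⁻¹ : (ZMod N)ˣ) : ZMod N)) = 0).card * M := by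
  classical
  let v : ZMod N → (ZMod N)ˣ := fun t => ⟨1 + q * t, 1 - q * t + q * q * t ^ 2,
    by linear_combination t ^ 3 * hq, by linear_combination t ^ 3 * hq⟩
  have h := KS_avg a b v
  have hN : (0 : ℝ) < N := by exact_mod_cast Nat.pos_of_ne_zero (NeZero.ne N)
  have h2 : ∀ u : (ZMod N)ˣ, ∑ t : ZMod N,
      ZMod.stdAddChar (a * (u * v t : ZMod N) + b * (((u⁻¹ : (ZMod N)ˣ) : ZMod N) * (((v t)⁻¹ : (ZMod N)ˣ) : ZMod N)))
      = ZMod.stdAddChar (a * (u : ZMod N) + b * ((u⁻¹ : (ZMod N)ˣ) : ZMod N)) *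
        WQ N (q * (a * u - b * ((u⁻¹ : (ZMod N)ˣ) : ZMod N))) (q * q * (b * ((u⁻¹ : (ZMod N)ˣ) : ZMod N))) := by
    intro u
    unfold WQ
    rw [Finset.mul_sum]
    refine Finset.sum_congr rfl fun t _ => ?_
    rw [← AddChar.map_add_eq_mul]
    congr 1
    change a * (u * (1 + q * t)) + b * (((u⁻¹ : (ZMod N)ˣ) : ZMod N) * (1 - q * t + q * q * t ^ 2)) = _
    ring
  rw [Finset.sum_congr rfl fun u _ => h2 u] at h
  have h3 : (N : ℝ) * ‖KS N a b‖ ≤ N * ((Finset.univ.filter fun u : (ZMod N)ˣ =>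
      P * q * (a * u - b * ((u⁻¹ : (ZMod N)ˣ) : ZMod N)) = 0).card * M) := by
    calc (N : ℝ) * ‖KS N a b‖ = ‖(N : ℂ) * KS N a b‖ := by simp
      _ ≤ ∑ u : (ZMod N)ˣ, (if P * q * (a * u - b * ((u⁻¹ : (ZMod N)ˣ) : ZMod N)) = 0 then N * M else 0) := by
        rw [h]
        refine (norm_sum_le _ _).trans (Finset.sum_le_sum fun u _ => ?_)
        rw [norm_mul, AddChar.norm_apply, one_mul]
        split_ifs with hu
        · exact hM u hu _
        · rw [WQ_zero _ _ P (by linear_combination b * ((u⁻¹ : (ZMod N)ˣ) : ZMod N) * hP)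
            (by rwa [← mul_assoc])]; simp
      _ = _ := by
        rw [← Finset.sum_filter, Finset.sum_const, nsmul_eq_mul]; ring
  exact le_of_mul_le_mul_left h3 hN

end shift

section pp2
variable {p : ℕ} [hpF : Fact p.Prime]

lemma KS_triv (N : ℕ) [NeZero N] (a b : ZMod N) : ‖KS N a b‖ ≤ Nat.totient N := by
  refine (norm_sum_le _ _).trans ?_
  rw [Finset.sum_congr rfl fun u _ => AddChar.norm_apply _ _, Finset.sum_const, Finset.card_univ,
    ZMod.card_units_eq_totient]
  simp

lemma KS_A {k s : ℕ} (hs : s < k) (hsk : k ≤ 2 * s) {a b : ZMod (p ^ k)} (hab : IsUnit a ∨ IsUnit b) :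
    ‖KS (p ^ k) a b‖ ≤ 4 * (p : ℝ) ^ s := by
  have h1 := KS_lemA a b ((p : ZMod (p ^ k)) ^ s) (by rw [← pow_add]; exact pk_zero (by omega))
  refine h1.trans ?_
  exact_mod_cast count_quad hs hab

lemma KS_B {l : ℕ} (hl : 1 ≤ l) (hp2 : p ≠ 2) {a b : ZMod (p ^ (2 * l + 1))} (hab : IsUnit a ∨ IsUnit b) :
    ‖KS (p ^ (2 * l + 1)) a b‖ ≤ 4 * (p : ℝ) ^ (l + 1) * (1 / Real.sqrt p) := by
  classical
  have hp0 : (0 : ℝ) < p := by exact_mod_cast hpF.out.pos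
  have h1 := KS_lemB a b ((p : ZMod (p ^ (2 * l + 1))) ^ l) (p : ZMod (p ^ (2 * l + 1)))
    (by rw [← pow_add, ← pow_add]; exact pk_zero (by omega))
    (by rw [← pow_add, ← pow_succ']; exact pk_zero (by omega)) (1 / Real.sqrt p) ?_
  · refine h1.trans ?_
    refine mul_le_mul_of_nonneg_right ?_ (by positivity)
    simp only [← pow_succ']
    exact_mod_cast count_quad (by omega) hab
  · intro u hu A
    rw [← pow_succ'] at hu
    obtain ⟨_, hb⟩ := both_unit (by omega) hab u hu
    have h2 := WQ_sq A ((p : ZMod (p ^ (2 * l + 1))) ^ l * (p : ZMod (p ^ (2 * l + 1))) ^ l * (b * ((u⁻¹ : (ZMod (p ^ (2 * l + 1)))ˣ) : ZMod (p ^ (2 * l + 1)))))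
    have h2u : IsUnit (2 : ZMod (p ^ (2 * l + 1))) := by
      have := (ZMod.isUnit_iff_coprime 2 (p ^ (2 * l + 1))).2
        ((Nat.Coprime.pow_right _ ((Nat.coprime_primes Nat.prime_two hpF.out).2 (Ne.symm hp2))))
      simpa using this
    have hc : (Finset.univ.filter fun h : ZMod (p ^ (2 * l + 1)) => 2 * ((p : ZMod (p ^ (2 * l + 1))) ^ l * (p : ZMod (p ^ (2 * l + 1))) ^ l * (b * ((u⁻¹ : (ZMod (p ^ (2 * l + 1)))ˣ) : ZMod (p ^ (2 * l + 1))))) * h = 0).card ≤ p ^ (2 * l) := by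
      refine le_trans (Finset.card_le_card ?_)
        (IsAddCyclic.card_nsmul_eq_zero_le (α := ZMod (p ^ (2 * l + 1))) (pow_pos hpF.out.pos (2 * l)))
      intro h hh
      rw [Finset.mem_filter] at hh ⊢
      refine ⟨Finset.mem_univ _, ?_⟩
      rw [nsmul_eq_mul]
      have hh := hh.2
      have hU := h2u.mul (hb.mul (Units.isUnit (u⁻¹)))
      rw [← hU.mul_right_eq_zero]
      push_cast
      rw [← hh]; ring
    have h3 : ‖WQ (p ^ (2 * l + 1)) A ((p : ZMod (p ^ (2 * l + 1))) ^ l * (p : ZMod (p ^ (2 * l + 1))) ^ l * (b * ((u⁻¹ : (ZMod (p ^ (2 * l + 1)))ˣ) : ZMod (p ^ (2 * l + 1)))))‖ ^ 2 ≤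
        (((p ^ (2 * l + 1) : ℕ) : ℝ) * (1 / Real.sqrt p)) ^ 2 := by
      refine h2.trans ?_
      have : (((p ^ (2 * l + 1) : ℕ) : ℝ) * (1 / Real.sqrt p)) ^ 2 =
          ((p ^ (2 * l + 1) : ℕ) : ℝ) * ((p ^ (2 * l) : ℕ) : ℝ) := by
        rw [mul_pow, div_pow, Real.sq_sqrt hp0.le]
        push_cast; field_simp; ring
      rw [this]
      exact mul_le_mul_of_nonneg_left (Nat.cast_le.2 hc) (Nat.cast_nonneg _)
    exact le_of_sq_le_sq h3 (by positivity)

lemma KS_pp {k : ℕ} {a b : ZMod (p ^ k)} (hk : 1 ≤ k) (hab : IsUnit a ∨ IsUnit b) :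
    ‖KS (p ^ k) a b‖ ≤ 8 * Real.sqrt ((p ^ k : ℕ) : ℝ) := by
  have hp0 : (0 : ℝ) < p := by exact_mod_cast hpF.out.pos
  have hsq : ∀ l : ℕ, Real.sqrt ((p ^ (2 * l) : ℕ) : ℝ) = (p : ℝ) ^ l := by
    intro l; push_cast; rw [mul_comm, pow_mul, Real.sqrt_sq (by positivity)]
  have hsq1 : ∀ l : ℕ, Real.sqrt ((p ^ (2 * l + 1) : ℕ) : ℝ) = (p : ℝ) ^ l * Real.sqrt p := by
    intro l
    rw [← hsq, ← Real.sqrt_mul (by positivity)]; congr 1; push_cast; ring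
  obtain ⟨l, rfl | rfl⟩ := Nat.even_or_odd' k
  · rw [hsq]
    refine (KS_A (s := l) (by omega) le_rfl hab).trans ?_
    have : (0 : ℝ) ≤ (p : ℝ) ^ l := by positivity
    linarith
  · rw [hsq1]
    by_cases hp2 : p = 2
    · rcases Nat.eq_zero_or_pos l with rfl | hl
      · refine (KS_triv _ _ _).trans ?_
        have : Nat.totient (p ^ (2 * 0 + 1)) = 1 := by rw [hp2]; rfl
        rw [this]
        have := Real.one_le_sqrt.2 (show (1 : ℝ) ≤ p by exact_mod_cast hpF.out.one_le)
        simp; linarith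
      · refine (KS_A (s := l + 1) (by omega) (by omega) hab).trans ?_
        have h2 : (p : ℝ) = Real.sqrt p * Real.sqrt p := (Real.mul_self_sqrt hp0.le).symm
        have h3 : Real.sqrt p ≤ 2 := by
          rw [Real.sqrt_le_left (by norm_num), hp2]; norm_num
        calc 4 * (p : ℝ) ^ (l + 1) = 4 * (p : ℝ) ^ l * Real.sqrt p * Real.sqrt p := by
              rw [pow_succ, mul_assoc _ (Real.sqrt p), ← h2]; ring
          _ ≤ 4 * (p : ℝ) ^ l * Real.sqrt p * 2 := mul_le_mul_of_nonneg_left h3 (by positivity)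
          _ = _ := by ring
    · rcases Nat.eq_zero_or_pos l with rfl | hl
      · have key : ∀ (q : ℕ) [NeZero q] (hq : q = p) (a b : ZMod q), (IsUnit a ∨ IsUnit b) →
            ‖KS q a b‖ ≤ 2 * Real.sqrt p := by
          clear hab hk a b
          intro q _ hq a b hab
          subst hq
          exact KS_prime hp2 (hab.imp IsUnit.ne_zero IsUnit.ne_zero)
        refine (key _ (by simp) a b hab).trans ?_
        have := Real.sqrt_nonneg (p : ℝ)
        simp only [pow_zero, one_mul]
        linarith
      · refine (KS_B hl hp2 hab).trans ?_
        have h2 : (p : ℝ) * (1 / Real.sqrt p) = Real.sqrt p := by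
          rw [mul_one_div, Real.div_sqrt]
        rw [pow_succ, mul_assoc, mul_assoc, h2]
        have : 0 ≤ (p : ℝ) ^ l * Real.sqrt p := by positivity
        linarith

end pp2

end part7

section part8

lemma KS_cast {N N' : ℕ} [NeZero N] [NeZero N'] (h : N = N') (n m : ℤ) :
    KS N (n : ZMod N) m = KS N' (n : ZMod N') m := by
  subst h; rfl

lemma char_scale (d M : ℕ) [NeZero d] [NeZero M] (z : ZMod (d * M)) :
    ZMod.stdAddChar ((d : ZMod (d * M)) * z) =
      ZMod.stdAddChar (ZMod.castHom (Dvd.intro_left d rfl : M ∣ d * M) (ZMod M) z) := by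
  obtain ⟨j, rfl⟩ := ZMod.intCast_surjective z
  rw [map_intCast, ZMod.stdAddChar_coe]
  rw [show (d : ZMod (d * M)) * (j : ZMod (d * M)) = ((d * j : ℤ) : ZMod (d * M)) by push_cast; rfl,
    ZMod.stdAddChar_coe]
  congr 1
  have h1 : (d : ℂ) ≠ 0 := by exact_mod_cast NeZero.ne d
  have h2 : (M : ℂ) ≠ 0 := by exact_mod_cast NeZero.ne M
  push_cast
  field_simp

lemma KS_scale (d M : ℕ) [NeZero d] [NeZero M] (n m : ℤ) :
    ‖KS (d * M) ((d * n : ℤ) : ZMod (d * M)) ((d * m : ℤ) : ZMod (d * M))‖ ≤ d * ‖KS M (n : ZMod M) m‖ := by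
  classical
  let hd : M ∣ d * M := Dvd.intro_left d rfl
  have h1 : KS (d * M) ((d * n : ℤ) : ZMod (d * M)) ((d * m : ℤ) : ZMod (d * M)) =
      ∑ u : (ZMod (d * M))ˣ, (fun v : (ZMod M)ˣ => ZMod.stdAddChar (N := M)
        ((n : ZMod M) * v + m * ((v⁻¹ : (ZMod M)ˣ) : ZMod M))) (ZMod.unitsMap hd u) := by
    unfold KS
    refine Finset.sum_congr rfl fun u _ => ?_
    have e : ((d * n : ℤ) : ZMod (d * M)) * u + ((d * m : ℤ) : ZMod (d * M)) * ((u⁻¹ : (ZMod (d * M))ˣ) : ZMod (d * M))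
      = d * (n * u + m * ((u⁻¹ : (ZMod (d * M))ˣ) : ZMod (d * M))) := by push_cast; ring
    rw [e, char_scale]
    congr 1
    rw [map_add, map_mul, map_mul, map_intCast, map_intCast, ← map_inv]
    rfl
  have hfib : ∀ v : (ZMod M)ˣ, (Finset.univ.filter fun u => ZMod.unitsMap hd u = v).card =
      (Finset.univ.filter fun u => ZMod.unitsMap hd u = 1).card := fun v =>
    MonoidHom.card_fiber_eq_of_mem_range _ (ZMod.unitsMap_surjective hd v) (ZMod.unitsMap_surjective hd 1)
  have hker : (Finset.univ.filter fun u => ZMod.unitsMap hd u = 1).card ≤ d := by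
    refine le_trans (Finset.card_le_card ?_) (count_lin (N := d * M) d (Nat.pos_of_ne_zero (NeZero.ne d)) (-1))
    intro u hu
    rw [Finset.mem_filter] at hu ⊢
    refine ⟨Finset.mem_univ _, ?_⟩
    have h2 := congrArg (Units.val) hu.2
    change ZMod.castHom hd (ZMod M) (u : ZMod (d * M)) = 1 at h2
    obtain ⟨j, hj⟩ := ZMod.intCast_surjective (u : ZMod (d * M))
    rw [← hj, map_intCast] at h2
    rw [← hj]
    have h3 : ((j - 1 : ℤ) : ZMod M) = 0 := by push_cast; rw [h2]; ring
    rw [ZMod.intCast_zmod_eq_zero_iff_dvd] at h3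
    rw [show (d : ZMod (d * M)) * ((j : ZMod (d * M)) + -1) = ((d * (j - 1) : ℤ) : ZMod (d * M)) by push_cast; ring,
      ZMod.intCast_zmod_eq_zero_iff_dvd]
    push_cast
    exact mul_dvd_mul_left _ h3
  rw [h1, ← Finset.sum_fiberwise (g := fun u => ZMod.unitsMap hd u)]
  have h4 : ∀ v : (ZMod M)ˣ, ∑ u ∈ Finset.univ.filter (fun u => ZMod.unitsMap hd u = v), (fun v : (ZMod M)ˣ => ZMod.stdAddChar (N := M)
        ((n : ZMod M) * v + m * ((v⁻¹ : (ZMod M)ˣ) : ZMod M))) (ZMod.unitsMap hd u) =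
      ((Finset.univ.filter fun u => ZMod.unitsMap hd u = 1).card : ℂ) * ZMod.stdAddChar (N := M)
        ((n : ZMod M) * v + m * ((v⁻¹ : (ZMod M)ˣ) : ZMod M)) := by
    intro v
    rw [← hfib v, ← nsmul_eq_mul, ← Finset.sum_const]
    refine Finset.sum_congr rfl fun u hu => ?_
    rw [(Finset.mem_filter.1 hu).2]
  rw [Finset.sum_congr rfl fun v _ => h4 v, ← Finset.mul_sum, norm_mul, Complex.norm_natCast]
  exact mul_le_mul_of_nonneg_right (by exact_mod_cast hker) (norm_nonneg _)

lemma KS_bound_pp (p : ℕ) [hpF : Fact p.Prime] (k : ℕ) : ∀ n m : ℤ,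
    ‖KS (p ^ k) (n : ZMod (p ^ k)) m‖ ≤
      8 * Real.sqrt (Int.gcd n ((p ^ k : ℕ) : ℤ)) * Real.sqrt ((p ^ k : ℕ) : ℝ) := by
  have hp0 : (0 : ℝ) < p := by exact_mod_cast hpF.out.pos
  have hu : ∀ k (n : ℤ), ¬ (p : ℤ) ∣ n → IsUnit (n : ZMod (p ^ k)) := by
    intro k n h
    rw [ZMod.coe_int_isUnit_iff_isCoprime]
    push_cast
    exact ((Prime.coprime_iff_not_dvd (Nat.prime_iff_prime_int.1 hpF.out)).2 h).pow_left
  induction k with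
  | zero =>
    intro n m
    refine (KS_triv _ _ _).trans ?_
    simp
  | succ k ih =>
    intro n m
    by_cases h : IsUnit (n : ZMod (p ^ (k + 1))) ∨ IsUnit (m : ZMod (p ^ (k + 1)))
    · refine (KS_pp (by omega) h).trans ?_
      refine mul_le_mul_of_nonneg_right ?_ (Real.sqrt_nonneg _)
      have : (1 : ℝ) ≤ (Int.gcd n ((p ^ (k + 1) : ℕ) : ℤ) : ℝ) := by
        exact_mod_cast Int.gcd_pos_of_ne_zero_right _ (by exact_mod_cast (pow_pos hpF.out.pos _).ne')
      have := Real.one_le_sqrt.2 this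
      linarith
    · push Not at h
      obtain ⟨n', rfl⟩ : (p : ℤ) ∣ n := by by_contra h'; exact h.1 (hu _ _ h')
      obtain ⟨m', rfl⟩ : (p : ℤ) ∣ m := by by_contra h'; exact h.2 (hu _ _ h')
      rw [KS_cast (pow_succ' p k)]
      refine (KS_scale p (p ^ k) n' m').trans ?_
      refine (mul_le_mul_of_nonneg_left (ih n' m') hp0.le).trans (le_of_eq ?_)
      have hg : Int.gcd (p * n') ((p ^ (k + 1) : ℕ) : ℤ) = p * Int.gcd n' ((p ^ k : ℕ) : ℤ) := by
        rw [pow_succ', Nat.cast_mul, Int.gcd_mul_left, Int.natAbs_natCast]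
      rw [hg, pow_succ']
      push_cast
      rw [Real.sqrt_mul hp0.le, Real.sqrt_mul hp0.le]
      have := Real.mul_self_sqrt hp0.le
      linear_combination (-8 * √(n'.gcd (p ^ k)) * √(p ^ k)) * this

lemma KS_mul (c d : ℕ) [NeZero c] [NeZero d] (α β : ℤ) (h : α * d + β * c = 1) (n m : ℤ) :
    KS (c * d) (n : ZMod (c * d)) m =
      KS c ((α * n : ℤ) : ZMod c) ((α * m : ℤ) : ZMod c) * KS d ((β * n : ℤ) : ZMod d) ((β * m : ℤ) : ZMod d) := by
  have hcop : Nat.Coprime c d := by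
    rw [← Nat.isCoprime_iff_coprime]
    exact ⟨β, α, by linear_combination h⟩
  let E : ZMod (c * d) ≃+* ZMod c × ZMod d := ZMod.chineseRemainder hcop
  have hchar : ∀ z : ZMod (c * d), ZMod.stdAddChar z =
      ZMod.stdAddChar ((α : ZMod c) * (E z).1) * ZMod.stdAddChar ((β : ZMod d) * (E z).2) := by
    intro z
    obtain ⟨j, rfl⟩ := ZMod.intCast_surjective z
    rw [map_intCast E, Prod.fst_intCast, Prod.snd_intCast, ← Int.cast_mul, ← Int.cast_mul,
      ZMod.stdAddChar_coe, ZMod.stdAddChar_coe, ZMod.stdAddChar_coe, ← Complex.exp_add]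
    congr 1
    have h1 : (c : ℂ) ≠ 0 := by exact_mod_cast NeZero.ne c
    have h2 : (d : ℂ) ≠ 0 := by exact_mod_cast NeZero.ne d
    have h3 : (α : ℂ) * d + β * c = 1 := by exact_mod_cast h
    push_cast
    field_simp
    linear_combination (-(j : ℂ)) * h3
  let F : (ZMod (c * d))ˣ ≃* (ZMod c)ˣ × (ZMod d)ˣ := (Units.mapEquiv E.toMulEquiv).trans MulEquiv.prodUnits
  unfold KS
  rw [Finset.sum_mul_sum, ← Finset.sum_product']
  refine Fintype.sum_equiv F.toEquiv _ _ fun u => ?_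
  rw [hchar]
  have e1 : ∀ w : (ZMod (c * d))ˣ, (E w).1 = ((F w).1 : ZMod c) := fun w => rfl
  have e2 : ∀ w : (ZMod (c * d))ˣ, (E w).2 = ((F w).2 : ZMod d) := fun w => rfl
  change _ = ZMod.stdAddChar (((α * n : ℤ) : ZMod c) * ((F u).1 : ZMod c) + ((α * m : ℤ) : ZMod c) * (((F u).1⁻¹ : (ZMod c)ˣ) : ZMod c)) *
    ZMod.stdAddChar (((β * n : ℤ) : ZMod d) * ((F u).2 : ZMod d) + ((β * m : ℤ) : ZMod d) * (((F u).2⁻¹ : (ZMod d)ˣ) : ZMod d))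
  rw [← Prod.fst_inv, ← Prod.snd_inv, ← map_inv, ← e1, ← e2, ← e1, ← e2]
  simp only [map_add, map_mul, map_intCast, Prod.fst_add, Prod.snd_add, Prod.fst_mul, Prod.snd_mul,
    Prod.fst_intCast, Prod.snd_intCast]
  push_cast
  congr 2 <;> ring

theorem KS_bound (c : ℕ) : ∀ [NeZero c] (n m : ℤ),
    ‖KS c (n : ZMod c) m‖ ≤ (c.divisors.card : ℝ) ^ 3 * Real.sqrt (Int.gcd n c) * Real.sqrt c := by
  induction c using Nat.recOnPosPrimePosCoprime with
  | prime_pow p k hp hk =>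
    intro _ n m
    have : Fact p.Prime := ⟨hp⟩
    refine (KS_bound_pp p k n m).trans ?_
    refine mul_le_mul_of_nonneg_right (mul_le_mul_of_nonneg_right ?_ (Real.sqrt_nonneg _)) (Real.sqrt_nonneg _)
    rw [Nat.divisors_prime_pow hp, Finset.card_map, Finset.card_range]
    have : (2 : ℝ) ≤ ((k + 1 : ℕ) : ℝ) := by exact_mod_cast (by omega : 2 ≤ k + 1)
    calc (8 : ℝ) = 2 ^ 3 := by norm_num
      _ ≤ _ := pow_le_pow_left₀ (by norm_num) this 3
  | zero => intro h; exact absurd rfl h.ne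
  | one =>
    intro _ n m
    refine (KS_triv _ _ _).trans ?_
    simp
  | coprime c d hc hd hcd ihc ihd =>
    intro _ n m
    have : NeZero c := ⟨by omega⟩
    have : NeZero d := ⟨by omega⟩
    obtain ⟨β, α, h⟩ := Nat.isCoprime_iff_coprime.2 hcd
    have h' : α * d + β * c = 1 := by linear_combination h
    rw [KS_mul c d α β h', norm_mul]
    have hg1 : Int.gcd (α * n) c = Int.gcd n c := by
      rw [Int.gcd_comm, Int.gcd_comm n]
      rw [mul_comm]
      apply Int.gcd_mul_left_right_of_gcd_eq_one
      rw [← Int.isCoprime_iff_gcd_eq_one]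
      exact ⟨β, d, by linear_combination h⟩
    have hg2 : Int.gcd (β * n) d = Int.gcd n d := by
      rw [Int.gcd_comm, Int.gcd_comm n]
      rw [mul_comm]
      apply Int.gcd_mul_left_right_of_gcd_eq_one
      rw [← Int.isCoprime_iff_gcd_eq_one]
      exact ⟨α, c, by linear_combination h⟩
    have h1 := ihc (α * n) (α * m)
    have h2 := ihd (β * n) (β * m)
    rw [hg1] at h1
    rw [hg2] at h2
    refine (mul_le_mul h1 h2 (norm_nonneg _) (by positivity)).trans (le_of_eq ?_)
    have hg : Int.gcd n ((c * d : ℕ) : ℤ) = Int.gcd n c * Int.gcd n d := by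
      rw [Int.gcd_eq_natAbs, Int.gcd_eq_natAbs, Int.gcd_eq_natAbs]
      exact Nat.Coprime.gcd_mul _ hcd
    rw [hg, Nat.Coprime.card_divisors_mul hcd]
    push_cast
    rw [Real.sqrt_mul (by positivity), Real.sqrt_mul (by positivity)]
    ring

end part8


lemma kloos_eq (n m : ℤ) (c : ℕ) [NeZero c] : kloos n m c = KS c (n : ZMod c) m := by
  unfold kloos KS
  rw [← Finset.sum_filter]
  symm
  refine Finset.sum_bij (fun u _ => (u : ZMod c).val) ?_ ?_ ?_ ?_
  · intro u _
    rw [Finset.mem_filter, Finset.mem_range]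
    exact ⟨ZMod.val_lt _, ZMod.val_coe_unit_coprime u⟩
  · intro u _ v _ h
    exact Units.ext (ZMod.val_injective c h)
  · intro b hb
    rw [Finset.mem_filter, Finset.mem_range] at hb
    refine ⟨ZMod.unitOfCoprime b hb.2, Finset.mem_univ _, ?_⟩
    rw [ZMod.coe_unitOfCoprime, ZMod.val_natCast, Nat.mod_eq_of_lt hb.1]
  · intro u _
    rw [ZMod.natCast_zmod_val, ZMod.inv_coe_unit]
    set z : ZMod c := (n : ZMod c) * u + m * ((u⁻¹ : (ZMod c)ˣ) : ZMod c)
    have h := ZMod.stdAddChar_coe (N := c) (z.val : ℤ)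
    rw [Int.cast_natCast, ZMod.natCast_zmod_val] at h
    rw [h]
    unfold ee
    congr 1
    push_cast
    ring

lemma tau_bound (δ : ℝ) (hδ : 0 < δ) :
    ∃ C : ℝ, 0 ≤ C ∧ ∀ c : ℕ, 1 ≤ c → (c.divisors.card : ℝ) ≤ C * (c : ℝ) ^ δ := by
  have hl : 0 < Real.log 2 := Real.log_pos (by norm_num)
  obtain ⟨M, hM⟩ := exists_nat_ge ((2 : ℝ) ^ (1 / δ))
  set K : ℝ := 1 + 1 / (δ * Real.log 2) with hK
  have hK1 : 1 ≤ K := by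
    have : 0 < 1 / (δ * Real.log 2) := by positivity
    linarith
  refine ⟨K ^ M, by positivity, fun c hc => ?_⟩
  have hc0 : c ≠ 0 := by omega
  have hloc : ∀ p ∈ c.primeFactors, ((c.factorization p + 1 : ℕ) : ℝ) ≤
      (if p < M then K else 1) * ((p : ℝ) ^ δ) ^ c.factorization p := by
    intro p hp
    have hpp := Nat.prime_of_mem_primeFactors hp
    generalize c.factorization p = k
    have hp2 : (2 : ℝ) ≤ p := by exact_mod_cast hpp.two_le
    split_ifs with h
    · have h1 : 1 + k * (δ * Real.log 2) ≤ ((p : ℝ) ^ δ) ^ k := by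
        have e1 : 1 + δ * Real.log 2 ≤ (p : ℝ) ^ δ := by
          calc 1 + δ * Real.log 2 ≤ Real.exp (Real.log 2 * δ) := by
                have := Real.add_one_le_exp (Real.log 2 * δ)
                linarith
            _ = (2 : ℝ) ^ δ := (Real.rpow_def_of_pos (by norm_num) δ).symm
            _ ≤ _ := Real.rpow_le_rpow (by norm_num) hp2 hδ.le
        have hpos : 0 < δ * Real.log 2 := by positivity
        calc 1 + k * (δ * Real.log 2) ≤ (1 + δ * Real.log 2) ^ k :=
              one_add_mul_le_pow (by linarith) k
          _ ≤ _ := pow_le_pow_left₀ (by positivity) e1 k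
      calc ((k + 1 : ℕ) : ℝ) ≤ K * (1 + k * (δ * Real.log 2)) := by
            rw [hK]
            have e : (1 + 1 / (δ * Real.log 2)) * (1 + k * (δ * Real.log 2)) =
              1 + k + (k * (δ * Real.log 2) + 1 / (δ * Real.log 2)) := by field_simp; ring
            rw [e]
            have : 0 ≤ k * (δ * Real.log 2) + 1 / (δ * Real.log 2) := by positivity
            push_cast
            linarith
        _ ≤ _ := mul_le_mul_of_nonneg_left h1 (by linarith)
    · have h1 : (2 : ℝ) ≤ (p : ℝ) ^ δ := by
        have e1 : (2 : ℝ) ^ (1 / δ) ≤ p := hM.trans (by exact_mod_cast (not_lt.1 h))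
        calc (2 : ℝ) = ((2 : ℝ) ^ (1 / δ)) ^ δ := by
              rw [← Real.rpow_mul (by norm_num), one_div_mul_cancel hδ.ne', Real.rpow_one]
          _ ≤ _ := Real.rpow_le_rpow (by positivity) e1 hδ.le
      rw [one_mul]
      calc ((k + 1 : ℕ) : ℝ) ≤ (2 : ℝ) ^ k := by exact_mod_cast Nat.lt_two_pow_self
        _ ≤ _ := pow_le_pow_left₀ (by norm_num) h1 k
  have hcprod : ∏ p ∈ c.primeFactors, ((p : ℝ) ^ δ) ^ c.factorization p = (c : ℝ) ^ δ := by
    have h1 : (c : ℝ) = ∏ p ∈ c.primeFactors, (p : ℝ) ^ c.factorization p := by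
      conv_lhs => rw [← Nat.prod_factorization_pow_eq_self hc0]
      rw [Finsupp.prod, Nat.support_factorization]
      push_cast
      rfl
    conv_rhs => rw [h1]
    rw [← Real.finsetProd_rpow _ _ (fun p _ => by positivity)]
    refine Finset.prod_congr rfl fun p _ => ?_
    rw [← Real.rpow_natCast, ← Real.rpow_natCast, ← Real.rpow_mul (by positivity),
      ← Real.rpow_mul (by positivity), mul_comm]
  rw [Nat.card_divisors hc0, Nat.cast_prod, ← hcprod]
  refine (Finset.prod_le_prod (fun _ _ => by positivity) hloc).trans ?_
  rw [Finset.prod_mul_distrib]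
  refine mul_le_mul_of_nonneg_right ?_ (Finset.prod_nonneg fun _ _ => by positivity)
  rw [← Finset.prod_filter, Finset.prod_const]
  refine pow_le_pow_right₀ hK1 ?_
  calc _ ≤ (Finset.range M).card := Finset.card_le_card fun p hp => by
        rw [Finset.mem_filter] at hp; exact Finset.mem_range.2 hp.2
    _ = M := Finset.card_range M

lemma gcd_sum (c : ℕ) (hc : 1 ≤ c) (x : ℝ) (hx : 1 ≤ x) :
    ∑ n ∈ Finset.Icc 1 ⌊x⌋₊, Real.sqrt (Int.gcd (n : ℤ) c) ≤ c.divisors.card * x := by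
  classical
  calc _ ≤ ∑ n ∈ Finset.Icc 1 ⌊x⌋₊, ∑ d ∈ c.divisors, (if d ∣ n then Real.sqrt d else 0) := by
        refine Finset.sum_le_sum fun n _ => ?_
        have h := Finset.single_le_sum (s := c.divisors) (f := fun d => if d ∣ n then Real.sqrt d else 0)
          (fun d _ => by positivity) (a := Nat.gcd n c)
          (Nat.mem_divisors.2 ⟨Nat.gcd_dvd_right _ _, by omega⟩)
        simp only [if_pos (Nat.gcd_dvd_left n c)] at h
        rw [Int.gcd_natCast_natCast]
        exact h
    _ = ∑ d ∈ c.divisors, ∑ n ∈ Finset.Icc 1 ⌊x⌋₊, (if d ∣ n then Real.sqrt d else 0) := Finset.sum_comm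
    _ ≤ ∑ d ∈ c.divisors, x := by
        refine Finset.sum_le_sum fun d hd => ?_
        have hd1 : 1 ≤ d := Nat.pos_of_mem_divisors hd
        have hd1' : (1 : ℝ) ≤ d := by exact_mod_cast hd1
        rw [← Finset.sum_filter, Finset.sum_const, nsmul_eq_mul]
        have e : (Finset.Icc 1 ⌊x⌋₊).filter (d ∣ ·) = (Finset.Ioc 0 ⌊x⌋₊).filter (d ∣ ·) := rfl
        rw [e, Nat.Ioc_filter_dvd_card_eq_div]
        have h1 : ((⌊x⌋₊ / d : ℕ) : ℝ) ≤ x / d :=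
          Nat.cast_div_le.trans (div_le_div_of_nonneg_right (Nat.floor_le (by linarith)) (by linarith))
        have h2 : Real.sqrt d ≤ d := by
          rw [Real.sqrt_le_left (by linarith)]; nlinarith
        calc _ ≤ x / d * d := mul_le_mul h1 h2 (Real.sqrt_nonneg _) (by positivity)
          _ = x := div_mul_cancel₀ _ (by linarith)
    _ = _ := by rw [Finset.sum_const, nsmul_eq_mul]

theorem stmt11 (ε : ℝ) (hε : 0 < ε) :
    ∃ C : ℝ, ∀ (m : ℤ) (c : ℕ), 1 ≤ c → ∀ x : ℝ, 1 ≤ x →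
      ∑ n ∈ Finset.Icc 1 ⌊x⌋₊, ‖kloos (n : ℤ) m c‖ ≤ C * (c : ℝ) ^ ((1:ℝ)/2 + ε) * x := by
  obtain ⟨C, hC, h⟩ := tau_bound (ε / 4) (by linarith)
  refine ⟨C ^ 4, fun m c hc x hx => ?_⟩
  have : NeZero c := ⟨by omega⟩
  have hc0 : (0 : ℝ) < c := by exact_mod_cast hc
  calc _ ≤ ∑ n ∈ Finset.Icc 1 ⌊x⌋₊, (c.divisors.card : ℝ) ^ 3 * Real.sqrt c * Real.sqrt (Int.gcd (n : ℤ) c) := by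
        refine Finset.sum_le_sum fun n _ => ?_
        rw [kloos_eq]
        refine (KS_bound c n m).trans (le_of_eq (by ring))
    _ = (c.divisors.card : ℝ) ^ 3 * Real.sqrt c * ∑ n ∈ Finset.Icc 1 ⌊x⌋₊, Real.sqrt (Int.gcd (n : ℤ) c) := by
        rw [Finset.mul_sum]
    _ ≤ (c.divisors.card : ℝ) ^ 3 * Real.sqrt c * (c.divisors.card * x) :=
        mul_le_mul_of_nonneg_left (gcd_sum c hc x hx) (by positivity)
    _ = (c.divisors.card : ℝ) ^ 4 * (Real.sqrt c * x) := by ring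
    _ ≤ (C * (c : ℝ) ^ (ε / 4)) ^ 4 * (Real.sqrt c * x) :=
        mul_le_mul_of_nonneg_right (pow_le_pow_left₀ (by positivity) (h c hc) 4)
          (mul_nonneg (Real.sqrt_nonneg _) (by linarith))
    _ = _ := by
        have e : ((c : ℝ) ^ (ε / 4)) ^ 4 = (c : ℝ) ^ ε := by
          rw [← Real.rpow_natCast, ← Real.rpow_mul hc0.le]; congr 1; push_cast; ring
        rw [mul_pow, e, Real.rpow_add hc0, Real.sqrt_eq_rpow]; ring
end

section
/- Let a > 0 and b be real numbers, and let ψ: ℝ → ℂ be a smooth compactly supported function. Then ∫_ℝ e^{−8πi a (v + b)²} ψ(v) dv = (e^{−iπ/4}/√(8a)) ∫_ℝ ψ̂(t) e^{2πi( t²/(16a) − b t )} dt. -/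
open Complex MeasureTheory Filter Topology FourierTransform in
theorem stmt14_aux (c : ℂ) (hc : 0 < c.re) (b : ℝ) (ψ : ℝ → ℂ) (hψ : Integrable ψ) :
    ∫ t : ℝ, 𝓕 ψ t * cexp (-Real.pi * c * t ^ 2 + 2 * Real.pi * (-I * b) * t)
      = 1 / c ^ (1 / 2 : ℂ) * ∫ v : ℝ, cexp (-Real.pi / c * (v + b) ^ 2) * ψ v := by
  have hG : Integrable (fun t : ℝ => cexp (-Real.pi * c * t ^ 2 + 2 * Real.pi * (-I * b) * t)) := by
    have := integrable_cexp_quadratic (b := Real.pi * c)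
      (by rw [re_ofReal_mul]; exact mul_pos Real.pi_pos hc) (2 * Real.pi * (-I * b)) 0
    refine this.congr (ae_of_all _ fun t => ?_)
    simp only [add_zero, neg_mul]
  have h := VectorFourier.integral_fourierIntegral_smul_eq_flip (μ := volume) (ν := volume)
    (L := innerₗ ℝ) Real.continuous_fourierChar continuous_inner hψ hG
  rw [flip_innerₗ] at h
  have h1 := fourier_gaussian_pi' hc (-I * b)
  have h' : ∫ t : ℝ, 𝓕 ψ t * cexp (-Real.pi * c * t ^ 2 + 2 * Real.pi * (-I * b) * t)
      = ∫ v : ℝ, ψ v * 𝓕 (fun t : ℝ =>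
        cexp (-Real.pi * c * t ^ 2 + 2 * Real.pi * (-I * b) * t)) v := h
  rw [h', h1, ← integral_const_mul]
  congr 1
  ext v
  have : I * (-I * b) = (b : ℂ) := by
    rw [← mul_assoc, mul_neg, I_mul_I]; ring
  rw [this]; ring

theorem norm_exp_le_one_aux (z : ℂ) (hz : z.re ≤ 0) : ‖Complex.exp z‖ ≤ 1 := by
  rw [Complex.norm_exp]; exact Real.exp_le_one_iff.2 hz

open Complex MeasureTheory Filter Topology FourierTransform in
theorem stmt14 (a b : ℝ) (ha : 0 < a) (ψ : ℝ → ℂ)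
    (hsm : ContDiff ℝ (⊤ : ℕ∞) ψ) (hcs : HasCompactSupport ψ) :
    ∫ v : ℝ, ee (-(4 * a * (v + b) ^ 2)) * ψ v
      = (Complex.exp (-Complex.I * Real.pi / 4) / ((Real.sqrt (8 * a) : ℝ) : ℂ)) *
        ∫ t : ℝ, fhat ψ t * ee (t ^ 2 / (16 * a) - b * t) := by
  have hψ : Integrable ψ := hsm.continuous.integrable_of_hasCompactSupport hcs
  have hF : Integrable (𝓕 ψ) := by
    have := (𝓕 (hcs.toSchwartzMap hsm)).integrable (μ := volume)
    exact this
  have hfh : fhat ψ = 𝓕 ψ := by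
    ext t
    rw [Real.fourier_real_eq_integral_exp_smul, fhat]
    congr 1; ext v
    rw [ee, smul_eq_mul, mul_comm]
    congr 2; push_cast; ring
  have ha' : (a : ℂ) ≠ 0 := by exact_mod_cast ha.ne'
  set c : ℝ → ℂ := fun ε => ε - I / (8 * a) with hcdef
  have hcv : ∀ ε, c ε = (ε : ℂ) + ((-(1 / (8 * a)) : ℝ) : ℂ) * I := by
    intro ε; simp only [hcdef]; push_cast; ring
  have hre : ∀ ε, (c ε).re = ε := by intro ε; rw [hcv]; simp
  have him : ∀ ε, (c ε).im = -(1 / (8 * a)) := by intro ε; rw [hcv]; simp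
  have him0 : ∀ ε, (c ε).im ≠ 0 := by
    intro ε; rw [him]; exact neg_ne_zero.2 (by positivity)
  have hc0 : ∀ ε, c ε ≠ 0 := fun ε h => him0 ε (by rw [h]; simp)
  have hcc : Continuous c := by simp only [hcdef]; fun_prop
  have hct : Tendsto c (𝓝[>] 0) (𝓝 (c 0)) := (hcc.tendsto 0).mono_left nhdsWithin_le_nhds
  have hpos : ∀ᶠ ε : ℝ in 𝓝[>] 0, 0 < ε := eventually_mem_nhdsWithin
  have L : Tendsto (fun ε => ∫ t : ℝ, 𝓕 ψ t *
      cexp (-Real.pi * c ε * t ^ 2 + 2 * Real.pi * (-I * b) * t)) (𝓝[>] 0)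
      (𝓝 (∫ t : ℝ, 𝓕 ψ t * cexp (-Real.pi * c 0 * t ^ 2 + 2 * Real.pi * (-I * b) * t))) := by
    refine tendsto_integral_filter_of_dominated_convergence (fun t => ‖𝓕 ψ t‖) ?_ ?_ hF.norm ?_
    · refine Eventually.of_forall fun ε => hF.aestronglyMeasurable.mul ?_
      exact Continuous.aestronglyMeasurable (by fun_prop)
    · filter_upwards [hpos] with ε hε
      refine ae_of_all _ fun t => ?_
      rw [norm_mul]
      refine mul_le_of_le_one_right (norm_nonneg _) (norm_exp_le_one_aux _ ?_)
      have : (-Real.pi * c ε * t ^ 2 + 2 * Real.pi * (-I * b) * t : ℂ)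
        = ((-Real.pi * t ^ 2 : ℝ) : ℂ) * c ε + ((-(2 * Real.pi * b * t) : ℝ) : ℂ) * I := by
        push_cast; ring
      rw [this, add_re, re_ofReal_mul, re_ofReal_mul, hre, I_re]
      have := mul_nonneg (mul_nonneg Real.pi_pos.le (sq_nonneg t)) hε.le
      linarith
    · refine ae_of_all _ fun t => Tendsto.const_mul _ ?_
      exact (continuous_exp.tendsto _).comp
        (((hct.const_mul _).mul_const _).add_const _)
  have R : Tendsto (fun ε => ∫ v : ℝ, cexp (-Real.pi / c ε * (v + b) ^ 2) * ψ v) (𝓝[>] 0)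
      (𝓝 (∫ v : ℝ, cexp (-Real.pi / c 0 * (v + b) ^ 2) * ψ v)) := by
    refine tendsto_integral_filter_of_dominated_convergence (fun t => ‖ψ t‖) ?_ ?_ hψ.norm ?_
    · refine Eventually.of_forall fun ε => AEStronglyMeasurable.mul ?_ hψ.aestronglyMeasurable
      exact Continuous.aestronglyMeasurable (by fun_prop)
    · filter_upwards [hpos] with ε hε
      refine ae_of_all _ fun t => ?_
      rw [norm_mul]
      refine mul_le_of_le_one_left (norm_nonneg _) (norm_exp_le_one_aux _ ?_)
      have : (-Real.pi / c ε * (t + b) ^ 2 : ℂ)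
        = ((-Real.pi * (t + b) ^ 2 : ℝ) : ℂ) * (c ε)⁻¹ := by
        push_cast; ring
      rw [this, re_ofReal_mul, inv_re, hre]
      have := mul_nonneg (mul_nonneg Real.pi_pos.le (sq_nonneg (t + b)))
        (div_nonneg hε.le (normSq_nonneg (c ε)))
      linarith
    · refine ae_of_all _ fun t => Tendsto.mul_const _ ?_
      exact (continuous_exp.tendsto _).comp
        ((tendsto_const_nhds.div hct (hc0 0)).mul_const _)
  have hslit : c 0 ∈ slitPlane := Or.inr (him0 0)
  have hP : Tendsto (fun ε => 1 / (c ε) ^ (1 / 2 : ℂ)) (𝓝[>] 0)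
      (𝓝 (1 / (c 0) ^ (1 / 2 : ℂ))) := by
    refine tendsto_const_nhds.div ?_ ?_
    · exact hct.cpow tendsto_const_nhds hslit
    · simp [cpow_eq_zero_iff, hc0]
  have key := tendsto_nhds_unique (L.congr' (by
    filter_upwards [hpos] with ε hε
    exact stmt14_aux (c ε) (by rw [hre]; exact hε) b ψ hψ)) (hP.mul R)
  have hs : ((Real.sqrt (8 * a) : ℝ) : ℂ) ^ 2 = 8 * a := by
    rw [← ofReal_pow, Real.sq_sqrt (by positivity)]; push_cast; ring
  have hsq : c 0 ^ (1 / 2 : ℂ)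
      = Complex.exp (-Complex.I * Real.pi / 4) / ((Real.sqrt (8 * a) : ℝ) : ℂ) := by
    have h2 : c 0 = (Complex.exp (-Complex.I * Real.pi / 4) / ((Real.sqrt (8 * a) : ℝ) : ℂ)) ^ 2 := by
      rw [div_pow, hs, ← Complex.exp_nat_mul]
      have : ((2 : ℕ) : ℂ) * (-I * Real.pi / 4) = -(Real.pi / 2 * I) := by push_cast; ring
      rw [this, Complex.exp_neg, exp_pi_div_two_mul_I, inv_I]
      simp only [hcdef]; push_cast; ring
    rw [h2, one_div, Complex.sq_cpow_two_inv]
    rw [div_ofReal_re]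
    have : -I * Real.pi / 4 = ((-(Real.pi / 4) : ℝ) : ℂ) * I := by push_cast; ring
    rw [this, exp_ofReal_mul_I_re, Real.cos_neg, Real.cos_pi_div_four]
    positivity
  have hne : c 0 ^ (1 / 2 : ℂ) ≠ 0 := by simp [cpow_eq_zero_iff, hc0]
  have e1 : ∀ v : ℝ, ee (-(4 * a * (v + b) ^ 2)) = cexp (-Real.pi / c 0 * (v + b) ^ 2) := by
    intro v
    rw [ee]
    congr 1
    have : -(Real.pi : ℂ) / c 0 = -8 * Real.pi * a * I := by
      rw [div_eq_iff (hc0 0)]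
      simp only [hcdef]
      field_simp
      push_cast
      linear_combination (-1 : ℂ) * I_sq
    rw [this]; push_cast; ring
  have e2 : ∀ t : ℝ, ee (t ^ 2 / (16 * a) - b * t)
      = cexp (-Real.pi * c 0 * t ^ 2 + 2 * Real.pi * (-I * b) * t) := by
    intro t
    rw [ee]
    congr 1
    simp only [hcdef]
    push_cast
    field_simp
    ring
  simp_rw [hfh, e1, e2]
  rw [key, ← hsq]
  field_simp
end
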